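/- For every finite simple graph G, if mad(G) ≤ 8/3 (that is, every nonempty vertex subset A spans at most 4|A|/3 edges, i.e. 3·e(A) ≤ 4·|A|), then G has an FII-partition: a partition of V(G) into sets F, Iα, Iβ such that the subgraph induced on F is a forest and each of Iα and Iβ is a 2-independent set of G. -/

import Mathlib

open scoped Classical

/-- `S` is a *2-independent set* of `G`: any two distinct vertices of `S` are at
distance at least 3 in `G`, i.e. they are non-adjacent and have no common neighbor. -/
def TwoIndepSet {W : Type*} (G : SimpleGraph W) (S : Set W) : Prop :=
  ∀ u ∈ S, ∀ v ∈ S, u ≠ v → ¬G.Adj u v ∧ ∀ w, ¬(G.Adj u w ∧ G.Adj w v)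

/-- `F ⊔ A ⊔ B` is an *FII-partition* of `G`: the three sets partition the vertex set,
the subgraph induced on `F` is a forest (acyclic), and `A`, `B` are 2-independent sets. -/
def IsFIIPartition {W : Type*} (G : SimpleGraph W) (F A B : Set W) : Prop :=
  (∀ v, v ∈ F ∨ v ∈ A ∨ v ∈ B) ∧
    Disjoint F A ∧ Disjoint F B ∧ Disjoint A B ∧
    (G.induce F).IsAcyclic ∧ TwoIndepSet G A ∧ TwoIndepSet G B

/-- `G` admits some FII-partition. -/
def HasFIIPartition {W : Type*} (G : SimpleGraph W) : Prop :=
  ∃ F A B, IsFIIPartition G F A B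

/-- The number of edges of `G` with both endpoints in the vertex subset `A`. -/
noncomputable def edgesIn {W : Type*} [Fintype W] (G : SimpleGraph W) (A : Finset W) : ℕ :=
  (Finset.univ.filter fun e : Sym2 W => e ∈ G.edgeSet ∧ ∀ v ∈ e, v ∈ A).card

/-- Multiplicities of the labels attached to a vertex. -/
structure LV where
  t : ℕ
  b : ℕ
  ka : ℕ
  kb : ℕ
  l : ℕ
  sa : ℕ
  sb : ℕ
  sr : ℕ
deriving DecidableEq

namespace LV

instance : Zero LV := ⟨⟨0, 0, 0, 0, 0, 0, 0, 0⟩⟩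

instance : Add LV :=
  ⟨fun x y => ⟨x.t + y.t, x.b + y.b, x.ka + y.ka, x.kb + y.kb, x.l + y.l,
    x.sa + y.sa, x.sb + y.sb, x.sr + y.sr⟩⟩

def cost (x : LV) : ℕ := x.t + x.b + x.ka + x.kb + x.l + 3 * (x.sa + x.sb + x.sr)

/-- A vertex of colour `s` carrying the labels `x` honours them when it keeps `k s'` places free
in each of its slots (`some c`) and at its root (`none`). -/
def Meets (x : LV) (s : Option Bool) (k : Option Bool → ℕ) : Prop :=
  match s with
  | some c => x.sa = 0 ∧ x.sb = 0 ∧ x.sr = 0 ∧ x.b + (if c then x.l else 0) ≤ k (some !c)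
  | none =>
    x.sa ≤ k (some true) ∧ x.sb ≤ k (some false) ∧ x.sr ≤ k none ∧
    x.sa + x.sb + x.t ≤ k (some true) + k (some false) ∧
    x.sa + x.sr + x.ka ≤ k (some true) + k none ∧
    x.sb + x.sr + x.kb ≤ k (some false) + k none ∧
    x.sa + x.sb + x.sr + x.t + x.ka + x.kb + x.l ≤ k (some true) + k (some false) + k none

instance (x : LV) (s : Option Bool) (k : Option Bool → ℕ) : Decidable (Meets x s k) :=
  match s with
  | some c => inferInstanceAs (Decidable (x.sa = 0 ∧ x.sb = 0 ∧ x.sr = 0 ∧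
      x.b + (if c then x.l else 0) ≤ k (some !c)))
  | none => inferInstanceAs (Decidable (x.sa ≤ k (some true) ∧ x.sb ≤ k (some false) ∧
      x.sr ≤ k none ∧ x.sa + x.sb + x.t ≤ k (some true) + k (some false) ∧
      x.sa + x.sr + x.ka ≤ k (some true) + k none ∧
      x.sb + x.sr + x.kb ≤ k (some false) + k none ∧
      x.sa + x.sb + x.sr + x.t + x.ka + x.kb + x.l ≤ k (some true) + k (some false) + k none))

end LV

open LV

section Colouring

variable {V : Type*} (G : SimpleGraph V)

noncomputable def nb (D : Finset V) (col : V → Option Bool) (v : V) (s : Option Bool) : ℕ :=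
  (D.filter fun u => G.Adj v u ∧ col u = s).card

structure Raw (D : Finset V) (col : V → Option Bool) (σ : V → Option Bool → ℕ) : Prop where
  slot : ∀ v ∈ D, ∀ c, col v ≠ some c → nb G D col v (some c) + σ v (some c) ≤ 1
  same : ∀ v ∈ D, ∀ c, col v = some c → nb G D col v (some c) = 0
  peel : ∀ S ⊆ D, S.Nonempty → (∀ v ∈ S, col v = none) →
    ∃ v ∈ S, (S.filter (G.Adj v)).card + σ v none ≤ 1

variable {G}

theorem nb_union {A B : Finset V} (h : Disjoint A B) (col : V → Option Bool) (v s) :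
    nb G (A ∪ B) col v s = nb G A col v s + nb G B col v s := by
  unfold nb
  rw [Finset.filter_union, Finset.card_union_of_disjoint]
  exact Finset.disjoint_filter_filter h

theorem nb_congr {A : Finset V} {col col' : V → Option Bool} (h : ∀ v ∈ A, col v = col' v) (v s) :
    nb G A col v s = nb G A col' v s := by
  unfold nb
  congr 1
  apply Finset.filter_congr
  intro u hu
  rw [h u hu]

theorem nb_eq_zero {A : Finset V} {col : V → Option Bool} {v s}
    (h : ∀ u ∈ A, G.Adj v u → col u ≠ s) : nb G A col v s = 0 := by
  unfold nb
  rw [Finset.card_eq_zero, Finset.filter_eq_empty_iff]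
  rintro u hu ⟨h1, h2⟩
  exact h u hu h1 h2

theorem ne_of_nb_eq_zero {A : Finset V} {col : V → Option Bool} {v s}
    (h : nb G A col v s = 0) {u} (hu : u ∈ A) (ha : G.Adj v u) : col u ≠ s := by
  unfold nb at h
  rw [Finset.card_eq_zero, Finset.filter_eq_empty_iff] at h
  intro hc
  exact h hu ⟨ha, hc⟩

theorem Raw.congr {D : Finset V} {col col' : V → Option Bool} {σ σ' : V → Option Bool → ℕ}
    (h : Raw G D col σ) (hc : ∀ v ∈ D, col v = col' v) (hs : ∀ v ∈ D, ∀ s, σ' v s ≤ σ v s) :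
    Raw G D col' σ' where
  slot v hv c h1 := by
    rw [← nb_congr hc]
    have := h.slot v hv c (by rwa [hc v hv])
    have := hs v hv (some c)
    omega
  same v hv c h1 := by
    rw [← nb_congr hc]
    exact h.same v hv c (by rwa [hc v hv])
  peel S hS hne hn := by
    obtain ⟨v, hv, h1⟩ := h.peel S hS hne (fun v hv => by rw [hc v (hS hv)]; exact hn v hv)
    have := hs v (hS hv) none
    exact ⟨v, hv, by omega⟩

theorem Raw.glue {A B : Finset V} {col : V → Option Bool} {σA σB σ : V → Option Bool → ℕ}
    (hAB : Disjoint A B) (h1 : Raw G A col σA) (h2 : Raw G B col σB)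
    (hA : ∀ v ∈ A, ∀ c, col v ≠ some c → σ v (some c) + nb G B col v (some c) ≤ σA v (some c))
    (hA0 : ∀ v ∈ A, σ v none ≤ σA v none)
    (hB : ∀ v ∈ B, ∀ c, col v ≠ some c → σ v (some c) + nb G A col v (some c) ≤ σB v (some c))
    (hB0 : ∀ v ∈ B, col v = none → σ v none + nb G A col v none ≤ σB v none)
    (hs : ∀ u ∈ A, ∀ v ∈ B, G.Adj u v → ∀ c, col u = some c → col v ≠ some c) :
    Raw G (A ∪ B) col σ where
  slot v hv c hc := by
    rw [nb_union hAB]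
    rcases Finset.mem_union.1 hv with hv | hv
    · have := h1.slot v hv c hc
      have := hA v hv c hc
      omega
    · have := h2.slot v hv c hc
      have := hB v hv c hc
      omega
  same v hv c hc := by
    rw [nb_union hAB]
    rcases Finset.mem_union.1 hv with hv | hv
    · rw [h1.same v hv c hc, zero_add]
      exact nb_eq_zero fun u hu ha => hs v hv u hu ha c hc
    · rw [h2.same v hv c hc, add_zero]
      exact nb_eq_zero fun u hu ha he => hs u hu v hv ha.symm c he hc
  peel S hS hne hn := by
    by_cases hSB : (S ∩ B).Nonempty
    · obtain ⟨v, hv, h3⟩ := h2.peel (S ∩ B) Finset.inter_subset_right hSB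
        (fun v hv => hn v (Finset.mem_inter.1 hv).1)
      obtain ⟨hvS, hvB⟩ := Finset.mem_inter.1 hv
      refine ⟨v, hvS, ?_⟩
      have h4 := hB0 v hvB (hn v hvS)
      have h5 : (S.filter (G.Adj v)).card ≤
          ((S ∩ B).filter (G.Adj v)).card + nb G A col v none := by
        unfold nb
        refine le_trans (Finset.card_le_card ?_) (Finset.card_union_le _ _)
        intro u hu
        obtain ⟨hu, ha⟩ := Finset.mem_filter.1 hu
        simp only [Finset.mem_union, Finset.mem_filter, Finset.mem_inter]
        rcases Finset.mem_union.1 (hS hu) with h | h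
        · exact Or.inr ⟨h, ha, hn u hu⟩
        · exact Or.inl ⟨⟨hu, h⟩, ha⟩
      omega
    · have hSA : S ⊆ A := by
        intro u hu
        rcases Finset.mem_union.1 (hS hu) with h | h
        · exact h
        · exact absurd ⟨u, Finset.mem_inter.2 ⟨hu, h⟩⟩ hSB
      obtain ⟨v, hv, h3⟩ := h1.peel S hSA hne hn
      have := hA0 v (hSA hv)
      exact ⟨v, hv, by omega⟩

/-- The colour of a vertex together with places still available at it. -/
structure Nd where
  c : Option Bool
  a : Bool
  b : Bool
  r : Bool

namespace Nd

def sp (n : Nd) : Option Bool → Bool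
  | some true => n.a
  | some false => n.b
  | none => n.r

def clear (n : Nd) : Option Bool → Nd
  | some true => { n with a := false }
  | some false => { n with b := false }
  | none => { n with r := false }

theorem sp_clear (n : Nd) (s s') : (n.clear s).sp s' = if s' = s then false else n.sp s' := by
  rcases s with _ | _ | _ <;> rcases s' with _ | _ | _ <;> rfl

theorem clear_c (n : Nd) (s) : (n.clear s).c = n.c := by
  rcases s with _ | _ | _ <;> rfl

end Nd

noncomputable def eps (ns : List (V × Nd)) (v : V) (s : Option Bool) : ℕ :=
  (ns.map fun p => if p.1 = v then (p.2.sp s).toNat else 0).sum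

theorem eps_nil (v : V) (s) : eps [] v s = 0 := rfl

theorem eps_cons (p) (ns : List (V × Nd)) (v : V) (s) :
    eps (p :: ns) v s = (if p.1 = v then (p.2.sp s).toNat else 0) + eps ns v s := by
  simp [eps]

theorem eps_append (ns ms : List (V × Nd)) (v : V) (s) :
    eps (ns ++ ms) v s = eps ns v s + eps ms v s := by
  simp [eps]

theorem eps_eq_zero {ns : List (V × Nd)} {v : V} (h : ∀ p ∈ ns, p.1 ≠ v) (s) :
    eps ns v s = 0 := by
  induction ns with
  | nil => rfl
  | cons p ns ih =>
    rw [eps_cons, if_neg (h p (by simp)), ih fun q hq => h q (by simp [hq])]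

variable (G) in
def St (ℓ : V → LV) (D : Finset V) (col : V → Option Bool) (ns : List (V × Nd)) : Prop :=
  ∃ κ : V → Option Bool → ℕ, Raw G D col (fun v s => κ v s + eps ns v s) ∧
    (∀ v ∈ D, Meets (ℓ v) (col v) (κ v)) ∧ ∀ p ∈ ns, p.1 ∈ D ∧ col p.1 = p.2.c

theorem St.congr {ℓ ℓ' : V → LV} {D : Finset V} {col col' : V → Option Bool} {ns : List (V × Nd)}
    (h : St G ℓ D col ns) (hc : ∀ v ∈ D, col v = col' v) (hl : ∀ v ∈ D, ℓ v = ℓ' v) :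
    St G ℓ' D col' ns := by
  obtain ⟨κ, h1, h2, h3⟩ := h
  refine ⟨κ, h1.congr hc fun _ _ _ => le_rfl, fun v hv => ?_, fun p hp => ?_⟩
  · rw [← hc v hv, ← hl v hv]; exact h2 v hv
  · rw [← hc _ (h3 p hp).1]; exact h3 p hp

theorem St.sub {ℓ : V → LV} {D : Finset V} {col : V → Option Bool} {ns ms : List (V × Nd)}
    (h : St G ℓ D col ns) (hms : ∀ p ∈ ms, p ∈ ns) (he : ∀ v s, eps ms v s ≤ eps ns v s) :
    St G ℓ D col ms := by
  obtain ⟨κ, h1, h2, h3⟩ := h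
  exact ⟨κ, h1.congr (fun _ _ => rfl) (fun v _ s => Nat.add_le_add_left (he v s) _), h2,
    fun p hp => h3 p (hms p hp)⟩

theorem St.sublist {ℓ : V → LV} {D : Finset V} {col : V → Option Bool} {ns ms : List (V × Nd)}
    (h : St G ℓ D col ns) (hms : ms.Sublist ns) : St G ℓ D col ms := by
  refine h.sub (fun p hp => hms.subset hp) fun v s => ?_
  exact (hms.map _).sum_le_sum (by simp)

theorem St.perm {ℓ : V → LV} {D : Finset V} {col : V → Option Bool} {ns ms : List (V × Nd)}
    (h : St G ℓ D col ns) (hms : ns.Perm ms) : St G ℓ D col ms := by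
  refine h.sub (fun p hp => hms.symm.subset hp) fun v s => ?_
  exact ((hms.map _).sum_eq).ge

variable (G) in
/-- Labels recording the coloured neighbours in `B`. -/
noncomputable def sl (B : Finset V) (col : V → Option Bool) (v : V) : LV :=
  ⟨0, 0, 0, 0, 0, nb G B col v (some true), nb G B col v (some false), nb G B col v none⟩

theorem nb_eq_zero_of_meets {x : LV} {B : Finset V} {col : V → Option Bool} {v : V} {c k}
    (h : Meets (x + sl G B col v) (some c) k) (s) : nb G B col v s = 0 := by
  obtain ⟨h1, h2, h3, -⟩ := h
  change _ + nb G B col v (some true) = 0 at h1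
  change _ + nb G B col v (some false) = 0 at h2
  change _ + nb G B col v none = 0 at h3
  rcases s with _ | _ | _ <;> omega

theorem LV.Meets.of_add_sl {x : LV} {B : Finset V} {col : V → Option Bool} {v : V} {s k}
    (h : Meets (x + sl G B col v) s k) :
    Meets x s (fun s' => k s' - nb G B col v s') ∧ (s = none → ∀ s', nb G B col v s' ≤ k s') := by
  rcases s with _ | c
  · obtain ⟨h1, h2, h3, h4, h5, h6, h7⟩ := h
    change x.sa + nb G B col v (some true) ≤ _ at h1
    change x.sb + nb G B col v (some false) ≤ _ at h2
    change x.sr + nb G B col v none ≤ _ at h3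
    change (x.sa + nb G B col v (some true)) + (x.sb + nb G B col v (some false)) + (x.t + 0) ≤ _
      at h4
    change (x.sa + nb G B col v (some true)) + (x.sr + nb G B col v none) + (x.ka + 0) ≤ _ at h5
    change (x.sb + nb G B col v (some false)) + (x.sr + nb G B col v none) + (x.kb + 0) ≤ _ at h6
    change (x.sa + nb G B col v (some true)) + (x.sb + nb G B col v (some false)) +
      (x.sr + nb G B col v none) + (x.t + 0) + (x.ka + 0) + (x.kb + 0) + (x.l + 0) ≤ _ at h7
    constructor
    · refine ⟨?_, ?_, ?_, ?_, ?_, ?_, ?_⟩ <;> dsimp only <;> omega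
    · rintro - (_ | _ | _) <;> omega
  · have h0 := nb_eq_zero_of_meets h
    obtain ⟨h1, h2, h3, h4⟩ := h
    change x.sa + _ = 0 at h1
    change x.sb + _ = 0 at h2
    change x.sr + _ = 0 at h3
    change x.b + 0 + (if c then x.l + 0 else 0) ≤ _ at h4
    refine ⟨⟨by omega, by omega, by omega, ?_⟩, by simp⟩
    dsimp only
    rw [h0]
    simpa using h4

theorem St.glue {ℓ : V → LV} {A B : Finset V} {col : V → Option Bool} {ns ms : List (V × Nd)}
    (hAB : Disjoint A B) (h1 : St G ℓ A col ns) (h2 : St G (fun v => ℓ v + sl G A col v) B col ms) :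
    St G ℓ (A ∪ B) col (ns ++ ms) := by
  obtain ⟨κA, hA1, hA2, hA3⟩ := h1
  obtain ⟨κB, hB1, hB2, hB3⟩ := h2
  have hnA : ∀ v ∈ A, v ∉ B := fun v hv hv' => Finset.disjoint_left.1 hAB hv hv'
  have hmsA : ∀ v ∈ A, ∀ s, eps ms v s = 0 := fun v hv s =>
    eps_eq_zero (fun p hp he => hnA v hv (by rw [← he]; exact (hB3 p hp).1)) s
  have hnsB : ∀ v ∈ B, ∀ s, eps ns v s = 0 := fun v hv s =>
    eps_eq_zero (fun p hp he => hnA v (by rw [← he]; exact (hA3 p hp).1) hv) s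
  have hcross : ∀ u ∈ A, ∀ v ∈ B, G.Adj u v → col v = none := by
    intro u hu v hv ha
    have := hB2 v hv
    rcases hcv : col v with _ | c
    · rfl
    · rw [hcv] at this
      exact absurd rfl (ne_of_nb_eq_zero (nb_eq_zero_of_meets this (col u)) hu ha.symm)
  refine ⟨fun v s => if v ∈ A then κA v s else κB v s - nb G A col v s,
    Raw.glue hAB hA1 hB1 ?_ ?_ ?_ ?_ ?_, ?_, ?_⟩
  · intro v hv c hc
    rw [nb_eq_zero (fun u hu ha he => by rw [hcross v hv u hu ha] at he; cases he)]
    simp only [eps_append, hmsA v hv, if_pos hv]; omega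
  · intro v hv
    simp only [eps_append, hmsA v hv, if_pos hv]; omega
  · intro v hv c hc
    have hvA : v ∉ A := fun h => hnA v h hv
    simp only [eps_append, hnsB v hv, if_neg hvA]
    rcases hcv : col v with _ | c'
    · have := hB2 v hv
      rw [hcv] at this
      have := (Meets.of_add_sl this).2 rfl (some c)
      omega
    · rw [nb_eq_zero (fun u hu ha he => by rw [hcross u hu v hv ha.symm] at hcv; cases hcv)]
      omega
  · intro v hv hcv
    have hvA : v ∉ A := fun h => hnA v h hv
    have := hB2 v hv
    rw [hcv] at this
    have := (Meets.of_add_sl this).2 rfl none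
    simp only [eps_append, hnsB v hv, if_neg hvA]
    omega
  · intro u hu v hv ha c hc
    rw [hcross u hu v hv ha]; simp
  · intro v hv
    by_cases hvA : v ∈ A
    · simp only [hvA, if_true]; exact hA2 v hvA
    · have hvB := (Finset.mem_union.1 hv).resolve_left hvA
      simp only [hvA, if_false]
      exact (Meets.of_add_sl (hB2 v hvB)).1
  · intro p hp
    rcases List.mem_append.1 hp with hp | hp
    · exact ⟨Finset.mem_union_left _ (hA3 p hp).1, (hA3 p hp).2⟩
    · exact ⟨Finset.mem_union_right _ (hB3 p hp).1, (hB3 p hp).2⟩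

end Colouring

/-- Combinations of extra labels that a vertex may receive. -/
inductive PL
  | O | T | B | K (c : Bool) | L | TT | TB

namespace PL

def lv : PL → LV
  | O => ⟨0, 0, 0, 0, 0, 0, 0, 0⟩
  | T => ⟨1, 0, 0, 0, 0, 0, 0, 0⟩
  | B => ⟨0, 1, 0, 0, 0, 0, 0, 0⟩
  | K true => ⟨0, 0, 1, 0, 0, 0, 0, 0⟩
  | K false => ⟨0, 0, 0, 1, 0, 0, 0, 0⟩
  | L => ⟨0, 0, 0, 0, 1, 0, 0, 0⟩
  | TT => ⟨2, 0, 0, 0, 0, 0, 0, 0⟩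
  | TB => ⟨1, 1, 0, 0, 0, 0, 0, 0⟩

def drop : PL → List Nd
  | O => [⟨some true, false, false, false⟩, ⟨some false, false, false, false⟩,
      ⟨none, false, false, false⟩]
  | T => [⟨some true, false, false, false⟩, ⟨some false, false, false, false⟩,
      ⟨none, true, false, false⟩, ⟨none, false, true, false⟩]
  | B => [⟨some true, false, true, false⟩, ⟨some false, true, false, false⟩,
      ⟨none, false, false, false⟩]
  | K true => [⟨some true, false, false, false⟩, ⟨some false, false, false, false⟩,
      ⟨none, true, false, false⟩, ⟨none, false, false, true⟩]
  | K false => [⟨some true, false, false, false⟩, ⟨some false, false, false, false⟩,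
      ⟨none, false, true, false⟩, ⟨none, false, false, true⟩]
  | L => [⟨some true, false, true, false⟩, ⟨some false, false, false, false⟩,
      ⟨none, true, false, false⟩, ⟨none, false, true, false⟩, ⟨none, false, false, true⟩]
  | TT => [⟨some true, false, false, false⟩, ⟨some false, false, false, false⟩,
      ⟨none, true, true, false⟩]
  | TB => [⟨some true, false, true, false⟩, ⟨some false, true, false, false⟩,
      ⟨none, true, false, false⟩, ⟨none, false, true, false⟩]

end PL

/-- Consumption given by its values at the two slots and the root. -/
def kf (a b r : ℕ) : Option Bool → ℕ
  | some true => a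
  | some false => b
  | none => r

theorem LV.add_eq (x y : LV) : x + y = ⟨x.t + y.t, x.b + y.b, x.ka + y.ka, x.kb + y.kb, x.l + y.l,
    x.sa + y.sa, x.sb + y.sb, x.sr + y.sr⟩ := rfl

theorem LV.zero_eq : (0 : LV) = ⟨0, 0, 0, 0, 0, 0, 0, 0⟩ := rfl

theorem meets_some {x : LV} {c k} : Meets x (some c) k ↔ x.sa = 0 ∧ x.sb = 0 ∧ x.sr = 0 ∧
      x.b + (if c then x.l else 0) ≤ k (some !c) := Iff.rfl

theorem meets_none {x : LV} {k} : Meets x none k ↔ x.sa ≤ k (some true) ∧ x.sb ≤ k (some false) ∧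
      x.sr ≤ k none ∧ x.sa + x.sb + x.t ≤ k (some true) + k (some false) ∧
      x.sa + x.sr + x.ka ≤ k (some true) + k none ∧
      x.sb + x.sr + x.kb ≤ k (some false) + k none ∧
      x.sa + x.sb + x.sr + x.t + x.ka + x.kb + x.l ≤ k (some true) + k (some false) + k none :=
  Iff.rfl

theorem LV.Meets.drop {x : LV} {y : PL} {s : Option Bool} {k : Option Bool → ℕ}
    (h : Meets (x + y.lv) s k)
    (hk : s = none → k (some true) ≤ 1 ∧ k (some false) ≤ 1) :
    ∃ n ∈ y.drop, n.c = s ∧ ∃ k', Meets x s k' ∧ ∀ s', k' s' + (n.sp s').toNat ≤ k s' := by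
  obtain ⟨t, b, ka, kb, l, sa, sb, sr⟩ := x
  obtain ⟨A, hA⟩ : ∃ A, A = k (some true) := ⟨_, rfl⟩
  obtain ⟨B, hB⟩ : ∃ B, B = k (some false) := ⟨_, rfl⟩
  obtain ⟨R, hR⟩ : ∃ R, R = k none := ⟨_, rfl⟩
  by_contra hcon
  have key : ∀ n ∈ y.drop, n.c = s → n.a.toNat ≤ A → n.b.toNat ≤ B → n.r.toNat ≤ R →
      ¬ Meets ⟨t, b, ka, kb, l, sa, sb, sr⟩ s
      (kf (A - n.a.toNat) (B - n.b.toNat) (R - n.r.toNat)) := by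
    intro n hn hs h1 h2 h3 h4
    refine hcon ⟨n, hn, hs, _, h4, ?_⟩
    rintro (_ | _ | _) <;> simp only [kf, Nd.sp] <;> omega
  clear hcon
  rcases s with _ | c
  · obtain ⟨hk1, hk2⟩ := hk rfl
    rcases y with _ | _ | _ | (_ | _) | _ | _ | _ <;>
    simp only [PL.drop, PL.lv, LV.add_eq, meets_none, List.forall_mem_cons, kf,
      reduceCtorEq, false_imp_iff, true_and, List.not_mem_nil, imp_true_iff,
      and_true, Bool.toNat_false, Bool.toNat_true, forall_const, ← hA, ← hB, ← hR] at key h hk1 hk2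
    all_goals omega
  · rcases c with _ | _ <;> rcases y with _ | _ | _ | (_ | _) | _ | _ | _ <;>
    simp only [PL.drop, PL.lv, LV.add_eq, meets_some, List.forall_mem_cons, kf,
      reduceCtorEq, false_imp_iff, true_and, List.not_mem_nil, imp_true_iff, Option.some.injEq,
      and_true, Bool.toNat_false, Bool.toNat_true, forall_const, Bool.not_true, Bool.not_false,
      if_true, if_false, ← hA, ← hB] at key h
    all_goals omega

section
variable {V : Type*} {G : SimpleGraph V}

noncomputable def addl (ℓ : V → LV) : List (V × PL) → V → LV
  | [], v => ℓ v
  | (p, x) :: ps, v => addl ℓ ps v + if v = p then x.lv else 0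

theorem St.drop {ℓ : V → LV} {D : Finset V} {col : V → Option Bool} {ns : List (V × Nd)} {p : V}
    {y : PL} (h : St G (fun v => ℓ v + if v = p then y.lv else 0) D col ns) (hp : p ∈ D) :
    ∃ n ∈ y.drop, St G ℓ D col ((p, n) :: ns) := by
  obtain ⟨κ, h1, h2, h3⟩ := h
  have hm := h2 p hp
  simp only [if_true] at hm
  obtain ⟨n, hn, hc, k', hk, hle⟩ := hm.drop (fun hs => by
    have ha := h1.slot p hp true (by simp [hs])
    have hb := h1.slot p hp false (by simp [hs])
    omega)
  refine ⟨n, hn, fun v => if v = p then k' else κ v, ?_, ?_, ?_⟩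
  · refine h1.congr (fun _ _ => rfl) fun v _ s => ?_
    rw [eps_cons]
    by_cases hv : v = p
    · subst hv
      have := hle s
      simp only [if_true]; omega
    · simp only [if_neg hv, if_neg (Ne.symm hv)]; omega
  · intro v hv
    by_cases hvp : v = p
    · subst hvp; simpa using hk
    · have := h2 v hv
      simp only [if_neg hvp] at this ⊢
      exact this
  · rintro q hq
    rcases List.mem_cons.1 hq with rfl | hq
    · exact ⟨hp, hc.symm⟩
    · exact h3 q hq

theorem St.drop_all {ℓ : V → LV} {D : Finset V} {col : V → Option Bool} :
    ∀ (ps : List (V × PL)) (ms : List (V × Nd)), St G (addl ℓ ps) D col ms → (∀ p ∈ ps, p.1 ∈ D) →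
    ∃ ns, List.Forall₂ (fun n y => n ∈ PL.drop y) ns (ps.map Prod.snd) ∧
      St G ℓ D col ((ps.map Prod.fst).zip ns ++ ms)
  | [], ms, h, _ => ⟨[], by simp, h⟩
  | (p, x) :: ps, ms, h, hp => by
    obtain ⟨n, hn, h1⟩ := St.drop (ℓ := addl ℓ ps) (p := p) (y := x) h (hp (p, x) (by simp))
    obtain ⟨ns, h2, h3⟩ := St.drop_all ps ((p, n) :: ms) h1 (fun q hq => hp q (by simp [hq]))
    refine ⟨n :: ns, List.Forall₂.cons hn h2, h3.perm ?_⟩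
    simp only [List.map_cons, List.zip_cons_cons, List.cons_append]
    exact List.perm_middle
end

/-- A colour for a new vertex together with the consumption honouring its labels. -/
structure Op where
  s : Option Bool
  a : ℕ
  b : ℕ
  r : ℕ
deriving DecidableEq

namespace Op

def k (o : Op) : Option Bool → ℕ := kf o.a o.b o.r

def all : List Op :=
  [⟨some true, 0, 0, 0⟩, ⟨some false, 0, 0, 0⟩, ⟨some true, 0, 1, 0⟩, ⟨some false, 1, 0, 0⟩,
    ⟨none, 0, 0, 0⟩, ⟨none, 1, 0, 0⟩, ⟨none, 0, 1, 0⟩, ⟨none, 0, 0, 1⟩, ⟨none, 1, 1, 0⟩,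
    ⟨none, 1, 0, 1⟩, ⟨none, 0, 1, 1⟩, ⟨none, 1, 1, 1⟩]

def lt (o p : Op) : Bool :=
  o.s == p.s && decide (o.a ≤ p.a) && decide (o.b ≤ p.b) && decide (o.r ≤ p.r) && !(o == p)

end Op

/-- The minimal ways of colouring a vertex and honouring its labels. -/
def opts (x : LV) : List Op :=
  let M := Op.all.filter fun o => decide (Meets x o.s o.k)
  M.filter fun o => !(M.any fun p => p.lt o)

theorem meets_of_mem_opts {x : LV} {o : Op} (h : o ∈ opts x) : Meets x o.s o.k := by
  have := (List.mem_filter.1 (List.mem_filter.1 h).1).2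
  simpa using this

def cnt : List Bool → List Nd → Option Bool → ℕ
  | b :: m, n :: ns, s => (if b && (n.c == s) then 1 else 0) + cnt m ns s
  | _, _, _ => 0

def okm (P : Nd → Bool) : List Bool → List Nd → Bool
  | b :: m, n :: ns => (!b || P n) && okm P m ns
  | _, _ => true

def upd (P : Option Bool → Bool) (s : Option Bool) : List Bool → List Nd → List Nd
  | b :: m, n :: ns => (if b && P n.c then n.clear s else n) :: upd P s m ns
  | _, ns => ns

def step (m : List Bool) (ns : List Nd) (o : Op) : List (List Nd) :=
  match o.s with
  | some c =>
    if okm (fun n => !(n.c == some c) && n.sp (some c)) m ns &&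
        decide (cnt m ns (some !c) + o.k (some !c) ≤ 1) then
      [⟨some c, !c && decide (cnt m ns (some !c) + o.k (some !c) = 0),
        c && decide (cnt m ns (some !c) + o.k (some !c) = 0), false⟩ ::
        upd (fun _ => true) (some c) m ns]
    else []
  | none =>
    if decide (cnt m ns (some true) + o.a ≤ 1) && decide (cnt m ns (some false) + o.b ≤ 1) then
      (if decide (cnt m ns none + o.r ≤ 1) then
        [⟨none, decide (cnt m ns (some true) + o.a = 0), decide (cnt m ns (some false) + o.b = 0),
          decide (cnt m ns none + o.r = 0)⟩ :: ns] else []) ++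
      (if okm (fun n => !(n.c == none) || n.r) m ns && !decide (cnt m ns none = 0) &&
          decide (o.r ≤ 1) then
        [⟨none, decide (cnt m ns (some true) + o.a = 0), decide (cnt m ns (some false) + o.b = 0),
          decide (o.r = 0)⟩ :: upd (fun s => s == none) none m ns] else [])
    else []

theorem upd_length (P s) : ∀ m ns, (upd P s m ns).length = ns.length
  | [], ns => by simp [upd]
  | _ :: _, [] => by simp [upd]
  | b :: m, n :: ns => by simp [upd, upd_length P s m ns]

section
variable {V : Type*} {G : SimpleGraph V}

theorem card_le_cnt {col : V → Option Bool} {s : Option Bool} :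
    ∀ (m : List Bool) (locs : List V) (ns : List Nd) (X : Finset V),
    locs.length = ns.length → (∀ u ∈ X, (true, u) ∈ m.zip locs ∧ col u = s) →
    (∀ p ∈ locs.zip ns, col p.1 = p.2.c) → X.card ≤ cnt m ns s
  | [], locs, ns, X, _, h, _ => by
    rcases X.eq_empty_or_nonempty with rfl | ⟨u, hu⟩
    · simp
    · simpa using (h u hu).1
  | _ :: _, [], ns, X, _, h, _ => by
    rcases X.eq_empty_or_nonempty with rfl | ⟨u, hu⟩
    · simp
    · simpa using (h u hu).1
  | _ :: _, _ :: _, [], _, hl, _, _ => by simp at hl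
  | b :: m, l :: locs, n :: ns, X, hl, h, hc => by
    have hln : col l = n.c := hc (l, n) (by simp)
    have hl' : locs.length = ns.length := by simpa using hl
    have hc' : ∀ p ∈ locs.zip ns, col p.1 = p.2.c := fun p hp => hc p (by simp [hp])
    unfold cnt
    by_cases hb : b = true ∧ n.c = s
    · have := card_le_cnt m locs ns (X.erase l) hl' (fun u hu => by
        obtain ⟨h1, h2⟩ := Finset.mem_erase.1 hu
        obtain ⟨h3, h4⟩ := h u h2
        refine ⟨?_, h4⟩
        simpa [h1] using h3) hc'
      have h5 := Finset.pred_card_le_card_erase (s := X) (a := l)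
      simp only [hb.1, hb.2, beq_self_eq_true, Bool.and_self, if_true]
      omega
    · have := card_le_cnt m locs ns X hl' (fun u hu => by
        obtain ⟨h3, h4⟩ := h u hu
        refine ⟨?_, h4⟩
        simp only [List.zip_cons_cons, List.mem_cons, Prod.mk.injEq] at h3
        rcases h3 with ⟨h3, rfl⟩ | h3
        · exact absurd ⟨h3.symm, hln ▸ h4⟩ hb
        · exact h3) hc'
      omega

theorem eps_upd_le (P s) (v : V) (s') : ∀ (m : List Bool) (locs : List V) (ns : List Nd),
    eps (locs.zip (upd P s m ns)) v s' ≤ eps (locs.zip ns) v s'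
  | [], _, _ => by simp [upd]
  | _ :: _, [], _ => by simp
  | _ :: _, _ :: _, [] => by simp [upd]
  | b :: m, l :: locs, n :: ns => by
    simp only [upd, List.zip_cons_cons, eps_cons]
    have := eps_upd_le P s v s' m locs ns
    refine add_le_add ?_ this
    by_cases h : l = v <;> simp only [h, if_true, if_false, le_refl]
    split_ifs
    · rw [Nd.sp_clear]; split_ifs <;> simp
    · rfl

theorem eps_upd_add_one_le {P s} {Q : Nd → Bool} {v : V}
    (hQ : ∀ n, P n.c = true → Q n = true → n.sp s = true) {col : V → Option Bool}
    (hv : P (col v) = true) :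
    ∀ (m : List Bool) (locs : List V) (ns : List Nd), locs.length = ns.length →
    (∀ p ∈ locs.zip ns, col p.1 = p.2.c) → okm Q m ns = true → (true, v) ∈ m.zip locs →
    eps (locs.zip (upd P s m ns)) v s + 1 ≤ eps (locs.zip ns) v s
  | [], _, _, _, _, _, h => by simp at h
  | _ :: _, [], _, _, _, _, h => by simp at h
  | _ :: _, _ :: _, [], h, _, _, _ => by simp at h
  | b :: m, l :: locs, n :: ns, hl, hc, hk, h => by
    have hln : col l = n.c := hc (l, n) (by simp)
    have hl' : locs.length = ns.length := by simpa using hl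
    have hc' : ∀ p ∈ locs.zip ns, col p.1 = p.2.c := fun p hp => hc p (by simp [hp])
    simp only [okm, Bool.and_eq_true] at hk
    simp only [List.zip_cons_cons, List.mem_cons, Prod.mk.injEq] at h
    rcases h with ⟨rfl, rfl⟩ | h
    · have h1 := eps_upd_le P s v s m locs ns
      rw [hln] at hv
      have h2 : n.sp s = true := hQ n hv (by simpa using hk.1)
      simp only [upd, List.zip_cons_cons, eps_cons, hv, Bool.and_self, if_true, h2, Nd.sp_clear,
        Bool.toNat_true, Bool.toNat_false]
      omega
    · have h1 := eps_upd_add_one_le hQ hv m locs ns hl' hc' hk.2 h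
      have h2 := eps_upd_le P s v s [b] [l] [n]
      simp only [upd, List.zip_cons_cons, eps_cons, List.zip_nil_right, eps_nil] at h2 ⊢
      omega

theorem upd_mem {P s} : ∀ (m : List Bool) (locs : List V) (ns : List Nd) (p : V × Nd),
    p ∈ locs.zip (upd P s m ns) → ∃ n, (p.1, n) ∈ locs.zip ns ∧ p.2.c = n.c
  | [], _, _, p, h => ⟨p.2, by simpa [upd] using h, rfl⟩
  | _ :: _, [], _, _, h => by simp at h
  | _ :: _, _ :: _, [], _, h => by simp [upd] at h
  | b :: m, l :: locs, n :: ns, p, h => by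
    simp only [upd, List.zip_cons_cons, List.mem_cons] at h
    rcases h with rfl | h
    · refine ⟨n, by simp, ?_⟩
      dsimp only
      split_ifs
      · exact Nd.clear_c _ _
      · rfl
    · obtain ⟨n', h1, h2⟩ := upd_mem m locs ns p h
      exact ⟨n', by simp [h1], h2⟩

theorem okm_col {Q : Nd → Bool} {col : V → Option Bool} {v : V} :
    ∀ (m : List Bool) (locs : List V) (ns : List Nd), locs.length = ns.length →
    (∀ p ∈ locs.zip ns, col p.1 = p.2.c) → okm Q m ns = true → (true, v) ∈ m.zip locs →
    ∃ n, n.c = col v ∧ Q n = true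
  | [], _, _, _, _, _, h => by simp at h
  | _ :: _, [], _, _, _, _, h => by simp at h
  | _ :: _, _ :: _, [], h, _, _, _ => by simp at h
  | b :: m, l :: locs, n :: ns, hl, hc, hk, h => by
    have hln : col l = n.c := hc (l, n) (by simp)
    have hl' : locs.length = ns.length := by simpa using hl
    have hc' : ∀ p ∈ locs.zip ns, col p.1 = p.2.c := fun p hp => hc p (by simp [hp])
    simp only [okm, Bool.and_eq_true] at hk
    simp only [List.zip_cons_cons, List.mem_cons, Prod.mk.injEq] at h
    rcases h with ⟨rfl, rfl⟩ | h
    · exact ⟨n, hln.symm, by simpa using hk.1⟩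
    · exact okm_col m locs ns hl' hc' hk.2 h

theorem raw_singleton {v : V} {col : V → Option Bool} {σ : V → Option Bool → ℕ}
    (h : ∀ c, col v ≠ some c → σ v (some c) ≤ 1) (h0 : col v = none → σ v none ≤ 1) :
    Raw G {v} col σ where
  slot u hu c hc := by
    rw [Finset.mem_singleton] at hu
    subst hu
    rw [nb_eq_zero (fun w hw ha => by
      rw [Finset.mem_singleton] at hw; subst hw; exact absurd ha (G.irrefl)), zero_add]
    exact h c hc
  same u hu c hc := by
    rw [Finset.mem_singleton] at hu
    subst hu
    exact nb_eq_zero (fun w hw ha => by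
      rw [Finset.mem_singleton] at hw; subst hw; exact absurd ha (G.irrefl))
  peel S hS hne hn := by
    obtain ⟨u, hu⟩ := hne
    have huv := Finset.mem_singleton.1 (hS hu)
    subst huv
    refine ⟨u, hu, ?_⟩
    rw [Finset.card_eq_zero.2, zero_add]
    · exact h0 (hn u hu)
    · rw [Finset.filter_eq_empty_iff]
      intro w hw
      rw [Finset.mem_singleton.1 (hS hw)]
      exact G.irrefl

theorem nb_singleton_le (col : V → Option Bool) (u v : V) (s) :
    nb G {v} col u s ≤ if G.Adj u v ∧ col v = s then 1 else 0 := by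
  unfold nb
  rw [Finset.filter_singleton]
  split_ifs <;> simp

theorem St.step {ℓ : V → LV} {D : Finset V} {col : V → Option Bool} {locs : List V} {ns : List Nd}
    (hlen : locs.length = ns.length) (h : St G ℓ D col (locs.zip ns)) {v : V} (hv : v ∉ D)
    {m : List Bool} (hm : ∀ u ∈ D, G.Adj v u → (true, u) ∈ m.zip locs) {o : Op}
    (ho : Meets (ℓ v) o.s o.k) {ns' : List Nd} (hns : ns' ∈ step m ns o) :
    (v :: locs).length = ns'.length ∧
      St G ℓ (insert v D) (Function.update col v o.s) ((v :: locs).zip ns') := by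
  obtain ⟨κ, h1, h2, h3⟩ := h
  set col' := Function.update col v o.s with hcol'
  have hcv : col' v = o.s := by simp [hcol']
  have hcD : ∀ u ∈ D, col u = col' u := fun u hu => by
    have : u ≠ v := fun h => hv (h ▸ hu)
    simp [hcol', this]
  have h1' := h1.congr hcD fun _ _ _ => le_rfl
  have hzc : ∀ p ∈ locs.zip ns, col' p.1 = p.2.c := fun p hp => by
    rw [← hcD _ (h3 p hp).1]; exact (h3 p hp).2
  have hnb : ∀ s, nb G D col' v s ≤ cnt m ns s := fun s =>
    card_le_cnt (col := col') m locs ns _ hlen (fun u hu => by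
      obtain ⟨h5, h6, h7⟩ := Finset.mem_filter.1 hu
      exact ⟨hm u h5 h6, h7⟩) hzc
  have hepsv : ∀ ns₁ : List Nd, eps (locs.zip ns₁) v = fun _ => 0 := fun ns₁ => by
    ext s
    refine eps_eq_zero (fun p hp he => hv ?_) s
    have : p.1 ∈ locs := (List.of_mem_zip (by exact hp : (p.1, p.2) ∈ _)).1
    obtain ⟨i, hi, hi'⟩ := List.getElem_of_mem this
    have h4 := (h3 (locs[i], ns[i]'(hlen ▸ hi)) (by
      rw [← List.getElem_zip (h := by simp [hi, ← hlen])]; exact List.getElem_mem _)).1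
    rwa [hi', he] at h4
  have hvu : ∀ u ∈ D, v ≠ u := fun u hu h => hv (h ▸ hu)
  have hdis : Disjoint ({v} : Finset V) D := by simpa using hv
  have hmeet : ∀ u ∈ insert v D, Meets (ℓ u) (col' u) (if u = v then o.k else κ u) := by
    intro u hu
    rcases Finset.mem_insert.1 hu with rfl | hu
    · rw [hcv, if_pos rfl]; exact ho
    · rw [← hcD u hu, if_neg (hvu u hu).symm]; exact h2 u hu
  have hback : ∀ P s, ∀ p ∈ locs.zip (upd P s m ns), p.1 ∈ insert v D ∧ col' p.1 = p.2.c := by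
    intro P s p hp
    obtain ⟨n, hn, hc⟩ := upd_mem m locs ns p hp
    exact ⟨Finset.mem_insert_of_mem (h3 _ hn).1, by rw [hzc _ hn, hc]⟩
  unfold _root_.step at hns
  rcases hos : o.s with _ | c <;> rw [hos] at hns hcv <;> dsimp only at hns
  · split at hns
    swap
    · simp at hns
    rename_i hslot
    simp only [Bool.and_eq_true, decide_eq_true_eq] at hslot
    rcases List.mem_append.1 hns with hns | hns
    · split at hns
      swap
      · simp at hns
      rename_i hr
      simp only [decide_eq_true_eq] at hr
      rw [List.mem_singleton] at hns
      subst hns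
      refine ⟨by simp [hlen], fun u => if u = v then o.k else κ u, ?_, hmeet, ?_⟩
      · rw [Finset.insert_eq, Finset.union_comm]
        refine Raw.glue hdis.symm h1' (raw_singleton (σ := fun u s => 1) (fun _ _ => le_rfl)
          fun _ => le_rfl) ?_ ?_ ?_ ?_ ?_
        · intro u hu c hc
          have := nb_singleton_le (G := G) col' u v (some c)
          rw [hcv] at this
          simp only [List.zip_cons_cons, eps_cons, if_neg (hvu u hu), if_neg (hvu u hu).symm]
          simp at this
          omega
        · intro u hu
          simp only [List.zip_cons_cons, eps_cons, if_neg (hvu u hu), if_neg (hvu u hu).symm]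
          omega
        · intro u hu c hc
          rw [Finset.mem_singleton] at hu
          subst hu
          simp only [List.zip_cons_cons, eps_cons, if_true, hepsv]
          have := hnb (some c)
          rcases c with _ | _ <;> simp only [Nd.sp, Op.k, kf]
          · by_cases h0 : cnt m ns (some false) + o.b = 0 <;> simp only [h0, decide_true, decide_false, Bool.toNat_true, Bool.toNat_false] <;> omega
          · by_cases h0 : cnt m ns (some true) + o.a = 0 <;> simp only [h0, decide_true, decide_false, Bool.toNat_true, Bool.toNat_false] <;> omega
        · intro u hu _
          rw [Finset.mem_singleton] at hu
          subst hu
          simp only [List.zip_cons_cons, eps_cons, if_true, hepsv]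
          have := hnb none
          simp only [Nd.sp, Op.k, kf]
          by_cases h0 : cnt m ns none + o.r = 0 <;> simp only [h0, decide_true, decide_false, Bool.toNat_true, Bool.toNat_false] <;> omega
        · intro u hu w hw _ c _
          rw [Finset.mem_singleton] at hw
          subst hw
          simp [hcv]
      · intro p hp
        simp only [List.zip_cons_cons, List.mem_cons] at hp
        rcases hp with rfl | hp
        · simp [hcv]
        · exact ⟨Finset.mem_insert_of_mem (h3 _ hp).1, hzc _ hp⟩
    · split at hns
      swap
      · simp at hns
      rename_i hr
      simp only [Bool.and_eq_true, decide_eq_true_eq] at hr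
      rw [List.mem_singleton] at hns
      subst hns
      refine ⟨by simp [hlen, upd_length], fun u => if u = v then o.k else κ u, ?_, hmeet, ?_⟩
      · rw [Finset.insert_eq]
        refine Raw.glue hdis (raw_singleton (σ := fun u s => 1) (fun _ _ => le_rfl)
          fun _ => le_rfl) h1' ?_ ?_ ?_ ?_ ?_
        · intro u hu c hc
          rw [Finset.mem_singleton] at hu
          subst hu
          simp only [List.zip_cons_cons, eps_cons, if_true, hepsv]
          have := hnb (some c)
          rcases c with _ | _ <;> simp only [Nd.sp, Op.k, kf]
          · by_cases h0 : cnt m ns (some false) + o.b = 0 <;> simp only [h0, decide_true, decide_false, Bool.toNat_true, Bool.toNat_false] <;> omega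
          · by_cases h0 : cnt m ns (some true) + o.a = 0 <;> simp only [h0, decide_true, decide_false, Bool.toNat_true, Bool.toNat_false] <;> omega
        · intro u hu
          rw [Finset.mem_singleton] at hu
          subst hu
          simp only [List.zip_cons_cons, eps_cons, if_true, hepsv]
          simp only [Nd.sp, Op.k, kf]
          by_cases h0 : o.r = 0 <;> simp only [h0, decide_true, decide_false, Bool.toNat_true, Bool.toNat_false] <;> omega
        · intro u hu c hc
          have := nb_singleton_le (G := G) col' u v (some c)
          rw [hcv] at this
          simp only [List.zip_cons_cons, eps_cons, if_neg (hvu u hu), if_neg (hvu u hu).symm]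
          have h5 := eps_upd_le (fun s => s == none) none u (some c) m locs ns
          simp at this
          omega
        · intro u hu hcu
          have := nb_singleton_le (G := G) col' u v none
          simp only [List.zip_cons_cons, eps_cons, if_neg (hvu u hu), if_neg (hvu u hu).symm]
          split_ifs at this with hadj
          · have h5 := eps_upd_add_one_le (P := fun s => s == none) (s := none)
              (Q := fun n => !(n.c == none) || n.r) (v := u) (col := col')
              (fun n h6 h7 => by simp at h6; simpa [h6, Nd.sp] using h7) (by simp [hcu]) m locs ns hlen
              hzc hr.1.1 (hm u hu hadj.1.symm)
            omega
          · have h5 := eps_upd_le (fun s => s == none) none u none m locs ns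
            omega
        · intro w hw u hu _ c hc
          rw [Finset.mem_singleton] at hw
          subst hw
          simp [hcv] at hc
      · intro p hp
        simp only [List.zip_cons_cons, List.mem_cons] at hp
        rcases hp with rfl | hp
        · simp [hcv]
        · exact hback _ _ p hp
  · split_ifs at hns with hr
    swap
    · simp at hns
    simp only [Bool.and_eq_true, decide_eq_true_eq] at hr
    rw [List.mem_singleton] at hns
    subst hns
    refine ⟨by simp [hlen, upd_length], fun u => if u = v then o.k else κ u, ?_, hmeet, ?_⟩
    · rw [Finset.insert_eq, Finset.union_comm]
      refine Raw.glue hdis.symm h1' (raw_singleton (σ := fun u s => 1) (fun _ _ => le_rfl)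
        fun _ => le_rfl) ?_ ?_ ?_ ?_ ?_
      · intro u hu c' hc'
        have := nb_singleton_le (G := G) col' u v (some c')
        simp only [List.zip_cons_cons, eps_cons, if_neg (hvu u hu), if_neg (hvu u hu).symm]
        split_ifs at this with hadj
        · rw [hcv] at hadj
          have hcc : c = c' := by simpa using hadj.2
          subst hcc
          have h5 := eps_upd_add_one_le (P := fun _ => true) (s := some c)
            (Q := fun n => !(n.c == some c) && n.sp (some c)) (v := u) (col := col')
            (fun n h6 h7 => by simp at h7; exact h7.2) rfl m locs ns hlen
            hzc hr.1 (hm u hu hadj.1.symm)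
          omega
        · have h5 := eps_upd_le (fun _ => true) (some c) u (some c') m locs ns
          omega
      · intro u hu
        simp only [List.zip_cons_cons, eps_cons, if_neg (hvu u hu), if_neg (hvu u hu).symm]
        have h5 := eps_upd_le (fun _ => true) (some c) u none m locs ns
        omega
      · intro u hu c' hc'
        rw [Finset.mem_singleton] at hu
        subst hu
        have hcc : c' = !c := by
          rw [hcv] at hc'
          rcases c with _ | _ <;> rcases c' with _ | _ <;> simp_all
        simp only [List.zip_cons_cons, eps_cons, if_true, hepsv]
        have := hnb (some c')
        rw [← hcc] at hr ⊢
        have hsp : ∀ x : Bool, Nd.sp ⟨some c, c' && x, c && x, false⟩ (some c') = x := by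
          intro x; subst hcc; rcases c with _ | _ <;> simp [Nd.sp]
        rw [hsp]
        by_cases h0 : cnt m ns (some c') + o.k (some c') = 0 <;> simp only [h0, decide_true, decide_false, Bool.toNat_true, Bool.toNat_false] <;> omega
      · intro u hu hcu
        rw [Finset.mem_singleton] at hu
        subst hu
        simp [hcv] at hcu
      · intro u hu w hw hadj c' hc' hcw
        rw [Finset.mem_singleton] at hw
        subst hw
        rw [hcv] at hcw
        obtain ⟨n, hn, hq⟩ := okm_col m locs ns hlen hzc hr.1 (hm u hu hadj.symm)
        rw [hc', ← hcw] at hn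
        simp [hn] at hq
    · intro p hp
      simp only [List.zip_cons_cons, List.mem_cons] at hp
      rcases hp with rfl | hp
      · simp [hcv]
      · exact hback _ _ p hp
end

/-! Forms of the search steps written with recursors, which the kernel evaluates faster. -/

def eqc : Option Bool → Option Bool → Bool
  | none, none => true
  | some true, some true => true
  | some false, some false => true
  | _, _ => false

theorem eqc_eq (s t : Option Bool) : eqc s t = (s == t) := by
  rcases s with _ | _ | _ <;> rcases t with _ | _ | _ <;> rfl

noncomputable def cntF (m : List Bool) : List Nd → Option Bool → ℕ :=
  m.rec (fun _ _ => 0) fun b _ ih ns s =>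
    ns.rec 0 fun n t _ => b.rec (ih t s) ((eqc n.c s).rec (ih t s) (ih t s).succ)

noncomputable def okmF (P : Nd → Bool) (m : List Bool) : List Nd → Bool :=
  m.rec (fun _ => true) fun b _ ih ns =>
    ns.rec true fun n t _ => b.rec (ih t) ((P n).rec false (ih t))

noncomputable def updF (P : Option Bool → Bool) (s : Option Bool) (m : List Bool) :
    List Nd → List Nd :=
  m.rec (fun ns => ns) fun b _ ih ns =>
    ns.rec [] fun n t _ => b.rec (n :: ih t) ((P n.c).rec n (n.clear s) :: ih t)

theorem cntF_eq (s) : ∀ m ns, cntF m ns s = cnt m ns s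
  | [], _ => by simp [cntF, cnt]
  | _ :: _, [] => by simp [cntF, cnt]
  | b :: m, n :: ns => by
    have : cntF (b :: m) (n :: ns) s =
      b.rec (cntF m ns s) ((eqc n.c s).rec (cntF m ns s) (cntF m ns s).succ) := rfl
    rw [this, cntF_eq s m ns, cnt, eqc_eq]
    rcases b <;> cases n.c == s <;> simp [add_comm]

theorem okmF_eq (P) : ∀ m ns, okmF P m ns = okm P m ns
  | [], _ => by simp [okmF, okm]
  | _ :: _, [] => by simp [okmF, okm]
  | b :: m, n :: ns => by
    have : okmF P (b :: m) (n :: ns) = b.rec (okmF P m ns) ((P n).rec false (okmF P m ns)) := rfl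
    rw [this, okmF_eq P m ns, okm]
    rcases b <;> cases P n <;> rfl

theorem updF_eq (P s) : ∀ m ns, updF P s m ns = upd P s m ns
  | [], _ => by simp [updF, upd]
  | _ :: _, [] => by simp [updF, upd]
  | b :: m, n :: ns => by
    have : updF P s (b :: m) (n :: ns) =
      b.rec (n :: updF P s m ns) ((P n.c).rec n (n.clear s) :: updF P s m ns) := rfl
    rw [this, updF_eq P s m ns, upd]
    rcases b <;> cases P n.c <;> rfl

noncomputable def stepF (m : List Bool) (ns : List Nd) (o : Op) : List (List Nd) :=
  match o.s with
  | some c =>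
    cond (okmF (fun n => !eqc n.c (some c) && n.sp (some c)) m ns &&
        Nat.ble (cntF m ns (some !c) + o.k (some !c)) 1)
      [⟨some c, !c && Nat.beq (cntF m ns (some !c) + o.k (some !c)) 0,
        c && Nat.beq (cntF m ns (some !c) + o.k (some !c)) 0, false⟩ ::
        updF (fun _ => true) (some c) m ns]
      []
  | none =>
    cond (Nat.ble (cntF m ns (some true) + o.a) 1 && Nat.ble (cntF m ns (some false) + o.b) 1)
      (cond (Nat.ble (cntF m ns none + o.r) 1)
        [⟨none, Nat.beq (cntF m ns (some true) + o.a) 0, Nat.beq (cntF m ns (some false) + o.b) 0,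
          Nat.beq (cntF m ns none + o.r) 0⟩ :: ns] [] ++
      cond (okmF (fun n => !eqc n.c none || n.r) m ns && !Nat.beq (cntF m ns none) 0 &&
          Nat.ble o.r 1)
        [⟨none, Nat.beq (cntF m ns (some true) + o.a) 0, Nat.beq (cntF m ns (some false) + o.b) 0,
          Nat.beq o.r 0⟩ :: updF (fun s => eqc s none) none m ns] [])
      []

theorem stepF_eq (m ns o) : stepF m ns o = step m ns o := by
  have h1 (a b : ℕ) : Nat.ble a b = decide (a ≤ b) := by
    rw [Bool.eq_iff_iff, Nat.ble_eq, decide_eq_true_iff]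
  have h2 (a b : ℕ) : Nat.beq a b = decide (a = b) := by
    rw [Bool.eq_iff_iff, Nat.beq_eq, decide_eq_true_iff]
  rcases hs : o.s with _ | c <;>
    simp only [stepF, step, hs, cntF_eq, okmF_eq, updF_eq, eqc_eq, h1, h2, Bool.cond_eq_ite]

/-- Search for an extension colouring new vertices one after the other. -/
noncomputable def solve (P : List Nd → Bool) : List (List Bool × List Op) → List Nd → Bool
  | [], ns => P ns
  | (m, os) :: js, ns => os.any fun o => (stepF m ns o).any fun ns' => solve P js ns'

/-- All choices of nodes that can result from the given ports. -/
def secs : List PL → List (List Nd)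
  | [] => [[]]
  | y :: ys => y.drop.flatMap fun n => (secs ys).map fun ns => n :: ns

theorem mem_secs {ns : List Nd} {ys : List PL} (h : List.Forall₂ (fun n y => n ∈ PL.drop y) ns ys) :
    ns ∈ secs ys := by
  induction h with
  | nil => simp [secs]
  | cons h1 _ ih =>
    simp only [secs, List.mem_flatMap, List.mem_map]
    exact ⟨_, h1, _, ih, rfl⟩

/-- A list containing the label vectors of cost at most `k`. -/
def cheap (k : ℕ) : List LV :=
  (List.range (k + 1)).flatMap fun t => (List.range (k + 1 - t)).flatMap fun b =>
  (List.range (k + 1 - t - b)).flatMap fun ka => (List.range (k + 1 - t - b - ka)).flatMap fun kb =>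
  (List.range (k + 1 - t - b - ka - kb)).flatMap fun l =>
  (List.range ((k - t - b - ka - kb - l) / 3 + 1)).flatMap fun sa =>
  (List.range ((k - t - b - ka - kb - l) / 3 + 1 - sa)).flatMap fun sb =>
  (List.range ((k - t - b - ka - kb - l) / 3 + 1 - sa - sb)).map fun sr =>
    ⟨t, b, ka, kb, l, sa, sb, sr⟩

theorem mem_cheap {x : LV} {k : ℕ} (h : x.cost ≤ k) : x ∈ cheap k := by
  obtain ⟨t, b, ka, kb, l, sa, sb, sr⟩ := x
  simp only [LV.cost] at h
  simp only [cheap, List.mem_flatMap, List.mem_map, List.mem_range]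
  exact ⟨t, by omega, b, by omega, ka, by omega, kb, by omega, l, by omega, sa, by omega,
    sb, by omega, sr, by omega, rfl⟩

theorem eq_zero_of_cost {x : LV} (h : x.cost = 0) : x = 0 := by
  obtain ⟨t, b, ka, kb, l, sa, sb, sr⟩ := x
  simp only [LV.cost] at h
  rw [LV.zero_eq]
  congr 1 <;> omega

section
variable {V : Type*} {G : SimpleGraph V}

variable (G) in
/-- The vertices `vs` can be coloured in this order with the masks and options in `js`. -/
def Fit (ℓ : V → LV) : Finset V → List V → List (List Bool × List Op) → List V → Prop
  | _, _, [], [] => True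
  | D, locs, (m, os) :: js, v :: vs => v ∉ D ∧ (∀ u ∈ D, G.Adj v u → (true, u) ∈ m.zip locs) ∧
      (∀ o ∈ os, Meets (ℓ v) o.s o.k) ∧ Fit ℓ (insert v D) (v :: locs) js vs
  | _, _, _, _ => False

theorem Fit.sound {ℓ : V → LV} {P : List Nd → Bool} : ∀ (js : List (List Bool × List Op))
    (vs : List V) {D : Finset V} {locs : List V} {ns : List Nd} {col : V → Option Bool},
    Fit G ℓ D locs js vs → solve P js ns = true → locs.length = ns.length →
    St G ℓ D col (locs.zip ns) →
    ∃ col' ns', P ns' = true ∧ (∀ u ∈ D, col' u = col u) ∧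
      (vs.reverse ++ locs).length = ns'.length ∧
      St G ℓ (D ∪ vs.toFinset) col' ((vs.reverse ++ locs).zip ns')
  | [], [], D, locs, ns, col, _, hs, hl, h =>
    ⟨col, ns, hs, fun _ _ => rfl, by simpa using hl, by simpa using h⟩
  | [], _ :: _, _, _, _, _, hf, _, _, _ => by simp [Fit] at hf
  | _ :: _, [], _, _, _, _, hf, _, _, _ => by simp [Fit] at hf
  | (m, os) :: js, v :: vs, D, locs, ns, col, hf, hs, hl, h => by
    obtain ⟨hv, hm, ho, hf⟩ := hf
    simp only [solve, List.any_eq_true] at hs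
    obtain ⟨o, hoo, ns', hns, hs⟩ := hs
    rw [stepF_eq] at hns
    obtain ⟨h1, h2⟩ := h.step hl hv hm (ho o hoo) hns
    obtain ⟨col', ns'', h3, h4, h5, h6⟩ := Fit.sound js vs hf hs h1 h2
    refine ⟨col', ns'', h3, fun u hu => ?_, ?_, ?_⟩
    · rw [h4 u (Finset.mem_insert_of_mem hu), Function.update_of_ne]
      rintro rfl
      exact hv hu
    · simpa using h5
    · have : D ∪ (v :: vs).toFinset = insert v D ∪ vs.toFinset := by
        ext; simp
      rw [this]
      simpa using h6
end

section
variable {V : Type*} (G : SimpleGraph V)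

noncomputable def dg (C : Finset V) (v : V) : ℕ := (C.filter (G.Adj v)).card

variable {G}

theorem dg_insert {C : Finset V} {u : V} (hu : u ∉ C) (v : V) :
    dg G (insert u C) v = dg G C v + if G.Adj v u then 1 else 0 := by
  unfold dg
  rw [Finset.filter_insert]
  split_ifs
  · rw [Finset.card_insert_of_notMem (by simp [hu])]
  · rfl

theorem length_le_dg {C : Finset V} {v : V} (L : List V) (hL : L.Nodup)
    (h : ∀ u ∈ L, u ∈ C ∧ G.Adj v u) : L.length ≤ dg G C v := by
  rw [← List.toFinset_card_of_nodup hL]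
  exact Finset.card_le_card fun u hu => Finset.mem_filter.2 (h u (List.mem_toFinset.1 hu))

theorem sum_nb (B : Finset V) (col : V → Option Bool) (v : V) :
    nb G B col v (some true) + nb G B col v (some false) + nb G B col v none = dg G B v := by
  unfold nb dg
  rw [Finset.filter_and, Finset.filter_and, Finset.filter_and, ← Finset.card_union_of_disjoint,
    ← Finset.card_union_of_disjoint]
  · congr 1
    ext u
    simp only [Finset.mem_union, Finset.mem_inter, Finset.mem_filter]
    rcases col u with _ | _ | _ <;> simp <;> tauto
  · rw [Finset.disjoint_left]
    intro u hu
    simp only [Finset.mem_union, Finset.mem_inter, Finset.mem_filter] at hu ⊢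
    rcases h : col u with _ | _ | _ <;> simp_all
  · rw [Finset.disjoint_left]
    intro u hu
    simp only [Finset.mem_inter, Finset.mem_filter] at hu ⊢
    rcases h : col u with _ | _ | _ <;> simp_all

theorem cost_add (x y : LV) : (x + y).cost = x.cost + y.cost := by
  simp only [LV.add_eq, LV.cost]; ring

theorem cost_sl (B : Finset V) (col : V → Option Bool) (v : V) :
    (sl G B col v).cost = 3 * dg G B v := by
  rw [← sum_nb B col v]
  simp only [sl, LV.cost]; ring
end

section
variable {V : Type*} [Fintype V] {G : SimpleGraph V}

theorem edgesIn_empty : edgesIn G ∅ = 0 := by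
  unfold edgesIn
  rw [Finset.card_eq_zero, Finset.filter_eq_empty_iff]
  rintro e - ⟨-, h⟩
  induction e using Sym2.ind with
  | _ x y => simpa using h x (by simp)

theorem edgesIn_insert {C : Finset V} {v : V} (hv : v ∉ C) :
    edgesIn G (insert v C) = edgesIn G C + dg G C v := by
  unfold edgesIn dg
  rw [← Finset.card_image_of_injOn (s := C.filter (G.Adj v)) (f := fun u => s(v, u)),
    ← Finset.card_union_of_disjoint]
  · congr 1
    ext e
    induction e using Sym2.ind with
    | _ x y =>
      simp only [Finset.mem_filter, Finset.mem_univ, true_and, SimpleGraph.mem_edgeSet, Sym2.mem_iff,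
        forall_eq_or_imp, forall_eq, Finset.mem_insert, Finset.mem_union, Finset.mem_image,
        Sym2.eq_iff]
      constructor
      · rintro ⟨h, rfl | hx, rfl | hy⟩
        · exact absurd h G.irrefl
        · exact Or.inr ⟨y, ⟨hy, h⟩, Or.inl ⟨rfl, rfl⟩⟩
        · exact Or.inr ⟨x, ⟨hx, h.symm⟩, Or.inr ⟨rfl, rfl⟩⟩
        · exact Or.inl ⟨h, hx, hy⟩
      · rintro (⟨h, hx, hy⟩ | ⟨u, ⟨hu, h⟩, ⟨rfl, rfl⟩ | ⟨rfl, rfl⟩⟩)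
        · exact ⟨h, Or.inr hx, Or.inr hy⟩
        · exact ⟨h, Or.inl rfl, Or.inr hu⟩
        · exact ⟨h.symm, Or.inr hu, Or.inl rfl⟩
  · rw [Finset.disjoint_left]
    rintro e he he'
    obtain ⟨u, -, rfl⟩ := Finset.mem_image.1 he'
    exact hv ((Finset.mem_filter.1 he).2.2 v (by simp))
  · intro x _ y _ h
    simp only [Sym2.eq_iff] at h
    rcases h with ⟨-, h⟩ | ⟨h1, h2⟩
    · exact h
    · exact h2.trans h1

theorem edgesIn_union_add_inter (A B : Finset V) :
    edgesIn G A + edgesIn G B ≤ edgesIn G (A ∪ B) + edgesIn G (A ∩ B) := by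
  unfold edgesIn
  rw [← Finset.card_union_add_card_inter]
  refine add_le_add (Finset.card_le_card ?_) (Finset.card_le_card ?_)
  · intro e he
    simp only [Finset.mem_union, Finset.mem_filter] at he ⊢
    rcases he with ⟨h1, h2, h3⟩ | ⟨h1, h2, h3⟩
    · exact ⟨h1, h2, fun v hv => Or.inl (h3 v hv)⟩
    · exact ⟨h1, h2, fun v hv => Or.inr (h3 v hv)⟩
  · intro e he
    simp only [Finset.mem_inter, Finset.mem_filter] at he ⊢
    exact ⟨he.1.1, he.1.2.1, fun v hv => ⟨he.1.2.2 v hv, he.2.2.2 v hv⟩⟩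

theorem edgesIn_union {A B : Finset V} (h : Disjoint A B) :
    edgesIn G (A ∪ B) = edgesIn G A + edgesIn G B + ∑ v ∈ B, dg G A v := by
  induction B using Finset.induction_on with
  | empty => simp [edgesIn_empty]
  | insert v B hv ih =>
    rw [Finset.disjoint_insert_right] at h
    rw [Finset.union_insert, edgesIn_insert (by simp [h.1, hv]), ih h.2, edgesIn_insert hv,
      Finset.sum_insert hv]
    have : dg G (A ∪ B) v = dg G A v + dg G B v := by
      unfold dg
      rw [Finset.filter_union, Finset.card_union_of_disjoint (Finset.disjoint_filter_filter h.2)]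
    omega

theorem sum_dg (C : Finset V) : ∑ v ∈ C, dg G C v = 2 * edgesIn G C := by
  induction C using Finset.induction_on with
  | empty => simp [edgesIn_empty]
  | insert v C hv ih =>
    rw [Finset.sum_insert hv, edgesIn_insert hv, dg_insert hv, if_neg G.irrefl,
      Finset.sum_congr rfl fun u _ => dg_insert hv u, Finset.sum_add_distrib, ih,
      Finset.sum_boole]
    have : C.filter (fun u => G.Adj u v) = C.filter (G.Adj v) :=
      Finset.filter_congr fun u _ => G.adj_comm u v
    rw [this]
    unfold dg
    simp only [Nat.cast_id]
    ring

/-- The weight left to a vertex by its labels. -/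
def LV.wt (x : LV) : ℤ := 4 - x.cost

variable (G) in
noncomputable def rho (ℓ : V → LV) (C : Finset V) : ℤ := ∑ v ∈ C, (ℓ v).wt - 3 * edgesIn G C

variable {ℓ : V → LV}

theorem rho_empty : rho G ℓ ∅ = 0 := by simp [rho, edgesIn_empty]

theorem rho_insert {C : Finset V} {v : V} (hv : v ∉ C) :
    rho G ℓ (insert v C) = rho G ℓ C + (ℓ v).wt - 3 * dg G C v := by
  unfold rho
  rw [Finset.sum_insert hv, edgesIn_insert hv]
  push_cast; ring

theorem rho_insert_le {C : Finset V} {v : V} (hv : v ∉ C) (L : List V) (hL : L.Nodup)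
    (h : ∀ u ∈ L, u ∈ C ∧ G.Adj v u) :
    rho G ℓ (insert v C) ≤ rho G ℓ C + (ℓ v).wt - 3 * L.length := by
  rw [rho_insert hv]
  have := length_le_dg L hL h
  omega

theorem rho_union_add_inter (A B : Finset V) :
    rho G ℓ (A ∪ B) + rho G ℓ (A ∩ B) ≤ rho G ℓ A + rho G ℓ B := by
  unfold rho
  have := edgesIn_union_add_inter (G := G) A B
  have h2 := Finset.sum_union_inter (s₁ := A) (s₂ := B) (f := fun v => (ℓ v).wt)
  omega

theorem rho_union {A B : Finset V} (h : Disjoint A B) :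
    rho G ℓ (A ∪ B) = rho G ℓ A + rho G ℓ B - 3 * ∑ v ∈ B, (dg G A v : ℤ) := by
  unfold rho
  rw [edgesIn_union h, Finset.sum_union h]
  push_cast; ring

theorem rho_add (m : V → LV) (C : Finset V) :
    rho G (fun v => ℓ v + m v) C = rho G ℓ C - ∑ v ∈ C, ((m v).cost : ℤ) := by
  unfold rho
  have : ∀ v ∈ C, (ℓ v + m v).wt = (ℓ v).wt - ((m v).cost : ℤ) := fun v _ => by
    unfold LV.wt; rw [cost_add]; push_cast; ring
  rw [Finset.sum_congr rfl this, Finset.sum_sub_distrib]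
  ring

variable (G) in
/-- A vertex set with labels that is smallest among those without an admissible colouring. -/
structure Crit (ℓ : V → LV) (U : Finset V) : Prop where
  ih : ∀ (U' : Finset V) (ℓ' : V → LV), U'.card < U.card → (∀ v ∈ U', (ℓ' v).kb ≤ 1) →
    (∀ C ⊆ U', 0 ≤ rho G ℓ' C) → ∃ col, St G ℓ' U' col []
  pv : ∀ v ∈ U, (ℓ v).kb ≤ 1
  nn : ∀ C ⊆ U, 0 ≤ rho G ℓ C
  no : ∀ col ns, ¬ St G ℓ U col ns

variable {U : Finset V}

theorem Crit.rem (M : Crit G ℓ U) {B R : Finset V} {col : V → Option Bool} {ns : List (V × Nd)}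
    (h : St G ℓ B col ns) (hBR : Disjoint B R) (hR : R.card < U.card) (ℓ' : V → LV)
    (hB : ∀ v ∈ B, ℓ' v = ℓ v) (hpv : ∀ v ∈ R, (ℓ' v).kb ≤ 1)
    (hc : ∀ C ⊆ R, C.Nonempty → rho G ℓ B ≤ rho G ℓ' (B ∪ C)) :
    ∃ col', (∀ v ∈ B, col' v = col v) ∧ St G ℓ' (B ∪ R) col' ns := by
  obtain ⟨col1, h1⟩ := M.ih R (fun v => ℓ' v + sl G B col v) hR
    (fun v hv => by simpa [LV.add_eq, sl] using hpv v hv) (fun C hC => by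
      rw [rho_add, Finset.sum_congr rfl fun v _ => by rw [cost_sl]]
      rcases C.eq_empty_or_nonempty with rfl | hne
      · simp [rho_empty]
      · have h2 := hc C hC hne
        rw [rho_union (Finset.disjoint_of_subset_right hC hBR)] at h2
        have h3 : rho G ℓ' B = rho G ℓ B := by
          unfold rho; rw [Finset.sum_congr rfl fun v hv => by rw [hB v hv]]
        push_cast
        rw [← Finset.mul_sum]
        linarith)
  set col' : V → Option Bool := fun v => if v ∈ B then col v else col1 v with hcol'
  have e1 : ∀ v ∈ B, col' v = col v := fun v hv => by simp [hcol', hv]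
  have e2 : ∀ v ∈ R, col1 v = col' v := fun v hv => by
    have : v ∉ B := fun h => Finset.disjoint_left.1 hBR h hv
    simp [hcol', this]
  refine ⟨col', e1, ?_⟩
  have h4 : St G ℓ' B col' ns := h.congr (fun v hv => (e1 v hv).symm) fun v hv => (hB v hv).symm
  have h5 : St G (fun v => ℓ' v + sl G B col' v) R col' [] := h1.congr e2 fun v hv => by
    simp only [sl, nb_congr (fun u hu => (e1 u hu))]
  simpa using St.glue hBR h4 h5

theorem Crit.one_le (M : Crit G ℓ U) {B : Finset V} (hB : B ⊆ U) (hne : B.Nonempty) (hU : B ≠ U) :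
    1 ≤ rho G ℓ B := by
  by_contra hlt
  have h0 : rho G ℓ B = 0 := by have := M.nn B hB; omega
  obtain ⟨col, hcol⟩ := M.ih B ℓ (Finset.card_lt_card (hB.ssubset_of_ne hU))
    (fun v hv => M.pv v (hB hv)) (fun C hC => M.nn C (hC.trans hB))
  obtain ⟨col', -, h⟩ := M.rem hcol (R := U \ B) Finset.disjoint_sdiff
    (Finset.card_lt_card (Finset.sdiff_ssubset hB hne)) ℓ (fun _ _ => rfl)
    (fun v hv => M.pv v (Finset.mem_sdiff.1 hv).1)
    (fun C hC _ => by
      rw [h0]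
      exact M.nn _ (Finset.union_subset hB (hC.trans Finset.sdiff_subset)))
  rw [Finset.union_sdiff_of_subset hB] at h
  exact M.no _ _ h

/-- The total cost of the ports lying in `C`. -/
noncomputable def pc (C : Finset V) : List (V × PL) → ℤ
  | [] => 0
  | (p, x) :: ps => (if p ∈ C then (x.lv.cost : ℤ) else 0) + pc C ps

theorem rho_addl (ps : List (V × PL)) (C : Finset V) :
    rho G (addl ℓ ps) C = rho G ℓ C - pc C ps := by
  induction ps with
  | nil => simp [pc]; rfl
  | cons p ps ih =>
    obtain ⟨p, x⟩ := p
    have : addl ℓ ((p, x) :: ps) = fun v => addl ℓ ps v + if v = p then x.lv else 0 := rfl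
    rw [this, rho_add, ih, pc]
    have : ∑ v ∈ C, (((if v = p then x.lv else 0 : LV).cost : ℕ) : ℤ) =
        if p ∈ C then (x.lv.cost : ℤ) else 0 := by
      rw [← Finset.sum_ite_eq' C p fun _ => (x.lv.cost : ℤ)]
      refine Finset.sum_congr rfl fun v _ => ?_
      split_ifs <;> rfl
    rw [this]; ring

theorem addl_kb {ps : List (V × PL)} (h : ∀ p ∈ ps, p.2.lv.kb = 0) (v : V) :
    (addl ℓ ps v).kb = (ℓ v).kb := by
  induction ps with
  | nil => rfl
  | cons p ps ih =>
    have h1 := ih fun q hq => h q (by simp [hq])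
    have h2 := h p (by simp)
    obtain ⟨p, x⟩ := p
    simp only [addl, LV.add_eq, h1]
    split_ifs
    · simpa using h2
    · rfl

theorem Crit.colour (M : Crit G ℓ U) {W : Finset V} (hW : W ⊂ U) (ps : List (V × PL))
    (hps : ∀ p ∈ ps, p.1 ∈ W) (hpv : ∀ v ∈ W, (addl ℓ ps v).kb ≤ 1)
    (hc : ∀ C ⊆ W, C.Nonempty → pc C ps ≤ rho G ℓ C) :
    ∃ ns ∈ secs (ps.map Prod.snd), ns.length = ps.length ∧
      ∃ col, St G ℓ W col ((ps.map Prod.fst).zip ns) := by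
  obtain ⟨col, h⟩ := M.ih W (addl ℓ ps) (Finset.card_lt_card hW) hpv (fun C hC => by
    rw [rho_addl]
    rcases C.eq_empty_or_nonempty with rfl | hne
    · have : ∀ ps : List (V × PL), pc ∅ ps = 0 := fun ps => by
        induction ps with
        | nil => rfl
        | cons p ps ih => simp [pc, ih]
      simp [rho_empty, this]
    · linarith [hc C hC hne])
  obtain ⟨ns, h1, h2⟩ := St.drop_all ps [] h hps
  exact ⟨ns, mem_secs h1, by simpa using h1.length_eq, col, by simpa using h2⟩

/-- No colouring of `W` obtained with the ports `ps` extends to the vertices `vs`. -/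
theorem Crit.absurd (M : Crit G ℓ U) {W : Finset V} (vs : List V) (hvs : vs ≠ [])
    (hd : ∀ v ∈ vs, v ∉ W)
    (hU : W ∪ vs.toFinset = U) (ps : List (V × PL))
    (hps : ∀ p ∈ ps, p.1 ∈ W) (hpv : ∀ p ∈ ps, p.2.lv.kb = 0)
    (hc : ∀ C ⊆ W, C.Nonempty → pc C ps ≤ rho G ℓ C)
    (h : ∀ ns ∈ secs (ps.map Prod.snd), ∃ vs' js, vs'.toFinset = vs.toFinset ∧
      Fit G ℓ W (ps.map Prod.fst) js vs' ∧ solve (fun _ => true) js ns = true) : False := by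
  have hW : W ⊂ U := by
    obtain ⟨v, hv⟩ := List.exists_mem_of_ne_nil vs hvs
    rw [← hU]
    refine Finset.ssubset_iff_subset_ne.2 ⟨Finset.subset_union_left, fun he => hd v hv ?_⟩
    rw [he]; simp [hv]
  obtain ⟨ns, h1, h2, col, h3⟩ := M.colour hW ps hps
    (fun v hv => by rw [addl_kb hpv]; exact M.pv v (hW.1 hv)) hc
  obtain ⟨vs', js, h4, h5, h6⟩ := h ns h1
  obtain ⟨col', ns', -, -, -, h7⟩ := Fit.sound js vs' h5 h6 (by simpa using h2.symm) h3
  rw [h4, hU] at h7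
  exact M.no _ _ h7
end

section
variable {V : Type*} {G : SimpleGraph V} {ℓ : V → LV} {U : Finset V}

theorem Fit.nil {D : Finset V} {locs : List V} : Fit G ℓ D locs [] [] := trivial

theorem Fit.cons {D : Finset V} {locs vs : List V} {v : V} {m : List Bool} {js} {x : LV}
    (hx : ℓ v = x) (hv : v ∉ D) (hm : ∀ u ∈ D, G.Adj v u → (true, u) ∈ m.zip locs)
    (h : Fit G ℓ (insert v D) (v :: locs) js vs) : Fit G ℓ D locs ((m, opts x) :: js) (v :: vs) :=
  ⟨hv, hm, fun _ ho => by rw [hx]; exact meets_of_mem_opts ho, h⟩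

variable (G U) in
/-- The neighbours of `v` inside `U` are the entries of `L`, without repetition. -/
def Nbs (v : V) (L : List V) : Prop := L.Nodup ∧ ∀ w, w ∈ U ∧ G.Adj v w ↔ w ∈ L

theorem Nbs.dg {v : V} {L : List V} (h : Nbs G U v L) : dg G U v = L.length := by
  rw [← List.toFinset_card_of_nodup h.1]
  unfold _root_.dg
  congr 1
  ext w
  rw [Finset.mem_filter, h.2, List.mem_toFinset]

theorem exists_nbs (v : V) : ∃ L, Nbs G U v L :=
  ⟨(U.filter (G.Adj v)).toList, Finset.nodup_toList _, fun w => by simp⟩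

theorem Nbs.perm {v : V} {L L' : List V} (h : Nbs G U v L) (hp : L.Perm L') : Nbs G U v L' :=
  ⟨hp.nodup h.1, fun w => by rw [h.2, hp.mem_iff]⟩

theorem exists_nbs_cons {v u : V} (hu : u ∈ U) (h : G.Adj v u) : ∃ L, Nbs G U v (u :: L) := by
  obtain ⟨L, hL⟩ := exists_nbs (G := G) (U := U) v
  exact ⟨_, hL.perm (List.perm_cons_erase ((hL.2 u).1 ⟨hu, h⟩))⟩

theorem Nbs.mem {v : V} {L : List V} (h : Nbs G U v L) {w : V} (hw : w ∈ L) : w ∈ U :=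
  ((h.2 w).2 hw).1

theorem Nbs.adj {v : V} {L : List V} (h : Nbs G U v L) {w : V} (hw : w ∈ L) : G.Adj v w :=
  ((h.2 w).2 hw).2

theorem Nbs.one {v p : V} (h : Nbs G U v [p]) : p ∈ U ∧ G.Adj v p ∧ v ≠ p :=
  ⟨h.mem (by simp), h.adj (by simp), (h.adj (w := p) (by simp)).ne⟩

theorem Nbs.two {v p q : V} (h : Nbs G U v [p, q]) :
    p ∈ U ∧ q ∈ U ∧ G.Adj v p ∧ G.Adj v q ∧ v ≠ p ∧ v ≠ q ∧ p ≠ q :=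
  ⟨h.mem (by simp), h.mem (by simp), h.adj (by simp), h.adj (by simp),
    (h.adj (w := p) (by simp)).ne, (h.adj (w := q) (by simp)).ne, by simpa using h.1⟩

theorem Nbs.three {v p q r : V} (h : Nbs G U v [p, q, r]) :
    p ∈ U ∧ q ∈ U ∧ r ∈ U ∧ G.Adj v p ∧ G.Adj v q ∧ G.Adj v r ∧ v ≠ p ∧ v ≠ q ∧ v ≠ r ∧
      p ≠ q ∧ p ≠ r ∧ q ≠ r := by
  have := h.1
  simp at this
  exact ⟨h.mem (by simp), h.mem (by simp), h.mem (by simp), h.adj (by simp), h.adj (by simp),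
    h.adj (by simp), (h.adj (w := p) (by simp)).ne, (h.adj (w := q) (by simp)).ne,
    (h.adj (w := r) (by simp)).ne, this.1.1, this.1.2, this.2⟩

theorem Fit.cons' {locs vs L : List V} {v : V} {m : List Bool} {js} {x : LV} (hN : Nbs G U v L)
    (hvU : v ∈ U) (hx : ℓ v = x) (hv : v ∉ vs) (hm : ∀ u ∈ L, u ∈ vs ∨ (true, u) ∈ m.zip locs)
    (h : Fit G ℓ (U \ vs.toFinset) (v :: locs) js vs) :
    Fit G ℓ (U \ (v :: vs).toFinset) locs ((m, opts x) :: js) (v :: vs) := by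
  refine Fit.cons hx (by simp) (fun u hu ha => ?_) ?_
  · simp only [Finset.mem_sdiff, List.mem_toFinset, List.mem_cons, not_or] at hu
    exact (hm u ((hN.2 u).1 ⟨hu.1, ha⟩)).resolve_left hu.2.2
  · have : insert v (U \ (v :: vs).toFinset) = U \ vs.toFinset := by
      ext w
      by_cases hw : w = v
      · subst hw; simp [hvU, hv]
      · simp [hw]
    rwa [this]

theorem nbs_of_dg_one {v : V} (h : dg G U v = 1) : ∃ p, Nbs G U v [p] := by
  obtain ⟨L, hL⟩ := exists_nbs (G := G) (U := U) v
  rw [hL.dg, List.length_eq_one_iff] at h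
  obtain ⟨p, rfl⟩ := h
  exact ⟨p, hL⟩

theorem nbs_of_dg_two {v u : V} (h : dg G U v = 2) (hu : u ∈ U) (ha : G.Adj v u) :
    ∃ p, Nbs G U v [u, p] := by
  obtain ⟨L, hL⟩ := exists_nbs_cons hu ha
  rw [hL.dg, List.length_cons, Nat.succ.injEq, List.length_eq_one_iff] at h
  obtain ⟨p, rfl⟩ := h
  exact ⟨p, hL⟩

end

section
variable {V : Type*} [Fintype V] {G : SimpleGraph V} {ℓ : V → LV} {U : Finset V}

variable (G U) in
/-- Starting from `C`, the vertices listed can be added one by one inside `U`, each having the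
indicated neighbours. -/
def Grow : Finset V → List (V × List V) → Prop
  | _, [] => True
  | C, (x, N) :: r => (x ∈ U ∧ x ∉ C) ∧ N.Nodup ∧ (∀ u ∈ N, u ∈ C ∧ G.Adj x u) ∧ Grow (insert x C) r

theorem Crit.grow (M : Crit G ℓ U) : ∀ (r : List (V × List V)) {C : Finset V}, C ⊆ U → Grow G U C r →
    0 ≤ rho G ℓ C + (r.map fun y => (ℓ y.1).wt - 3 * (y.2.length : ℤ)).sum
  | [], C, hC, _ => by simpa using M.nn C hC
  | (x, N) :: r, C, hC, ⟨⟨h1, h2⟩, h3, h4, h5⟩ => by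
    have h6 := M.grow r (Finset.insert_subset h1 hC) h5
    have h7 := rho_insert_le (ℓ := ℓ) h2 N h3 h4
    simp only [List.map_cons, List.sum_cons]
    linarith

/-- Deleting `vs` and adding the labels `ps` gives a colouring that does not extend to `vs`. -/
theorem Crit.reduce (M : Crit G ℓ U) (vs : List V) (hvs : vs ≠ []) (hvU : ∀ v ∈ vs, v ∈ U)
    (ps : List (V × PL)) (hps : ∀ p ∈ ps, p.1 ∈ U ∧ p.1 ∉ vs) (hpv : ∀ p ∈ ps, p.2.lv.kb = 0)
    (hc : ∀ C ⊆ U, (∀ v ∈ vs, v ∉ C) → 1 ≤ rho G ℓ C → pc C ps ≤ rho G ℓ C)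
    (h : ∀ ns ∈ secs (ps.map Prod.snd), ∃ vs' js, vs'.toFinset = vs.toFinset ∧
      Fit G ℓ (U \ vs'.toFinset) (ps.map Prod.fst) js vs' ∧ solve (fun _ => true) js ns = true) :
    False := by
  refine M.absurd (W := U \ vs.toFinset) vs hvs 
    (fun v hv h => (Finset.mem_sdiff.1 h).2 (by simpa using hv)) ?_ ps
    (fun p hp => by simpa using hps p hp)
    hpv ?_ ?_
  · exact Finset.sdiff_union_of_subset fun v hv => hvU v (by simpa using hv)
  · intro C hC hne
    have h1 : ∀ v ∈ vs, v ∉ C := fun v hv h => by have := hC h; simp [hv] at this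
    have h2 := hC.trans Finset.sdiff_subset
    refine hc C h2 h1 (M.one_le h2 hne ?_)
    rintro rfl
    obtain ⟨v, hv⟩ := List.exists_mem_of_ne_nil vs hvs
    exact h1 v hv (hvU v hv)
  · intro ns hns
    obtain ⟨vs', js, h1, h2, h3⟩ := h ns hns
    exact ⟨vs', js, h1, h1 ▸ h2, h3⟩

theorem wt_of_cost {x : LV} {n : ℕ} (h : x.cost = n) : x.wt = 4 - n := by
  rw [LV.wt, h]

theorem check3 : (((cheap 1).filter fun x => x.cost == 1).all fun x =>
    [(PL.O, PL.T), (PL.T, PL.O), (PL.T, PL.K true), (PL.L, PL.T)].any fun y =>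
      (secs [y.1, y.2]).all fun ns =>
        solve (fun _ => true) [([false, true], opts 0), ([true, true], opts x)] ns ||
        solve (fun _ => true) [([true], opts x), ([true, false, true], opts 0)] ns) = true := by
  decide +kernel

theorem Crit.thread_three (M : Crit G ℓ U) {u v p q : V} (hu : u ∈ U) (hv : v ∈ U)
    (hu0 : (ℓ u).cost = 0) (hv1 : (ℓ v).cost = 1)
    (hNu : Nbs G U u [v, q]) (hNv : Nbs G U v [u, p]) : False := by
  obtain ⟨-, hq, huv, huq, huv', huq', hvq⟩ := hNu.two
  obtain ⟨-, hp, -, hvp, -, hvp', hup⟩ := hNv.two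
  have h2 : ∀ C ⊆ U, (∀ w ∈ [u, v], w ∉ C) → p ∈ C → q ∈ C → 2 ≤ rho G ℓ C := by
    intro C hC hw hp hq
    have h3 := M.grow [(u, [q]), (v, [u, p])] hC (by
      simp at hw; simp [Grow, *, huv.symm, huv'.symm])
    simp [wt_of_cost hu0, wt_of_cost hv1] at h3
    linarith
  have hc := check3
  simp only [List.all_eq_true, List.any_eq_true] at hc
  obtain ⟨⟨y, y'⟩, hy, hc⟩ := hc (ℓ v) (by simpa [hv1] using mem_cheap hv1.le)
  refine M.reduce [u, v] (by simp) (by simp [hu, hv]) [(p, y), (q, y')]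
    (by simp [*, Ne.symm]) ?_ ?_ ?_
  · simp at hy
    rcases hy with ⟨rfl, rfl⟩ | ⟨rfl, rfl⟩ | ⟨rfl, rfl⟩ | ⟨rfl, rfl⟩ <;> simp [PL.lv]
  · intro C hC hw h1
    have h2 := h2 C hC hw
    simp at hy
    rcases hy with ⟨rfl, rfl⟩ | ⟨rfl, rfl⟩ | ⟨rfl, rfl⟩ | ⟨rfl, rfl⟩ <;> simp [pc, PL.lv, LV.cost] <;>
      split_ifs <;> grind
  · intro ns hns
    have := hc ns hns
    rw [Bool.or_eq_true] at this
    rcases this with h | h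
    · exact ⟨[u, v], _, rfl, Fit.cons' hNu hu (eq_zero_of_cost hu0) (by simpa) (by simp)
        (Fit.cons' hNv hv rfl (by simp) (by simp) Fit.nil), h⟩
    · exact ⟨[v, u], _, by simp [Finset.pair_comm], Fit.cons' hNv hv rfl (by simpa using huv'.symm)
        (by simp) (Fit.cons' hNu hu (eq_zero_of_cost hu0) (by simp) (by simp) Fit.nil), h⟩

theorem Crit.cost_le (M : Crit G ℓ U) {v : V} (hv : v ∈ U) : (ℓ v).cost ≤ 4 := by
  have h := M.grow [(v, [])] (Finset.empty_subset U) (by simp [Grow, hv])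
  simp [rho_empty, LV.wt] at h
  exact_mod_cast h

theorem check_isolated : (cheap 4).all (fun x => solve (fun _ => true) [([], opts x)] []) = true := by
  decide +kernel

theorem Crit.isolated (M : Crit G ℓ U) {v : V} (hv : v ∈ U) (hN : Nbs G U v []) : False := by
  have hc := check_isolated
  simp only [List.all_eq_true] at hc
  refine M.reduce [v] (by simp) (by simpa) [] (by simp) (by simp) ?_ ?_
  · intro C hC hw h1
    simp [pc]; omega
  · intro ns hns
    simp [secs] at hns
    subst hns
    exact ⟨[v], _, rfl, Fit.cons' hN hv rfl (by simp) (by simp) Fit.nil,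
      hc _ (mem_cheap (M.cost_le hv))⟩

theorem check_leaf : ((cheap 2).filter fun x => decide (x.kb ≤ 1)).all (fun x =>
    [PL.O, PL.B, PL.L].any fun y => (secs [y]).all fun ns =>
      solve (fun _ => true) [([true], opts x)] ns) = true := by
  decide +kernel

theorem Crit.leaf (M : Crit G ℓ U) {v p : V} (hv : v ∈ U) (hc2 : (ℓ v).cost ≤ 2)
    (hN : Nbs G U v [p]) : False := by
  obtain ⟨hp, -, hvp⟩ := hN.one
  have hc := check_leaf
  simp only [List.all_eq_true, List.any_eq_true] at hc
  obtain ⟨y, hy, hc⟩ := hc (ℓ v) (by simpa [M.pv v hv] using mem_cheap hc2)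
  simp at hy
  refine M.reduce [v] (by simp) (by simpa) [(p, y)] (by simp [hp, hvp.symm]) ?_ ?_ ?_
  · rcases hy with rfl | rfl | rfl <;> simp [PL.lv]
  · intro C hC hw h1
    rcases hy with rfl | rfl | rfl <;> simp [pc, PL.lv, LV.cost] <;> (try split_ifs) <;> omega
  · intro ns hns
    exact ⟨[v], _, rfl, Fit.cons' hN hv rfl (by simp) (by simp) Fit.nil, hc _ hns⟩

theorem check_leaf_free : (cheap 3).all (fun x => (secs [PL.T]).all fun ns =>
    solve (fun _ => true) [([true], opts 0), ([true], opts x)] ns) = true := by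
  decide +kernel

theorem Crit.leaf_free (M : Crit G ℓ U) {v u q : V} (hv : v ∈ U) (hc3 : (ℓ v).cost ≤ 3)
    (hu0 : ℓ u = 0) (hNv : Nbs G U v [u]) (hNu : Nbs G U u [v, q]) : False := by
  obtain ⟨hu, -, hvu⟩ := hNv.one
  obtain ⟨-, hq, -, -, -, huq, hvq⟩ := hNu.two
  have hc := check_leaf_free
  simp only [List.all_eq_true] at hc
  refine M.reduce [u, v] (by simp) (by simp [hu, hv]) [(q, .T)] (by simp [hq, huq.symm, hvq.symm])
    (by simp [PL.lv]) ?_ ?_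
  · intro C hC hw h1
    simp [pc, PL.lv, LV.cost]; split_ifs <;> omega
  · intro ns hns
    exact ⟨[u, v], _, rfl, Fit.cons' hNu hu hu0 (by simpa using hvu.symm) (by simp)
      (Fit.cons' hNv hv rfl (by simp) (by simp) Fit.nil), hc _ (mem_cheap hc3) _ hns⟩

theorem check_thread_two : ((secs [PL.T, PL.O]).all fun ns =>
    solve (fun _ => true) [([true], opts 0), ([true, false, true], opts 0)] ns ||
    solve (fun _ => true) [([false, true], opts 0), ([true, true], opts 0)] ns) = true := by
  decide +kernel

theorem Crit.thread_two (M : Crit G ℓ U) {u v p q : V} (hu0 : ℓ u = 0) (hv0 : ℓ v = 0)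
    (hNu : Nbs G U u [v, p]) (hNv : Nbs G U v [u, q]) : False := by
  obtain ⟨hv, hp, -, -, huv, hup, hvp⟩ := hNu.two
  obtain ⟨hu, hq, -, -, -, hvq, huq⟩ := hNv.two
  have hc := check_thread_two
  simp only [List.all_eq_true, Bool.or_eq_true] at hc
  refine M.reduce [u, v] (by simp) (by simp [hu, hv]) [(p, .T), (q, .O)]
    (by simp [hp, hq, huq.symm, hvq.symm, hup.symm, hvp.symm])
    (by simp [PL.lv]) ?_ ?_
  · intro C hC hw h1
    simp [pc, PL.lv, LV.cost]; split_ifs <;> omega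
  · intro ns hns
    rcases hc ns hns with h | h
    · exact ⟨[u, v], _, rfl, Fit.cons' hNu hu hu0 (by simpa using huv) (by simp)
        (Fit.cons' hNv hv hv0 (by simp) (by simp) Fit.nil), h⟩
    · exact ⟨[v, u], _, by simp [Finset.pair_comm], Fit.cons' hNv hv hv0 (by simpa using huv.symm)
        (by simp) (Fit.cons' hNu hu hu0 (by simp) (by simp) Fit.nil), h⟩

theorem check_two_free : (cheap 2).all (fun x => (secs [PL.T, PL.O]).all fun ns =>
    solve (fun _ => true) [([false, true], opts 0), ([true], opts x),
      ([true, false, true], opts 0)] ns) = true := by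
  decide +kernel

theorem Crit.two_free (M : Crit G ℓ U) {v u₁ u₂ q₁ q₂ : V} (hv : v ∈ U) (hc2 : (ℓ v).cost ≤ 2)
    (h1 : ℓ u₁ = 0) (h2 : ℓ u₂ = 0) (hNv : Nbs G U v [u₁, u₂]) (hN1 : Nbs G U u₁ [v, q₁])
    (hN2 : Nbs G U u₂ [v, q₂]) : False := by
  obtain ⟨hu1, hu2, -, -, hv1, hv2, h12⟩ := hNv.two
  obtain ⟨-, hq1, -, a1, -, hn1, hvq1⟩ := hN1.two
  obtain ⟨-, hq2, -, a2, -, hn2, hvq2⟩ := hN2.two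
  have k1 : q₁ ≠ u₂ := by
    rintro rfl
    have := (hN2.2 u₁).1 ⟨hu1, a1.symm⟩
    simp [hv1.symm] at this
    subst this
    exact M.thread_two h1 h2 (hN1.perm (List.Perm.swap _ _ _)) (hN2.perm (List.Perm.swap _ _ _))
  have k2 : q₂ ≠ u₁ := by
    rintro rfl
    have := (hN1.2 u₂).1 ⟨hu2, a2.symm⟩
    simp [hv2.symm] at this
    exact k1 this.symm
  have hc := check_two_free
  simp only [List.all_eq_true] at hc
  refine M.reduce [u₂, v, u₁] (by simp) (by simp [hu1, hu2, hv]) [(q₁, .T), (q₂, .O)]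
    (by simp [hq1, hq2, k1, k2, hn1.symm, hn2.symm, hvq1.symm, hvq2.symm])
    (by simp [PL.lv]) ?_ ?_
  · intro C hC hw h1
    simp [pc, PL.lv, LV.cost]; split_ifs <;> omega
  · intro ns hns
    exact ⟨[u₂, v, u₁], _, rfl, Fit.cons' hN2 hu2 h2 (by simp [hv2.symm, h12.symm]) (by simp)
        (Fit.cons' hNv hv rfl (by simp [hv1]) (by simp) (Fit.cons' hN1 hu1 h1 (by simp) (by simp)
        Fit.nil)), hc _ (mem_cheap hc2) _ hns⟩

theorem check_three_free : (cheap 1).all (fun x => (secs [PL.O, PL.O, PL.O]).all fun ns =>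
    solve (fun _ => true) [([true], opts 0), ([true], opts x),
      ([true, false, false, true], opts 0),
      ([false, true, false, false, false, true], opts 0)] ns ||
    solve (fun _ => true) [([false, false, true], opts 0), ([true], opts x),
      ([true, false, true], opts 0),
      ([false, true, false, false, true], opts 0)] ns ||
    solve (fun _ => true) [([false, true], opts 0), ([true], opts x),
      ([true, false, true], opts 0),
      ([false, true, false, false, false, true], opts 0)] ns) = true := by
  decide +kernel

theorem Crit.end_ne (M : Crit G ℓ U) {u₁ u₂ v v' q₁ q₂ : V} (h1 : ℓ u₁ = 0) (h2 : ℓ u₂ = 0)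
    (hu1 : u₁ ∈ U)
    (hN1 : Nbs G U u₁ [v, q₁]) (hN2 : Nbs G U u₂ [v', q₂]) : q₁ ≠ u₂ := by
  rintro rfl
  obtain ⟨-, hq1, -, a1, -, hn1, hvq1⟩ := hN1.two
  have := (hN2.2 u₁).1 ⟨hu1, a1.symm⟩
  simp at this
  rcases this with rfl | rfl
  · exact M.thread_two h1 h2 (hN1.perm (List.Perm.swap _ _ _)) hN2
  · exact M.thread_two h1 h2 (hN1.perm (List.Perm.swap _ _ _)) (hN2.perm (List.Perm.swap _ _ _))

theorem Crit.three_free (M : Crit G ℓ U) {x u₁ u₂ u₃ q₁ q₂ q₃ : V} (hx : x ∈ U)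
    (hc1 : (ℓ x).cost ≤ 1) (h1 : ℓ u₁ = 0) (h2 : ℓ u₂ = 0) (h3 : ℓ u₃ = 0)
    (hNx : Nbs G U x [u₁, u₂, u₃]) (hN1 : Nbs G U u₁ [x, q₁]) (hN2 : Nbs G U u₂ [x, q₂])
    (hN3 : Nbs G U u₃ [x, q₃]) : False := by
  obtain ⟨hu1, hu2, hu3, -, -, -, hx1, hx2, hx3, h12, h13, h23⟩ := hNx.three
  obtain ⟨-, hq1, -, a1, -, hn1, hxq1⟩ := hN1.two
  obtain ⟨-, hq2, -, a2, -, hn2, hxq2⟩ := hN2.two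
  obtain ⟨-, hq3, -, a3, -, hn3, hxq3⟩ := hN3.two
  have k12 := M.end_ne h1 h2 hu1 hN1 hN2
  have k13 := M.end_ne h1 h3 hu1 hN1 hN3
  have k21 := M.end_ne h2 h1 hu2 hN2 hN1
  have k23 := M.end_ne h2 h3 hu2 hN2 hN3
  have k31 := M.end_ne h3 h1 hu3 hN3 hN1
  have k32 := M.end_ne h3 h2 hu3 hN3 hN2
  have hc := check_three_free
  simp only [List.all_eq_true, Bool.or_eq_true] at hc
  refine M.reduce [u₁, x, u₂, u₃] (by simp) (by simp [*]) [(q₁, .O), (q₂, .O), (q₃, .O)]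
    (by simp [*, Ne.symm]) (by simp [PL.lv]) ?_ ?_
  · intro C hC hw h1
    simp [pc, PL.lv, LV.cost]; omega
  · intro ns hns
    rcases hc _ (mem_cheap hc1) ns hns with (h | h) | h
    · exact ⟨[u₁, x, u₂, u₃], _, rfl, Fit.cons' hN1 hu1 h1 (by simp [*, Ne.symm]) (by simp)
        (Fit.cons' hNx hx rfl (by simp [*]) (by simp) (Fit.cons' hN2 hu2 h2 (by simp [*]) (by simp)
        (Fit.cons' hN3 hu3 h3 (by simp) (by simp) Fit.nil))), h⟩
    · exact ⟨[u₃, x, u₁, u₂], _, by ext; simp; tauto, Fit.cons' hN3 hu3 h3 (by simp [*, Ne.symm])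
        (by simp) (Fit.cons' hNx hx rfl (by simp [*]) (by simp) (Fit.cons' hN1 hu1 h1
        (by simp [*]) (by simp) (Fit.cons' hN2 hu2 h2 (by simp) (by simp) Fit.nil))), h⟩
    · exact ⟨[u₂, x, u₁, u₃], _, by ext; simp; tauto, Fit.cons' hN2 hu2 h2 (by simp [*, Ne.symm])
        (by simp) (Fit.cons' hNx hx rfl (by simp [*]) (by simp) (Fit.cons' hN1 hu1 h1
        (by simp [*]) (by simp) (Fit.cons' hN3 hu3 h3 (by simp) (by simp) Fit.nil))), h⟩
end

/-- Places at the ends of an edge that allow the edge to be added, the first end being older. -/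
def cross (x z : Nd) : Bool :=
  (x.c == none && z.c == none && z.r) || (x.c == none && z.c != none && x.sp z.c) ||
    (x.c != none && z.c == none && z.sp x.c)

section
variable {V : Type*} {G : SimpleGraph V}

theorem nb_le_ite {N : Finset V} {col : V → Option Bool} {v e : V} {s : Option Bool} {p : Prop}
    [Decidable p] (h : ∀ u ∈ N, G.Adj v u → u = e ∧ p) :
    nb G N col v s ≤ if p ∧ col e = s then 1 else 0 := by
  split_ifs with hp
  · refine (Finset.card_le_card fun u hu => ?_).trans (Finset.card_singleton e).le
    obtain ⟨h1, h2, h3⟩ := Finset.mem_filter.1 hu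
    simpa using (h u h1 h2).1
  · refine (nb_eq_zero fun u hu ha hs => hp ?_).le
    obtain ⟨rfl, h2⟩ := h u hu ha
    exact ⟨h2, hs⟩

/-- Gluing along a single edge `e r` when the newer part `R` was coloured relative to `Y` and the
older part has meanwhile been enlarged by `N`. -/
theorem St.glue_edge {ℓ : V → LV} {Y N R : Finset V} {col : V → Option Bool}
    {ns ms : List (V × Nd)} {e r : V} {ne nr : Nd} (hYN : Disjoint Y N)
    (hR : Disjoint (Y ∪ N) R)
    (h1 : St G ℓ (Y ∪ N) col ((e, ne) :: ns))
    (h2 : St G (fun v => ℓ v + sl G Y col v) R col ((r, nr) :: ms))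
    (he : ∀ u ∈ N, ∀ v ∈ R, G.Adj u v → u = e ∧ v = r) (hc : cross ne nr = true) :
    St G ℓ (Y ∪ N ∪ R) col (ns ++ ms) := by
  obtain ⟨κA, hA1, hA2, hA3⟩ := h1
  obtain ⟨κB, hB1, hB2, hB3⟩ := h2
  have hnA : ∀ v ∈ Y ∪ N, v ∉ R := fun v hv hv' => Finset.disjoint_left.1 hR hv hv'
  have hmsA : ∀ v ∈ Y ∪ N, ∀ s, eps ms v s = 0 := fun v hv s =>
    eps_eq_zero (fun p hp he => hnA v hv (by rw [← he]; exact (hB3 p (by simp [hp])).1)) s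
  have hnsB : ∀ v ∈ R, ∀ s, eps ns v s = 0 := fun v hv s =>
    eps_eq_zero (fun p hp he => hnA v (by rw [← he]; exact (hA3 p (by simp [hp])).1) hv) s
  have hcross : ∀ u ∈ Y, ∀ v ∈ R, G.Adj u v → col v = none := by
    intro u hu v hv ha
    have := hB2 v hv
    rcases hcv : col v with _ | c
    · rfl
    · rw [hcv] at this
      exact absurd rfl (ne_of_nb_eq_zero (nb_eq_zero_of_meets this (col u)) hu ha.symm)
  have hce : col e = ne.c := (hA3 (e, ne) (by simp)).2
  have hcr : col r = nr.c := (hB3 (r, nr) (by simp)).2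
  have hcN : ∀ v ∈ Y ∪ N, ∀ c, nb G R col v (some c) ≤ if v = e ∧ col r = some c then 1 else 0 := by
    intro v hv c
    rcases Finset.mem_union.1 hv with hv | hv
    · rw [nb_eq_zero (fun u hu ha he => by rw [hcross v hv u hu ha] at he; cases he)]
      exact Nat.zero_le _
    · exact nb_le_ite fun u hu ha => (he v hv u hu ha).symm
  have hcR : ∀ v ∈ R, ∀ s, nb G N col v s ≤ if v = r ∧ col e = s then 1 else 0 :=
    fun v hv s => nb_le_ite fun u hu ha => he u hu v hv ha.symm
  simp only [cross, Bool.or_eq_true, Bool.and_eq_true, beq_iff_eq, bne_iff_ne, ne_eq] at hc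
  rw [← hce, ← hcr] at hc
  refine ⟨fun v s => if v ∈ Y ∪ N then κA v s else κB v s - nb G Y col v s,
    Raw.glue hR hA1 hB1 ?_ ?_ ?_ ?_ ?_, ?_, ?_⟩
  · intro v hv c hcv
    have h3 := hcN v hv c
    simp only [eps_append, eps_cons, hmsA v hv, if_pos hv]
    by_cases hve : v = e ∧ col r = some c
    · obtain ⟨rfl, h4⟩ := hve
      have h5 : ne.sp (some c) = true := by
        rcases hc with (⟨⟨-, h⟩, -⟩ | ⟨⟨-, -⟩, h⟩) | ⟨⟨-, h⟩, -⟩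
        · simp [h4] at h
        · rwa [h4] at h
        · simp [h4] at h
      simp [h4] at h3
      simp [h5]; omega
    · simp [hve] at h3
      omega
  · intro v hv
    simp only [eps_append, eps_cons, hmsA v hv, if_pos hv]; omega
  · intro v hv c hcv
    have hvA : v ∉ Y ∪ N := fun h => hnA v h hv
    have h3 := hcR v hv (some c)
    simp only [eps_append, eps_cons, hnsB v hv, if_neg hvA, nb_union hYN]
    have h6 : nb G Y col v (some c) ≤ κB v (some c) := by
      rcases hcv' : col v with _ | c'
      · have := hB2 v hv
        rw [hcv'] at this
        exact (Meets.of_add_sl this).2 rfl (some c)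
      · rw [nb_eq_zero (fun u hu ha he => by rw [hcross u hu v hv ha.symm] at hcv'; cases hcv')]
        omega
    by_cases hve : v = r ∧ col e = some c
    · obtain ⟨rfl, h4⟩ := hve
      have h5 : nr.sp (some c) = true := by
        rcases hc with (⟨⟨h, -⟩, -⟩ | ⟨⟨h, -⟩, -⟩) | ⟨⟨-, -⟩, h⟩
        · simp [h4] at h
        · simp [h4] at h
        · rwa [h4] at h
      simp [h4] at h3
      simp [h5]; omega
    · simp [hve] at h3
      omega
  · intro v hv hcv
    have hvA : v ∉ Y ∪ N := fun h => hnA v h hv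
    have h3 := hcR v hv none
    have h6 := hB2 v hv
    rw [hcv] at h6
    have h6 := (Meets.of_add_sl h6).2 rfl none
    simp only [eps_append, eps_cons, hnsB v hv, if_neg hvA, nb_union hYN]
    by_cases hve : v = r ∧ col e = none
    · obtain ⟨rfl, h4⟩ := hve
      have h5 : nr.sp none = true := by
        rcases hc with (⟨⟨-, -⟩, h⟩ | ⟨⟨-, h⟩, -⟩) | ⟨⟨h, -⟩, -⟩
        · exact h
        · exact absurd hcv h
        · exact absurd h4 h
      simp [h4] at h3
      simp [h5]; omega
    · simp [hve] at h3
      omega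
  · intro u hu v hv ha c hcu
    rcases Finset.mem_union.1 hu with hu | hu
    · rw [hcross u hu v hv ha]; simp
    · obtain ⟨rfl, rfl⟩ := he u hu v hv ha
      rcases hc with (⟨⟨h, -⟩, -⟩ | ⟨⟨h, -⟩, -⟩) | ⟨⟨-, h⟩, -⟩
      · simp [hcu] at h
      · simp [hcu] at h
      · rw [h]; simp
  · intro v hv
    by_cases hvA : v ∈ Y ∪ N
    · simp only [hvA, if_true]; exact hA2 v hvA
    · have hvB := (Finset.mem_union.1 hv).resolve_left hvA
      simp only [hvA, if_false]
      exact (Meets.of_add_sl (hB2 v hvB)).1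
  · intro p hp
    rcases List.mem_append.1 hp with hp | hp
    · have := hA3 p (by simp [hp])
      exact ⟨Finset.mem_union_left _ this.1, this.2⟩
    · have := hB3 p (by simp [hp])
      exact ⟨Finset.mem_union_right _ this.1, this.2⟩
end

section
variable {V : Type*} [Fintype V] {G : SimpleGraph V} {ℓ : V → LV} {U : Finset V}

/-- A coloured set is extended by `R`; the new part is described relative to the old one. -/
theorem Crit.extend (M : Crit G ℓ U) {B R : Finset V} (col : V → Option Bool)
    (hBR : Disjoint B R) (hR : R.card < U.card) (ps : List (V × PL))
    (hps : ∀ p ∈ ps, p.1 ∈ R) (hpv : ∀ v ∈ R, (addl ℓ ps v).kb ≤ 1)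
    (hc : ∀ C ⊆ R, C.Nonempty → pc C ps + rho G ℓ B ≤ rho G ℓ (B ∪ C)) :
    ∃ ns ∈ secs (ps.map Prod.snd), ∃ col', (∀ v ∈ B, col' v = col v) ∧
      St G (fun v => ℓ v + sl G B col' v) R col' ((ps.map Prod.fst).zip ns) := by
  have hpc : ∀ ps : List (V × PL), pc ∅ ps = 0 := fun ps => by
    induction ps with
    | nil => rfl
    | cons p ps ih => simp [pc, ih]
  have hkb : ∀ ps v, (addl (fun v => ℓ v + sl G B col v) ps v).kb = (addl ℓ ps v).kb := by
    intro ps v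
    induction ps with
    | nil => simp [addl, LV.add_eq, sl]
    | cons p ps ih => 
      obtain ⟨p, x⟩ := p
      change (addl _ ps v).kb + _ = (addl _ ps v).kb + _
      rw [ih]
  obtain ⟨col1, h1⟩ := M.ih R (addl (fun v => ℓ v + sl G B col v) ps) hR
    (fun v hv => (hkb ps v).le.trans (hpv v hv)) (fun C hC => by
      rw [rho_addl, rho_add, Finset.sum_congr rfl fun v _ => by rw [cost_sl]]
      rcases C.eq_empty_or_nonempty with rfl | hne
      · simp [rho_empty, hpc]
      · have h2 := hc C hC hne
        rw [rho_union (Finset.disjoint_of_subset_right hC hBR)] at h2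
        push_cast
        rw [← Finset.mul_sum]
        linarith)
  obtain ⟨ns, h2, h3⟩ := St.drop_all ps [] h1 hps
  set col' : V → Option Bool := fun v => if v ∈ B then col v else col1 v with hcol'
  have e1 : ∀ v ∈ B, col' v = col v := fun v hv => by simp [hcol', hv]
  have e2 : ∀ v ∈ R, col1 v = col' v := fun v hv => by
    have : v ∉ B := fun h => Finset.disjoint_left.1 hBR h hv
    simp [hcol', this]
  refine ⟨ns, mem_secs h2, col', e1, ?_⟩
  have := h3.congr e2 (ℓ' := fun v => ℓ v + sl G B col' v) fun v hv => by
    simp only [sl, nb_congr (fun u hu => (e1 u hu))]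
  simpa using this

theorem Crit.grow_one (M : Crit G ℓ U) : ∀ (r : List (V × List V)) {C : Finset V}, C ⊆ U →
    C.Nonempty → (∃ w ∈ U, w ∉ C ∧ w ∉ r.map Prod.fst) → Grow G U C r →
    1 ≤ rho G ℓ C + (r.map fun y => (ℓ y.1).wt - 3 * (y.2.length : ℤ)).sum
  | [], C, hC, hne, ⟨w, hw, hwC, _⟩, _ => by
    simpa using M.one_le hC hne fun h => hwC (h ▸ hw)
  | (x, N) :: r, C, hC, hne, ⟨w, hw, hwC, hwr⟩, ⟨⟨h1, h2⟩, h3, h4, h5⟩ => by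
    simp at hwr
    have h6 := M.grow_one r (Finset.insert_subset h1 hC) (Finset.insert_nonempty _ _)
      ⟨w, hw, by simp [hwC, hwr.1], by simpa using hwr.2⟩ h5
    have h7 := rho_insert_le (ℓ := ℓ) h2 N h3 h4
    simp only [List.map_cons, List.sum_cons]
    linarith
end

theorem of_mem_secs_one {ns : List Nd} {y : PL} (h : ns ∈ secs [y]) : ∃ n ∈ y.drop, ns = [n] := by
  simp only [secs, List.mem_flatMap, List.map_cons, List.map_nil, List.mem_singleton] at h
  exact h

theorem of_mem_secs_two {ns : List Nd} {y z : PL} (h : ns ∈ secs [y, z]) :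
    ∃ n ∈ y.drop, ∃ m ∈ z.drop, ns = [n, m] := by
  rw [secs, List.mem_flatMap] at h
  obtain ⟨n, h1, h2⟩ := h
  obtain ⟨ms, h3, rfl⟩ := List.mem_map.1 h2
  obtain ⟨m, h4, rfl⟩ := of_mem_secs_one h3
  exact ⟨n, h1, m, h4, rfl⟩

theorem of_mem_secs_three {ns : List Nd} {y z w : PL} (h : ns ∈ secs [y, z, w]) :
    ∃ n ∈ y.drop, ∃ m ∈ z.drop, ∃ k ∈ w.drop, ns = [n, m, k] := by
  rw [secs, List.mem_flatMap] at h
  obtain ⟨n, h1, h2⟩ := h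
  obtain ⟨ms, h3, rfl⟩ := List.mem_map.1 h2
  obtain ⟨m, h4, k, h5, rfl⟩ := of_mem_secs_two h3
  exact ⟨n, h1, m, h4, k, h5, rfl⟩

/-- A vertex with three neighbours `y₁`, `y₂`, `z`, the first two of which lead on to `q₁`, `q₂`,
can be coloured together with `y₁`, `y₂`. -/
noncomputable def armsFit (n₁ n₂ nz : Nd) : Bool :=
  solve (fun _ => true) [([false, false, true], opts 0), ([true, true], opts 0),
    ([false, true, false, true], opts 0)] [n₁, n₂, nz] ||
  solve (fun _ => true) [([true], opts 0), ([true, false, false, true], opts 0),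
    ([true, false, false, true], opts 0)] [n₁, n₂, nz] ||
  solve (fun _ => true) [([false, true], opts 0), ([true, false, false, true], opts 0),
    ([true, false, true], opts 0)] [n₁, n₂, nz]

/-- As `armsFit`, but `z` is newer than the arms. -/
noncomputable def armsFit₁ (n₁ n₂ nz : Nd) : Bool :=
  solve (fun ns => match ns with
    | _ :: nx :: _ => cross nx nz
    | _ => false) [([false, true], opts 0), ([true], opts 0),
    ([true, false, true], opts 0)] [n₁, n₂]

/-- As `armsFit`, but both `z` and `q₁` are newer than the arms. -/
noncomputable def armsFit₂ (n₁ n₂ nz : Nd) : Bool :=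
  solve (fun ns => match ns with
    | ny :: nx :: _ => cross ny n₁ && cross nx nz
    | _ => false) [([true], opts 0), ([true], opts 0), ([true], opts 0)] [n₂]

theorem check_arms_tight : (PL.drop .O).all (fun n₁ => (PL.drop .O).all fun n₂ =>
    [PL.TB, PL.TT].any fun y => y.drop.all fun nz => armsFit n₁ n₂ nz) = true := by
  decide +kernel

theorem check_arms_loose : (PL.drop .TT).all (fun n₁ => (PL.drop .T).all fun n₂ =>
    (PL.drop .O).all fun nz => armsFit n₁ n₂ nz) = true := by
  decide +kernel

theorem check_arms_mid : (PL.drop .TT).all (fun n₁ => (PL.drop .O).all fun n₂ =>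
    [PL.T, PL.K true, PL.K false].any fun y => y.drop.all fun nz =>
      armsFit n₁ n₂ nz || armsFit₁ n₁ n₂ nz) = true := by
  decide +kernel

theorem check_arms_low : (PL.drop .T).all (fun n₂ =>
    [PL.T, PL.B, PL.K true, PL.L].any fun y => y.drop.all fun n₁ =>
    [PL.T, PL.B, PL.K true, PL.L].any fun y => y.drop.all fun nz =>
      armsFit n₁ n₂ nz || armsFit₂ n₁ n₂ nz) = true := by
  decide +kernel

theorem check_arms_triangle : (PL.drop .TT).all (fun nz => (PL.drop .O).all fun n₁ =>
    solve (fun _ => true) [([false, true], opts 0), ([true, true], opts 0),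
      ([true, false, true], opts 0)] [nz, n₁]) = true := by
  decide +kernel

theorem check_arms_square : (PL.drop .TT).all (fun n => (PL.drop .T).all fun nz =>
    solve (fun _ => true) [([false, true], opts 0), ([true, true], opts 0),
      ([false, true, true], opts 0)] [n, nz] ||
    solve (fun _ => true) [([true], opts 0), ([true, false, true], opts 0),
      ([true, false, true], opts 0)] [n, nz]) = true := by
  decide +kernel

section
variable {V : Type*} [Fintype V] {G : SimpleGraph V} {ℓ : V → LV} {U : Finset V}

variable (G ℓ U) in
/-- A vertex `x` with neighbours `y₁`, `y₂`, `z`, where `y₁`, `y₂` lead on to `q₁`, `q₂`. -/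
structure Arms (x y₁ y₂ z q₁ q₂ : V) : Prop where
  hx : x ∈ U
  x0 : ℓ x = 0
  h1 : ℓ y₁ = 0
  h2 : ℓ y₂ = 0
  nx : Nbs G U x [y₁, y₂, z]
  n1 : Nbs G U y₁ [x, q₁]
  n2 : Nbs G U y₂ [x, q₂]

variable {x y₁ y₂ z q₁ q₂ : V}

theorem Arms.swap (P : Arms G ℓ U x y₁ y₂ z q₁ q₂) : Arms G ℓ U x y₂ y₁ z q₂ q₁ :=
  ⟨P.hx, P.x0, P.h2, P.h1, P.nx.perm (List.Perm.swap _ _ _), P.n2, P.n1⟩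

theorem Arms.facts (P : Arms G ℓ U x y₁ y₂ z q₁ q₂) (M : Crit G ℓ U) :
    (y₁ ∈ U ∧ y₂ ∈ U ∧ z ∈ U ∧ q₁ ∈ U ∧ q₂ ∈ U) ∧ (x ≠ y₁ ∧ x ≠ y₂ ∧ x ≠ z ∧ x ≠ q₁ ∧ x ≠ q₂) ∧
    (y₁ ≠ y₂ ∧ y₁ ≠ z ∧ y₂ ≠ z ∧ q₁ ≠ y₁ ∧ q₁ ≠ y₂ ∧ q₂ ≠ y₁ ∧ q₂ ≠ y₂) ∧
    G.Adj x y₁ ∧ G.Adj x y₂ ∧ G.Adj x z ∧ G.Adj y₁ q₁ ∧ G.Adj y₂ q₂ := by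
  obtain ⟨hu1, hu2, hu3, a1, a2, a3, hx1, hx2, hx3, h12, h13, h23⟩ := P.nx.three
  obtain ⟨-, hq1, -, b1, -, hn1, hxq1⟩ := P.n1.two
  obtain ⟨-, hq2, -, b2, -, hn2, hxq2⟩ := P.n2.two
  have k12 := M.end_ne P.h1 P.h2 hu1 P.n1 P.n2
  have k21 := M.end_ne P.h2 P.h1 hu2 P.n2 P.n1
  exact ⟨⟨hu1, hu2, hu3, hq1, hq2⟩, ⟨hx1, hx2, hx3, hxq1, hxq2⟩, ⟨h12, h13, h23, hn1.symm, k12,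
    k21, hn2.symm⟩, a1, a2, a3, b1, b2⟩

theorem wt_zero {x : LV} (h : x = 0) : x.wt = 4 := by subst h; rfl

theorem Arms.three_le (P : Arms G ℓ U x y₁ y₂ z q₁ q₂) (M : Crit G ℓ U) {C : Finset V}
    (hC : C ⊆ U) (hx : x ∉ C) (h1 : y₁ ∉ C) (h2 : y₂ ∉ C) (hq1 : q₁ ∈ C) (hq2 : q₂ ∈ C)
    (hz : z ∈ C) : 3 ≤ rho G ℓ C := by
  obtain ⟨m, n, k, a⟩ := P.facts M
  have h3 := M.grow [(y₁, [q₁]), (y₂, [q₂]), (x, [y₁, y₂, z])] hC (by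
      simp [Grow, *, Ne.symm, P.hx, Ne.symm k.1])
  simp [wt_zero P.x0, wt_zero P.h1, wt_zero P.h2] at h3
  linarith

theorem Arms.two_le (P : Arms G ℓ U x y₁ y₂ z q₁ q₂) (M : Crit G ℓ U) {C : Finset V}
    (hC : C ⊆ U) (hx : x ∉ C) (h1 : y₁ ∉ C) (h2 : y₂ ∉ C) (hq1 : q₁ ∈ C)
    (hz : z ∈ C) : 2 ≤ rho G ℓ C := by
  obtain ⟨m, n, k, a⟩ := P.facts M
  have h3 := M.grow_one [(y₁, [q₁]), (x, [y₁, z])] hC ⟨_, hz⟩ ⟨y₂, by simp [*, Ne.symm]⟩ (by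
      simp [Grow, *, Ne.symm, P.hx])
  simp [wt_zero P.x0, wt_zero P.h1] at h3
  linarith

theorem Arms.finish (P : Arms G ℓ U x y₁ y₂ z q₁ q₂) (M : Crit G ℓ U) {col} {n₁ n₂ nz : Nd}
    (h : St G ℓ (U \ {x, y₁, y₂}) col [(q₁, n₁), (q₂, n₂), (z, nz)])
    (hf : armsFit n₁ n₂ nz = true) : False := by
  obtain ⟨m, n, k, a⟩ := P.facts M
  have key : ∀ vs js, vs.toFinset = {x, y₁, y₂} → Fit G ℓ (U \ vs.toFinset) [q₁, q₂, z] js vs →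
      solve (fun _ => true) js [n₁, n₂, nz] = true → False := by
    intro vs js hvs hfit hs
    rw [hvs] at hfit
    obtain ⟨col', ns', -, -, -, h7⟩ := Fit.sound js vs hfit hs rfl h
    rw [hvs, Finset.sdiff_union_of_subset] at h7
    · exact M.no _ _ h7
    · intro v hv
      simp at hv
      rcases hv with rfl | rfl | rfl
      exacts [P.hx, m.1, m.2.1]
  simp only [armsFit, Bool.or_eq_true] at hf
  rcases hf with (hf | hf) | hf
  · refine key [x, y₁, y₂] _ (by simp) ?_ hf
    exact Fit.cons' P.nx P.hx P.x0 (by simp [*]) (by simp) (Fit.cons' P.n1 m.1 P.h1 (by simp [*])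
      (by simp) (Fit.cons' P.n2 m.2.1 P.h2 (by simp) (by simp) Fit.nil))
  · refine key [y₁, x, y₂] _ (by ext; simp; tauto) ?_ hf
    exact Fit.cons' P.n1 m.1 P.h1 (by simp [*, Ne.symm]) (by simp) (Fit.cons' P.nx P.hx P.x0
      (by simp [*]) (by simp) (Fit.cons' P.n2 m.2.1 P.h2 (by simp) (by simp) Fit.nil))
  · refine key [y₂, x, y₁] _ (by ext; simp; tauto) ?_ hf
    exact Fit.cons' P.n2 m.2.1 P.h2 (by simp [*, Ne.symm, k.1.symm]) (by simp)
      (Fit.cons' P.nx P.hx P.x0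
      (by simp [*]) (by simp) (Fit.cons' P.n1 m.1 P.h1 (by simp) (by simp) Fit.nil))

theorem Fit.cons_nbs {D : Finset V} {locs vs L : List V} {v : V} {m : List Bool} {js} {x : LV}
    (hN : Nbs G U v L) (hD : D ⊆ U) (hx : ℓ v = x) (hv : v ∉ D)
    (hm : ∀ u ∈ L, u ∈ D → (true, u) ∈ m.zip locs)
    (h : Fit G ℓ (insert v D) (v :: locs) js vs) : Fit G ℓ D locs ((m, opts x) :: js) (v :: vs) :=
  Fit.cons hx hv (fun u hu ha => hm u ((hN.2 u).1 ⟨hD hu, ha⟩) hu) h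

theorem Arms.sub (P : Arms G ℓ U x y₁ y₂ z q₁ q₂) (M : Crit G ℓ U) {C : Finset V}
    (hC : C ⊆ U \ {x, y₁, y₂}) : C ⊆ U ∧ x ∉ C ∧ y₁ ∉ C ∧ y₂ ∉ C := by
  refine ⟨hC.trans Finset.sdiff_subset, ?_, ?_, ?_⟩ <;> intro h <;> simpa using hC h

theorem Arms.one_le (P : Arms G ℓ U x y₁ y₂ z q₁ q₂) (M : Crit G ℓ U) {C : Finset V}
    (hC : C ⊆ U \ {x, y₁, y₂}) (hne : C.Nonempty) : 1 ≤ rho G ℓ C := by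
  obtain ⟨h, hx, -, -⟩ := P.sub M hC
  exact M.one_le h hne fun e => hx (e ▸ P.hx)

theorem Arms.ssub (P : Arms G ℓ U x y₁ y₂ z q₁ q₂) {C : Finset V}
    (hC : C ⊆ U \ {x, y₁, y₂}) : C ⊂ U := by
  refine Finset.ssubset_iff_subset_ne.2 ⟨hC.trans Finset.sdiff_subset, ?_⟩
  rintro rfl
  simpa using hC P.hx

theorem Arms.ne_right (P : Arms G ℓ U x y₁ y₂ z q₁ q₂) (M : Crit G ℓ U) : z ≠ q₂ := by
  rintro rfl
  obtain ⟨m, n, k, a⟩ := P.facts M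
  have hc := check_arms_triangle
  simp only [List.all_eq_true] at hc
  refine M.reduce [y₁, x, y₂] (by simp) (by simp [*, P.hx]) [(z, .TT), (q₁, .O)]
    (by simp [*, Ne.symm]) (by simp [PL.lv]) ?_ ?_
  · intro C hC hw h1
    simp at hw
    have := P.swap.two_le M hC hw.2.1 hw.2.2 hw.1
    simp [pc, PL.lv, LV.cost]
    split_ifs with hz
    · exact this hz hz
    · omega
  · intro ns hns
    obtain ⟨nz, h1, n₁, h2, rfl⟩ := of_mem_secs_two hns
    refine ⟨[y₁, x, y₂], _, rfl, ?_, hc nz h1 n₁ h2⟩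
    exact Fit.cons' P.n1 m.1 P.h1 (by simp [*, Ne.symm]) (by simp) (Fit.cons' P.nx P.hx P.x0
      (by simp [*]) (by simp) (Fit.cons' P.n2 m.2.1 P.h2 (by simp) (by simp) Fit.nil))

/-- Colouring the part of the rest that contains neither arm after `B`. -/
theorem Arms.extend (P : Arms G ℓ U x y₁ y₂ z q₁ q₂) (M : Crit G ℓ U) {B D : Finset V}
    (col : V → Option Bool) (hB : B ⊆ D) (hD : D ⊆ U \ {x, y₁, y₂}) {t : V} {y : PL}
    (ht : t ∈ D) (htB : t ∉ B)
    (hk : (ℓ t).kb + y.lv.kb ≤ 1)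
    (hc : ∀ C ⊆ D, B ⊆ C → (if t ∈ C then (y.lv.cost : ℤ) else 0) + rho G ℓ B ≤ rho G ℓ C) :
    ∃ n ∈ y.drop, ∃ col', (∀ v ∈ B, col' v = col v) ∧
      St G (fun v => ℓ v + sl G B col' v) (D \ B) col' [(t, n)] := by
  have hDU := P.ssub hD
  obtain ⟨ns, h1, col', h2, h3⟩ := M.extend (R := D \ B) col Finset.disjoint_sdiff
    (Finset.card_lt_card (lt_of_le_of_lt Finset.sdiff_subset hDU)) [(t, y)] (by simp [ht, htB]) (by
      intro v hv
      simp only [addl]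
      split_ifs with h
      · subst h; exact hk
      · exact M.pv v (hDU.1 (Finset.mem_sdiff.1 hv).1)) (by
      intro C hC hne
      have h4 := hc (B ∪ C) (Finset.union_subset hB (hC.trans Finset.sdiff_subset))
        Finset.subset_union_left
      simpa [pc, htB] using h4)
  obtain ⟨n, h4, rfl⟩ := of_mem_secs_one h1
  exact ⟨n, h4, col', h2, h3⟩

theorem Arms.glue (P : Arms G ℓ U x y₁ y₂ z q₁ q₂) (M : Crit G ℓ U) {B : Finset V} {col col'}
    {n₁ n₂ nz : Nd} (hB : B ⊆ U \ {x, y₁, y₂})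
    (h1 : St G ℓ B col [(q₁, n₁), (q₂, n₂)]) (hcol : ∀ v ∈ B, col' v = col v)
    (h2 : St G (fun v => ℓ v + sl G B col' v) ((U \ {x, y₁, y₂}) \ B) col' [(z, nz)])
    (hf : armsFit n₁ n₂ nz = true) : False := by
  have h3 := St.glue Finset.disjoint_sdiff (h1.congr (fun v hv => (hcol v hv).symm)
    fun _ _ => rfl) h2
  rw [Finset.union_sdiff_of_subset hB] at h3
  exact P.finish M h3 hf

theorem Arms.glue_edge (P : Arms G ℓ U x y₁ y₂ z q₁ q₂) (M : Crit G ℓ U) {B : Finset V} {col col'}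
    {nx nz : Nd} {ns} (hB : B ⊆ U \ {x, y₁, y₂}) (hq1 : q₁ ∈ B) (hq2 : q₂ ∈ B)
    (h1 : St G ℓ (B ∪ {x, y₁, y₂}) col ((x, nx) :: ns)) (hcol : ∀ v ∈ B, col' v = col v)
    (h2 : St G (fun v => ℓ v + sl G B col' v) ((U \ {x, y₁, y₂}) \ B) col' [(z, nz)])
    (hf : cross nx nz = true) : False := by
  obtain ⟨hBU, hx, hy1, hy2⟩ := P.sub M hB
  obtain ⟨m, n, k, a⟩ := P.facts M
  set col3 : V → Option Bool := fun v => if v ∈ (U \ {x, y₁, y₂}) \ B then col' v else col v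
    with hcol3
  have e0 : ∀ v ∈ B ∪ {x, y₁, y₂}, v ∉ (U \ {x, y₁, y₂}) \ B := by
    intro v hv h
    simp at hv h
    tauto
  have e1 : ∀ v ∈ B ∪ {x, y₁, y₂}, col v = col3 v := fun v hv => by
    simp only [hcol3, if_neg (e0 v hv)]
  have e2 : ∀ v ∈ (U \ {x, y₁, y₂}) \ B, col' v = col3 v := fun v hv => by
    simp only [hcol3, if_pos hv]
  have h3 := St.glue_edge (Y := B) (N := {x, y₁, y₂}) (R := (U \ {x, y₁, y₂}) \ B) (col := col3)
    (by simp [*]) (Finset.disjoint_left.2 e0) (h1.congr e1 fun _ _ => rfl)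
    (h2.congr e2 fun v _ => by
      simp only [sl, nb_congr fun u hu => (hcol u hu).trans (e1 u (Finset.mem_union_left _ hu))])
    (by
      intro u hu v hv ha
      simp only [Finset.mem_sdiff, Finset.mem_insert, Finset.mem_singleton, not_or] at hu hv
      rcases hu with rfl | rfl | rfl
      · have := (P.nx.2 v).1 ⟨hv.1.1, ha⟩
        simp at this; tauto
      · have := (P.n1.2 v).1 ⟨hv.1.1, ha⟩
        simp at this
        rcases this with rfl | rfl <;> tauto
      · have := (P.n2.2 v).1 ⟨hv.1.1, ha⟩
        simp at this
        rcases this with rfl | rfl <;> tauto) hf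
  have : B ∪ {x, y₁, y₂} ∪ (U \ {x, y₁, y₂}) \ B = U := by
    ext v
    have : v ∈ B → v ∈ U := fun h => hBU h
    have : v ∈ ({x, y₁, y₂} : Finset V) → v ∈ U := fun h => by
      simp at h; rcases h with rfl | rfl | rfl
      exacts [P.hx, m.1, m.2.1]
    simp only [Finset.mem_union, Finset.mem_sdiff]
    tauto
  rw [this] at h3
  exact M.no _ _ h3

theorem Arms.tight (P : Arms G ℓ U x y₁ y₂ z q₁ q₂) (M : Crit G ℓ U) {B : Finset V}
    (hB : B ⊆ U \ {x, y₁, y₂}) (hq1 : q₁ ∈ B) (hq2 : q₂ ∈ B) (hz : z ∉ B) :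
    2 ≤ rho G ℓ B := by
  by_contra hlt
  have hB1 := P.one_le M hB ⟨_, hq1⟩
  obtain ⟨m, n, k, a⟩ := P.facts M
  have hBU := P.ssub hB
  obtain ⟨ns, h1, -, col, h2⟩ := M.colour hBU [(q₁, .O), (q₂, .O)] (by simp [hq1, hq2])
    (fun v hv => by rw [addl_kb (by simp [PL.lv])]; exact M.pv v (hBU.1 hv))
    (fun C hC _ => by simpa [pc, PL.lv, LV.cost] using M.nn C (hC.trans hBU.1))
  obtain ⟨n₁, k1, n₂, k2, rfl⟩ := of_mem_secs_two h1
  have hc := check_arms_tight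
  simp only [List.all_eq_true, List.any_eq_true] at hc
  obtain ⟨y, hy, hc⟩ := hc n₁ k1 n₂ k2
  simp at hy
  have hy' : y.lv.cost = 2 ∧ y.lv.kb = 0 := by rcases hy with rfl | rfl <;> exact ⟨rfl, rfl⟩
  obtain ⟨nz, h3, col', h4, h5⟩ := P.extend M col hB le_rfl (t := z) (y := y) (by simp [*, Ne.symm]) hz
    (by rw [hy'.2]; exact M.pv z m.2.2.1) (by
      intro C hC hBC
      rw [hy'.1]
      obtain ⟨s1, s2, s3, s4⟩ := P.sub M hC
      split_ifs with hzC
      · have := P.three_le M s1 s2 s3 s4 (hBC hq1) (hBC hq2) hzC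
        push_cast; omega
      · have := P.one_le M hC ⟨_, hBC hq1⟩
        omega)
  exact P.glue M hB h2 h4 h5 (hc nz h3)

theorem Arms.ne_ends (P : Arms G ℓ U x y₁ y₂ z q₁ q₂) (M : Crit G ℓ U) : q₁ ≠ q₂ := by
  rintro rfl
  obtain ⟨m, n, k, a⟩ := P.facts M
  have hc := check_arms_square
  simp only [List.all_eq_true, Bool.or_eq_true] at hc
  refine M.reduce [x, y₁, y₂] (by simp) (by simp [*, P.hx]) [(q₁, .TT), (z, .T)]
    (by simp [*, Ne.symm]) (by simp [PL.lv]) ?_ ?_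
  · intro C hC hw h1
    simp at hw
    have t2 := P.three_le M hC hw.1 hw.2.1 hw.2.2
    have t1 := P.tight M (B := C) (by
      intro v hv; simp; exact ⟨hC hv, by rintro rfl; exact hw.1 hv, by rintro rfl; exact hw.2.1 hv,
        by rintro rfl; exact hw.2.2 hv⟩)
    simp [pc, PL.lv, LV.cost]
    split_ifs <;> grind
  · intro ns hns
    obtain ⟨nz, h1, n₁, h2, rfl⟩ := of_mem_secs_two hns
    rcases hc nz h1 n₁ h2 with h | h
    · refine ⟨[x, y₁, y₂], _, rfl, ?_, h⟩
      exact Fit.cons' P.nx P.hx P.x0 (by simp [*]) (by simp) (Fit.cons' P.n1 m.1 P.h1 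
        (by simp [*]) (by simp) (Fit.cons' P.n2 m.2.1 P.h2 (by simp) (by simp) Fit.nil))
    · refine ⟨[y₁, x, y₂], _, by ext; simp; tauto, ?_, h⟩
      exact Fit.cons' P.n1 m.1 P.h1 (by simp [*, Ne.symm]) (by simp) (Fit.cons' P.nx P.hx P.x0
        (by simp [*]) (by simp) (Fit.cons' P.n2 m.2.1 P.h2 (by simp) (by simp) Fit.nil))
end

section
variable {V : Type*} [Fintype V] {G : SimpleGraph V} {ℓ : V → LV} {U : Finset V}
variable {x y₁ y₂ z q₁ q₂ : V}

theorem Arms.two_le_both (P : Arms G ℓ U x y₁ y₂ z q₁ q₂) (M : Crit G ℓ U) {C : Finset V}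
    (hC : C ⊆ U \ {x, y₁, y₂}) (hq1 : q₁ ∈ C) (hq2 : q₂ ∈ C) : 2 ≤ rho G ℓ C := by
  by_cases hz : z ∈ C
  · obtain ⟨s1, s2, s3, s4⟩ := P.sub M hC
    have := P.three_le M s1 s2 s3 s4 hq1 hq2 hz
    omega
  · exact P.tight M hC hq1 hq2 hz

theorem Arms.loose (P : Arms G ℓ U x y₁ y₂ z q₁ q₂) (M : Crit G ℓ U)
    (h3 : ∀ C ⊆ U \ {x, y₁, y₂}, q₁ ∈ C → q₂ ∈ C → 3 ≤ rho G ℓ C)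
    (h2 : ∀ C ⊆ U \ {x, y₁, y₂}, q₁ ∈ C → 2 ≤ rho G ℓ C) : False := by
  obtain ⟨m, n, k, a⟩ := P.facts M
  have hW := P.ssub (Finset.Subset.refl _)
  obtain ⟨ns, h4, -, col, h5⟩ := M.colour hW [(q₁, .TT), (q₂, .T), (z, .O)] (by simp [*, Ne.symm])
    (fun v hv => by rw [addl_kb (by simp [PL.lv])]; exact M.pv v (hW.1 hv))
    (fun C hC hne => by
      have h1 := P.one_le M hC hne
      have h2 := h2 C hC
      have h3 := h3 C hC
      simp [pc, PL.lv, LV.cost]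
      split_ifs <;> grind)
  obtain ⟨n₁, k1, n₂, k2, nz, k3, rfl⟩ := of_mem_secs_three h4
  have hc := check_arms_loose
  simp only [List.all_eq_true] at hc
  exact P.finish M h5 (hc n₁ k1 n₂ k2 nz k3)

set_option maxHeartbeats 1000000 in
theorem Arms.low (P : Arms G ℓ U x y₁ y₂ z q₁ q₂) (M : Crit G ℓ U) {B Y : Finset V}
    (hB : B ⊆ U \ {x, y₁, y₂}) (hq1 : q₁ ∈ B) (hz : z ∉ B)
    (hB2 : rho G ℓ B ≤ 2) (hYB : Y ⊆ B) (hqY : q₂ ∈ Y) (hY1 : rho G ℓ Y ≤ 1) : False := by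
  obtain ⟨m, n, k, a⟩ := P.facts M
  have hY := hYB.trans hB
  obtain ⟨hBU, hxB, hy1B, hy2B⟩ := P.sub M hB
  obtain ⟨hYU, hxY, hy1Y, hy2Y⟩ := P.sub M hY
  have hq2 := hYB hqY
  have hq1Y : q₁ ∉ Y := fun h => by have := P.two_le_both M hY h hqY; omega
  obtain ⟨ns, h4, -, col, h5⟩ := M.colour (P.ssub hY) [(q₂, .T)] (by simp [*])
    (fun v hv => by rw [addl_kb (by simp [PL.lv])]; exact M.pv v (hYU hv))
    (fun C hC hne => by
      have h1 := P.one_le M (hC.trans hY) hne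
      simp [pc, PL.lv, LV.cost]
      split_ifs <;> omega)
  obtain ⟨n₂, k2, rfl⟩ := of_mem_secs_one h4
  have hc := check_arms_low
  simp only [List.all_eq_true, List.any_eq_true] at hc
  obtain ⟨y, hy, hc⟩ := hc n₂ k2
  have hcost : ∀ y ∈ [PL.T, PL.B, PL.K true, PL.L], y.lv.cost = 1 ∧ y.lv.kb = 0 := by
    simp [PL.lv, LV.cost]
  obtain ⟨n₁, k1, col1, e1, h6⟩ := P.extend M col hYB hB (t := q₁) (y := y) hq1 hq1Y
    (by rw [(hcost y hy).2]; exact M.pv _ m.2.2.2.1) (by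
      intro C hC hYC
      rw [(hcost y hy).1]
      split_ifs with hzC
      · have := P.two_le_both M (hC.trans hB) hzC (hYC hqY)
        push_cast; omega
      · have := P.one_le M (hC.trans hB) ⟨_, hYC hqY⟩
        omega)
  obtain ⟨y', hy', hc⟩ := hc n₁ k1
  obtain ⟨nz, k3, col2, e2, h7⟩ := P.extend M col1 hB le_rfl (t := z) (y := y')
    (by simp [*, Ne.symm]) hz
    (by rw [(hcost y' hy').2]; exact M.pv _ m.2.2.1) (by
      intro C hC hBC
      rw [(hcost y' hy').1]
      obtain ⟨s1, s2, s3, s4⟩ := P.sub M hC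
      split_ifs with hzC
      · have := P.three_le M s1 s2 s3 s4 (hBC hq1) (hBC hq2) hzC
        push_cast; omega
      · have := P.two_le_both M hC (hBC hq1) (hBC hq2)
        omega)
  have hor := hc nz k3
  rw [Bool.or_eq_true] at hor
  rcases hor with hf | hf
  · have h8 := St.glue Finset.disjoint_sdiff (h5.congr (fun v hv => (e1 v hv).symm)
      fun _ _ => rfl) h6
    rw [Finset.union_sdiff_of_subset hYB] at h8
    exact P.glue M hB (h8.perm (List.Perm.swap _ _ _)) e2 h7 hf
  · have hsub2 : insert y₂ Y ⊆ U := Finset.insert_subset m.2.1 hYU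
    have hsub1 : insert x (insert y₂ Y) ⊆ U := Finset.insert_subset P.hx hsub2
    obtain ⟨col3, ns', hp, e3, hl, h8⟩ := Fit.sound _ [y₂, x, y₁] (D := Y)
      (Fit.cons_nbs P.n2 hYU P.h2 hy2Y (by simp [*])
        (Fit.cons_nbs P.nx hsub2 P.x0 (by simp [*])
          (by
            have : z ∉ Y := fun h => hz (hYB h)
            simp [*, Ne.symm])
          (Fit.cons_nbs P.n1 hsub1 P.h1 (by simp [*, Ne.symm])
            (by
              simp [*, Ne.symm])
            Fit.nil))) hf rfl h5
    match ns', hl, hp, h8 with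
    | ny :: nx :: n3 :: n4 :: [], _, hp, h8 =>
    rw [Bool.and_eq_true] at hp
    simp only [List.reverse_cons, List.reverse_nil, List.nil_append, List.cons_append,
      List.zip_cons_cons, List.zip_nil_left, List.map_cons, List.map_nil] at h8
    have hN : [y₂, x, y₁].toFinset = {x, y₁, y₂} := by ext; simp; tauto
    rw [hN] at h8
    set col4 : V → Option Bool := fun v => if v ∈ B \ Y then col1 v else col3 v with hcol4
    have e0 : ∀ v ∈ Y ∪ {x, y₁, y₂}, v ∉ B \ Y := by
      intro v hv h
      simp only [Finset.mem_union, Finset.mem_insert, Finset.mem_singleton, Finset.mem_sdiff] at hv h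
      rcases hv with hv | rfl | rfl | rfl <;> tauto
    have e4 : ∀ v ∈ Y ∪ {x, y₁, y₂}, col3 v = col4 v := fun v hv => by
      simp only [hcol4, if_neg (e0 v hv)]
    have e5 : ∀ v ∈ B \ Y, col1 v = col4 v := fun v hv => by
      simp only [hcol4, if_pos hv]
    have e6 : ∀ v ∈ Y, col1 v = col4 v := fun v hv => by
      rw [← e4 v (Finset.mem_union_left _ hv), e1 v hv, e3 v hv]
    have h9 := St.glue_edge (Y := Y) (N := {x, y₁, y₂}) (R := B \ Y) (col := col4)
      (by simp [*]) (Finset.disjoint_left.2 e0) (h8.congr e4 fun _ _ => rfl)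
      (h6.congr e5 fun v _ => by simp only [sl, nb_congr e6])
      (by
        intro u hu v hv ha
        simp only [Finset.mem_sdiff, Finset.mem_insert, Finset.mem_singleton] at hu hv
        have hvU := hBU hv.1
        rcases hu with rfl | rfl | rfl
        · have := (P.nx.2 v).1 ⟨hvU, ha⟩
          simp at this
          rcases this with rfl | rfl | rfl <;> tauto
        · have := (P.n1.2 v).1 ⟨hvU, ha⟩
          simp at this
          rcases this with rfl | rfl <;> tauto
        · have := (P.n2.2 v).1 ⟨hvU, ha⟩
          simp at this
          rcases this with rfl | rfl <;> tauto) hp.1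
    have hset : Y ∪ {x, y₁, y₂} ∪ B \ Y = B ∪ {x, y₁, y₂} := by
      ext v
      have := @hYB v
      simp only [Finset.mem_union, Finset.mem_sdiff]
      tauto
    rw [hset] at h9
    refine P.glue_edge M hB hq1 hq2 h9 (fun v hv => ?_) h7 hp.2
    rw [e2 v hv]
    by_cases h : v ∈ Y
    · exact e6 v h
    · exact e5 v (by simp [hv, h])

theorem Arms.mid (P : Arms G ℓ U x y₁ y₂ z q₁ q₂) (M : Crit G ℓ U) {B : Finset V}
    (hB : B ⊆ U \ {x, y₁, y₂}) (hq1 : q₁ ∈ B) (hq2 : q₂ ∈ B) (hz : z ∉ B)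
    (hB2 : rho G ℓ B ≤ 2) (h2 : ∀ C ⊆ U \ {x, y₁, y₂}, q₁ ∈ C → 2 ≤ rho G ℓ C) :
    1 ≤ (ℓ z).kb := by
  by_contra hk
  have hk : (ℓ z).kb = 0 := by omega
  obtain ⟨m, n, k, a⟩ := P.facts M
  obtain ⟨hBU, hxB, hy1B, hy2B⟩ := P.sub M hB
  obtain ⟨ns, h4, -, col, h5⟩ := M.colour (P.ssub hB) [(q₁, .TT), (q₂, .O)] (by simp [*])
    (fun v hv => by rw [addl_kb (by simp [PL.lv])]; exact M.pv v (hBU hv))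
    (fun C hC hne => by
      have h1 := P.one_le M (hC.trans hB) hne
      have h2 := h2 C (hC.trans hB)
      simp [pc, PL.lv, LV.cost]
      split_ifs <;> grind)
  obtain ⟨n₁, k1, n₂, k2, rfl⟩ := of_mem_secs_two h4
  have hc := check_arms_mid
  simp only [List.all_eq_true, List.any_eq_true] at hc
  obtain ⟨y, hy, hc⟩ := hc n₁ k1 n₂ k2
  have hcost : ∀ y ∈ [PL.T, PL.K true, PL.K false], y.lv.cost = 1 ∧ y.lv.kb ≤ 1 := by
    simp [PL.lv, LV.cost]
  obtain ⟨nz, k3, col2, e2, h7⟩ := P.extend M col hB le_rfl (t := z) (y := y)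
    (by simp [*, Ne.symm]) hz
    (by rw [hk, zero_add]; exact (hcost y hy).2) (by
      intro C hC hBC
      rw [(hcost y hy).1]
      obtain ⟨s1, s2, s3, s4⟩ := P.sub M hC
      split_ifs with hzC
      · have := P.three_le M s1 s2 s3 s4 (hBC hq1) (hBC hq2) hzC
        push_cast; omega
      · have := P.two_le_both M hC (hBC hq1) (hBC hq2)
        omega)
  have hor := hc nz k3
  rw [Bool.or_eq_true] at hor
  rcases hor with hf | hf
  · exact P.glue M hB h5 e2 h7 hf
  · have hsub2 : insert y₂ B ⊆ U := Finset.insert_subset m.2.1 hBU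
    have hsub1 : insert x (insert y₂ B) ⊆ U := Finset.insert_subset P.hx hsub2
    obtain ⟨col3, ns', hp, e3, hl, h8⟩ := Fit.sound _ [y₂, x, y₁] (D := B)
      (Fit.cons_nbs P.n2 hBU P.h2 hy2B (by simp [*])
        (Fit.cons_nbs P.nx hsub2 P.x0 (by simp [*])
          (by simp [*, Ne.symm])
          (Fit.cons_nbs P.n1 hsub1 P.h1 (by simp [*, Ne.symm])
            (by simp [*, Ne.symm])
            Fit.nil))) hf rfl h5
    match ns', hl, hp, h8 with
    | ny :: nx :: n3 :: n4 :: n5 :: [], _, hp, h8 =>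
    simp only [List.reverse_cons, List.reverse_nil, List.nil_append, List.cons_append,
      List.zip_cons_cons, List.zip_nil_left, List.map_cons, List.map_nil] at h8
    have hN : [y₂, x, y₁].toFinset = {x, y₁, y₂} := by ext; simp; tauto
    rw [hN] at h8
    exact P.glue_edge M hB hq1 hq2 (h8.perm (List.Perm.swap _ _ _))
      (fun v hv => (e2 v hv).trans (e3 v hv).symm) h7 hp

/-- The far ends of the two free neighbours lie in a set of small value that avoids the third
neighbour. -/
theorem Arms.core (P : Arms G ℓ U x y₁ y₂ z q₁ q₂) (M : Crit G ℓ U) :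
    ∃ B ⊆ U \ {x, y₁, y₂}, q₁ ∈ B ∧ q₂ ∈ B ∧ z ∉ B ∧ rho G ℓ B ≤ 2 := by
  have hsd : U \ {x, y₂, y₁} = U \ {x, y₁, y₂} := by rw [Finset.pair_comm]
  have h3 : ∃ B ⊆ U \ {x, y₁, y₂}, q₁ ∈ B ∧ q₂ ∈ B ∧ rho G ℓ B ≤ 2 := by
    by_contra! hcon
    have hcon : ∀ B ⊆ U \ {x, y₁, y₂}, q₁ ∈ B → q₂ ∈ B → 3 ≤ rho G ℓ B :=
      fun B h1 h2 h3 => hcon B h1 h2 h3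
    have e1 : ∃ C ⊆ U \ {x, y₁, y₂}, q₁ ∈ C ∧ rho G ℓ C ≤ 1 := by
      by_contra! h
      exact P.loose M hcon fun C h1 h2 => h C h1 h2
    have e2 : ∃ C ⊆ U \ {x, y₁, y₂}, q₂ ∈ C ∧ rho G ℓ C ≤ 1 := by
      by_contra! h
      exact P.swap.loose M (by rw [hsd]; exact fun C h1 h2 h3 => hcon C h1 h3 h2)
        (by rw [hsd]; exact fun C h1 h2 => h C h1 h2)
    obtain ⟨C, c1, c2, c3⟩ := e1
    obtain ⟨D, d1, d2, d3⟩ := e2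
    have h4 := hcon (C ∪ D) (Finset.union_subset c1 d1) (by simp [c2]) (by simp [d2])
    have h5 := rho_union_add_inter (G := G) (ℓ := ℓ) C D
    have h6 := M.nn (C ∩ D) (Finset.inter_subset_left.trans (P.sub M c1).1)
    omega
  obtain ⟨B, hB, hq1, hq2, hB2⟩ := h3
  have hz : z ∉ B := fun hz => by
    obtain ⟨s1, s2, s3, s4⟩ := P.sub M hB
    have := P.three_le M s1 s2 s3 s4 hq1 hq2 hz
    omega
  exact ⟨B, hB, hq1, hq2, hz, hB2⟩

/-- The third neighbour of a vertex with two free neighbours of degree two keeps a `K_β` label, and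
the far ends of the two free neighbours are in no tight set. -/
theorem Arms.bad (P : Arms G ℓ U x y₁ y₂ z q₁ q₂) (M : Crit G ℓ U) :
    1 ≤ (ℓ z).kb ∧ ∀ C ⊆ U \ {x, y₁, y₂}, q₁ ∈ C ∨ q₂ ∈ C → 2 ≤ rho G ℓ C := by
  have hsd : U \ {x, y₂, y₁} = U \ {x, y₁, y₂} := by rw [Finset.pair_comm]
  obtain ⟨B, hB, hq1, hq2, hz, hB2⟩ := P.core M
  have key : ∀ Y ⊆ U \ {x, y₁, y₂}, ∀ q ∈ B, q ∈ Y → z ∉ Y → rho G ℓ Y ≤ 1 →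
      z ∉ B ∪ Y ∧ rho G ℓ (B ∪ Y) ≤ 2 := by
    intro Y hY q hqB hqY hzY hY1
    have h5 := rho_union_add_inter (G := G) (ℓ := ℓ) B Y
    have h6 := P.one_le M (Finset.inter_subset_left.trans hB : B ∩ Y ⊆ _) ⟨q, by simp [*]⟩
    exact ⟨by simp [*], by omega⟩
  have r2 : ∀ C ⊆ U \ {x, y₁, y₂}, q₂ ∈ C → 2 ≤ rho G ℓ C := by
    intro Y hY hqY
    by_contra hlt
    have hzY : z ∉ Y := fun h => by
      obtain ⟨s1, s2, s3, s4⟩ := P.sub M hY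
      exact hlt (P.swap.two_le M s1 s2 s4 s3 hqY h)
    obtain ⟨k1, k2⟩ := key Y hY q₂ hq2 hqY hzY (by omega)
    exact P.low M (Finset.union_subset hB hY) (by simp [hq1]) k1 k2 Finset.subset_union_right hqY
      (by omega)
  have r1 : ∀ C ⊆ U \ {x, y₁, y₂}, q₁ ∈ C → 2 ≤ rho G ℓ C := by
    intro Y hY hqY
    by_contra hlt
    have hzY : z ∉ Y := fun h => by
      obtain ⟨s1, s2, s3, s4⟩ := P.sub M hY
      exact hlt (P.two_le M s1 s2 s3 s4 hqY h)
    obtain ⟨k1, k2⟩ := key Y hY q₁ hq1 hqY hzY (by omega)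
    exact P.swap.low M (by rw [hsd]; exact Finset.union_subset hB hY) (by simp [hq2]) k1 k2
      Finset.subset_union_right hqY (by omega)
  refine ⟨P.mid M hB hq1 hq2 hz hB2 r1, fun C hC h => ?_⟩
  rcases h with h | h
  · exact r1 C hC h
  · exact r2 C hC h
end

section
variable {V : Type*} [Fintype V] {G : SimpleGraph V} {ℓ : V → LV} {U : Finset V}
variable {x y₁ y₂ z q₁ q₂ : V}

theorem le_rho_insert {C : Finset V} {v : V} (hv : v ∉ C) (L : List V)
    (h : ∀ u ∈ C, G.Adj v u → u ∈ L) :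
    rho G ℓ C + (ℓ v).wt - 3 * L.length ≤ rho G ℓ (insert v C) := by
  rw [rho_insert hv]
  have : dg G C v ≤ L.length := by
    refine le_trans (Finset.card_le_card (t := L.toFinset) fun u hu => ?_) (List.toFinset_card_le L)
    rw [Finset.mem_filter] at hu
    simpa using h u hu.1 hu.2
  omega

variable {x' y₁' y₂' q₁' q₂' : V}

theorem Arms.ne_bad (P : Arms G ℓ U x y₁ y₂ z q₁ q₂) (P' : Arms G ℓ U x' y₁' y₂' z q₁' q₂')
    (M : Crit G ℓ U) (hxx : x ≠ x') : q₁ ≠ x' := by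
  rintro rfl
  obtain ⟨B, hB, hq1, hq2, hz, hB2⟩ := P.core M
  obtain ⟨m, n, k, a⟩ := P.facts M
  obtain ⟨m', n', k', a'⟩ := P'.facts M
  obtain ⟨hBU, hxB, hy1B, hy2B⟩ := P.sub M hB
  have hy : y₁ ∈ [y₁', y₂', z] := (P'.nx.2 _).1 ⟨m.1, a.2.2.2.1.symm⟩
  obtain ⟨w, r, hw, h0, hr, hmem⟩ : ∃ w r, w ≠ q₁ ∧ ℓ w = 0 ∧ Nbs G U w [q₁, r] ∧
      ∀ v ∈ B, G.Adj q₁ v → v = w := by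
    have hadj : ∀ v ∈ B, G.Adj q₁ v → v ∈ [y₁', y₂', z] := fun v hv ha => (P'.nx.2 _).1 ⟨hBU hv, ha⟩
    simp at hy hadj
    rcases hy with rfl | rfl | rfl
    · refine ⟨y₂', q₂', n'.2.1.symm, P'.h2, P'.n2, fun v hv ha => ?_⟩
      rcases hadj v hv ha with rfl | rfl | rfl
      exacts [absurd hv hy1B, rfl, absurd hv hz]
    · refine ⟨y₁', q₁', n'.1.symm, P'.h1, P'.n1, fun v hv ha => ?_⟩
      rcases hadj v hv ha with rfl | rfl | rfl
      exacts [rfl, absurd hv hy1B, absurd hv hz]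
    · exact absurd rfl k.2.1
  have e1 := M.nn (B.erase q₁) ((Finset.erase_subset _ _).trans hBU)
  by_cases hwB : w ∈ B
  · have e2 := le_rho_insert (G := G) (ℓ := ℓ) (C := B.erase q₁) (v := q₁) (by simp) [w] (by
      intro u hu ha
      simpa using hmem u (Finset.mem_of_mem_erase hu) ha)
    rw [Finset.insert_erase hq1, wt_zero P'.x0] at e2
    have e3 := le_rho_insert (G := G) (ℓ := ℓ) (C := (B.erase q₁).erase w) (v := w) (by simp) [r] (by
      intro u hu ha
      have hu' := Finset.mem_of_mem_erase hu
      have := (hr.2 u).1 ⟨hBU (Finset.mem_of_mem_erase hu'), ha⟩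
      simp at this
      rcases this with rfl | rfl
      · simp at hu
      · simp)
    rw [Finset.insert_erase (by simp [hwB, hw]), wt_zero h0] at e3
    have hne := P.ne_ends M
    have hqw := M.end_ne P.h2 h0 m.2.1 P.n2 hr
    have e4 := P.one_le M (C := (B.erase q₁).erase w)
      ((Finset.erase_subset _ _).trans ((Finset.erase_subset _ _).trans hB))
      ⟨q₂, by simp [hq2, hqw, hne.symm]⟩
    simp at e2 e3
    omega
  · have e2 := le_rho_insert (G := G) (ℓ := ℓ) (C := B.erase q₁) (v := q₁) (by simp) [] (by
      intro u hu ha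
      have hu := Finset.mem_of_mem_erase hu
      rw [hmem u hu ha] at hu
      exact absurd hu hwB)
    rw [Finset.insert_erase hq1, wt_zero P'.x0] at e2
    simp at e2
    omega

theorem Arms.arm_ne (P : Arms G ℓ U x y₁ y₂ z q₁ q₂) (P' : Arms G ℓ U x' y₁' y₂' z q₁' q₂')
    (M : Crit G ℓ U) (hxx : x ≠ x') : y₁ ≠ y₁' := by
  rintro rfl
  have := (P.n1.2 x').1 ⟨P'.hx, P'.n1.two.2.2.1⟩
  simp [hxx.symm] at this
  exact P.ne_bad P' M hxx this.symm

theorem Arms.ne_arm (P : Arms G ℓ U x y₁ y₂ z q₁ q₂) (P' : Arms G ℓ U x' y₁' y₂' z q₁' q₂') :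
    x ≠ y₁' := by
  rintro rfl
  have := P.nx.dg.symm.trans P'.n1.dg
  simp at this

/-- The sites of two such vertices with a common third neighbour are disjoint. -/
theorem Arms.sep (P : Arms G ℓ U x y₁ y₂ z q₁ q₂) (P' : Arms G ℓ U x' y₁' y₂' z q₁' q₂')
    (M : Crit G ℓ U) (hxx : x ≠ x') :
    (x ≠ y₁' ∧ x ≠ y₂' ∧ x' ≠ y₁ ∧ x' ≠ y₂) ∧ (q₁ ≠ x' ∧ q₂ ≠ x' ∧ q₁' ≠ x ∧ q₂' ≠ x) ∧
    (y₁ ≠ y₁' ∧ y₁ ≠ y₂' ∧ y₂ ≠ y₁' ∧ y₂ ≠ y₂') ∧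
    (q₁ ≠ y₁' ∧ q₁ ≠ y₂' ∧ q₂ ≠ y₁' ∧ q₂ ≠ y₂') ∧
    (q₁' ≠ y₁ ∧ q₁' ≠ y₂ ∧ q₂' ≠ y₁ ∧ q₂' ≠ y₂) := by
  have s := P.swap
  have s' := P'.swap
  have m := (P.facts M).1
  have m' := (P'.facts M).1
  exact ⟨⟨P.ne_arm P', P.ne_arm s', P'.ne_arm P, P'.ne_arm s⟩,
    ⟨P.ne_bad P' M hxx, s.ne_bad P' M hxx, P'.ne_bad P M hxx.symm, s'.ne_bad P M hxx.symm⟩,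
    ⟨P.arm_ne P' M hxx, P.arm_ne s' M hxx, s.arm_ne P' M hxx, s.arm_ne s' M hxx⟩,
    ⟨M.end_ne P.h1 P'.h1 m.1 P.n1 P'.n1, M.end_ne P.h1 P'.h2 m.1 P.n1 P'.n2,
      M.end_ne P.h2 P'.h1 m.2.1 P.n2 P'.n1, M.end_ne P.h2 P'.h2 m.2.1 P.n2 P'.n2⟩,
    ⟨M.end_ne P'.h1 P.h1 m'.1 P'.n1 P.n1, M.end_ne P'.h1 P.h2 m'.1 P'.n1 P.n2,
      M.end_ne P'.h2 P.h1 m'.2.1 P'.n2 P.n1, M.end_ne P'.h2 P.h2 m'.2.1 P'.n2 P.n2⟩⟩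

theorem Arms.sep_free (P : Arms G ℓ U x y₁ y₂ z q₁ q₂) (M : Crit G ℓ U) {u p : V} (hu : u ∈ U)
    (h0 : ℓ u = 0) (hN : Nbs G U u [z, p]) :
    (u ≠ x ∧ u ≠ y₁ ∧ u ≠ y₂) ∧ (q₁ ≠ u ∧ q₂ ≠ u) ∧ (p ≠ x ∧ p ≠ y₁ ∧ p ≠ y₂) := by
  obtain ⟨m, n, k, a⟩ := P.facts M
  obtain ⟨-, hp, b1, b2, r1, r2, r3⟩ := hN.two
  have t1 := P.ne_right M
  have t2 := P.swap.ne_right M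
  have c1 : u ≠ x := by
    rintro rfl
    have := P.nx.dg.symm.trans hN.dg
    simp at this
  have c2 : u ≠ y₁ := by
    rintro rfl
    have := (P.n1.2 z).1 ⟨m.2.2.1, b1⟩
    simp [n.2.2.1.symm] at this
    exact t2 this
  have c3 : u ≠ y₂ := by
    rintro rfl
    have := (P.n2.2 z).1 ⟨m.2.2.1, b1⟩
    simp [n.2.2.1.symm] at this
    exact t1 this
  refine ⟨⟨c1, c2, c3⟩, ⟨M.end_ne P.h1 h0 m.1 P.n1 hN, M.end_ne P.h2 h0 m.2.1 P.n2 hN⟩, ?_,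
    M.end_ne h0 P.h1 hu hN P.n1, M.end_ne h0 P.h2 hu hN P.n2⟩
  rintro rfl
  have := (P.nx.2 u).1 ⟨hu, b2.symm⟩
  simp [c2, c3] at this
  exact r1 this
end

theorem check_thread_tail : ((cheap 1).filter fun k => k.kb == 1).all (fun k =>
    (secs [PL.T, .T, .T]).all fun ns =>
    solve (fun _ => true) [([true], opts k), ([true], opts 0), ([true, false, false, true], opts 0), ([false, true, false, false, false, true], opts 0)] ns) = true := by
  decide +kernel

theorem check_arms_one : ((cheap 3).filter fun k => k.kb == 1).all (fun k =>
    (secs [PL.TT, .O]).all fun ns =>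
    solve (fun _ => true) [([false, true], opts 0), ([true], opts 0), ([true, false, true], opts 0), ([false, true], opts k)] ns) = true := by
  decide +kernel

theorem check_arms_two_free : ((cheap 2).filter fun k => k.kb == 1).all (fun k =>
    (secs [PL.TT, .O, .O]).all fun ns =>
    solve (fun _ => true) [([false, true], opts 0), ([true], opts 0), ([true, false, true], opts 0), ([false, true], opts k), ([true, false, false, false, false, false, true], opts 0)] ns) = true := by
  decide +kernel

theorem check_arms_two_arms : ((cheap 2).filter fun k => k.kb == 1).all (fun k =>
    (secs [PL.TT, .O, .O, .O]).all fun ns =>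
    solve (fun _ => true) [([false, true], opts 0), ([true], opts 0), ([true, false, true], opts 0), ([false, true], opts k), ([false, false, false, false, false, false, true], opts 0), ([true, true], opts 0), ([true, false, false, false, false, false, false, false, false, true], opts 0)] ns ||
    solve (fun _ => true) [([false, true], opts 0), ([true], opts 0), ([true, false, true], opts 0), ([false, true], opts k), ([false, false, false, false, false, false, false, true], opts 0), ([true, true], opts 0), ([true, false, false, false, false, false, false, false, true], opts 0)] ns) = true := by
  decide +kernel

theorem check_arms_three_free : ((cheap 1).filter fun k => k.kb == 1).all (fun k =>
    (secs [PL.TT, .O, .O, .O]).all fun ns =>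
    solve (fun _ => true) [([false, true], opts 0), ([true], opts 0), ([true, false, true], opts 0), ([false, true], opts k), ([true, false, false, false, false, false, true], opts 0), ([false, true, false, false, false, false, false, false, true], opts 0)] ns) = true := by
  decide +kernel

theorem check_arms_three_mixed : ((cheap 1).filter fun k => k.kb == 1).all (fun k =>
    (secs [PL.TT, .O, .O, .O, .O]).all fun ns =>
    solve (fun _ => true) [([false, true], opts 0), ([true], opts 0), ([true, false, true], opts 0), ([false, true], opts k), ([false, false, false, false, false, false, true], opts 0), ([true, true], opts 0), ([true, false, false, false, false, false, false, false, false, true], opts 0), ([false, false, false, true, false, false, false, false, false, false, false, true], opts 0)] ns ||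
    solve (fun _ => true) [([false, true], opts 0), ([true], opts 0), ([true, false, true], opts 0), ([false, true], opts k), ([false, false, false, false, false, false, false, true], opts 0), ([true, true], opts 0), ([true, false, false, false, false, false, false, false, true], opts 0), ([false, false, false, true, false, false, false, false, false, false, false, true], opts 0)] ns) = true := by
  decide +kernel

theorem check_arms_three_arms : ((cheap 1).filter fun k => k.kb == 1).all (fun k =>
    (secs [PL.TT, .O, .T, .O, .O, .O]).all fun ns =>
    solve (fun _ => true) [([false, true], opts 0), ([true], opts 0), ([true, false, true], opts 0), ([false, true], opts k), ([false, false, false, false, false, false, false, true], opts 0), ([true, true], opts 0), ([true, false, false, false, false, false, false, false, true], opts 0), ([false, false, false, false, false, false, false, false, false, false, false, true], opts 0), ([true, false, false, false, true], opts 0), ([true, false, false, false, false, false, false, false, false, false, false, false, false, false, true], opts 0)] ns ||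
    solve (fun _ => true) [([false, true], opts 0), ([true], opts 0), ([true, false, true], opts 0), ([false, true], opts k), ([true], opts 0), ([true, false, false, false, false, false, false, true], opts 0), ([false, true, false, false, false, false, false, false, false, true], opts 0), ([false, false, false, false, false, false, false, false, false, false, false, false, true], opts 0), ([true, false, false, false, true], opts 0), ([true, false, false, false, false, false, false, false, false, false, false, false, false, true], opts 0)] ns) = true := by
  decide +kernel

section
variable {V : Type*} [Fintype V] {G : SimpleGraph V} {ℓ : V → LV} {U : Finset V}
variable {x y₁ y₂ z q₁ q₂ x' y₁' y₂' q₁' q₂' x'' y₁'' y₂'' q₁'' q₂'' : V}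

theorem Arms.kb_one (P : Arms G ℓ U x y₁ y₂ z q₁ q₂) (M : Crit G ℓ U) : (ℓ z).kb = 1 :=
  le_antisymm (M.pv z (P.facts M).1.2.2.1) (P.bad M).1

theorem Arms.two_le_left (P : Arms G ℓ U x y₁ y₂ z q₁ q₂) (M : Crit G ℓ U) {C : Finset V}
    (hC : C ⊆ U) (hx : x ∉ C) (h1 : y₁ ∉ C) (h2 : y₂ ∉ C) (h : q₁ ∈ C ∨ q₂ ∈ C) :
    2 ≤ rho G ℓ C := by
  refine (P.bad M).2 C (fun v hv => ?_) h
  simp only [Finset.mem_sdiff, Finset.mem_insert, Finset.mem_singleton, not_or]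
  exact ⟨hC hv, fun e => hx (e ▸ hv), fun e => h1 (e ▸ hv), fun e => h2 (e ▸ hv)⟩

theorem Arms.thread_tail (P : Arms G ℓ U x y₁ y₂ z q₁ q₂) (M : Crit G ℓ U)
    {p : V} (hN : Nbs G U z [x, p]) (hc : (ℓ z).cost ≤ 1) : False := by
  obtain ⟨m, n, k, a⟩ := P.facts M
  obtain ⟨-, hp, -, b2, -, b4, b5⟩ := hN.two
  have t1 := P.ne_right M
  have t2 := P.swap.ne_right M
  have d1 : p ≠ y₁ := by
    rintro rfl
    have := (P.n1.2 z).1 ⟨m.2.2.1, b2.symm⟩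
    simp [n.2.2.1.symm, t2] at this
  have d2 : p ≠ y₂ := by
    rintro rfl
    have := (P.n2.2 z).1 ⟨m.2.2.1, b2.symm⟩
    simp [n.2.2.1.symm, t1] at this
  have hwt : (ℓ z).wt ≤ 3 := by
    have := (P.bad M).1
    simp only [LV.wt, LV.cost]
    omega
  refine M.reduce [z, x, y₁, y₂] (by simp) (by simp [*, P.hx]) [(p, .T), (q₁, .T), (q₂, .T)]
    (by simp [*, Ne.symm]) (by simp [PL.lv]) ?_ ?_
  · intro C hC hw h1
    simp only [List.mem_cons, List.not_mem_nil, or_false, forall_eq_or_imp, forall_eq] at hw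
    have t := P.two_le_left M hC (hw.2.1) (hw.2.2.1) (hw.2.2.2)
    have t' : p ∈ C → q₁ ∈ C → q₂ ∈ C → 3 ≤ rho G ℓ C := by
      intro e1 e2 e3
      have h3 := M.grow [(y₁, [q₁]), (y₂, [q₂]), (x, [y₁, y₂]), (z, [x, p])] hC (by
        simp [Grow, *, Ne.symm, P.hx, Ne.symm k.1, a.2.2.1.symm])
      simp [wt_zero P.x0, wt_zero P.h1, wt_zero P.h2] at h3
      linarith
    simp [pc, PL.lv, LV.cost]
    split_ifs <;> grind
  · intro ns hns
    have f1 : Fit G ℓ (U \ [z, x, y₁, y₂].toFinset) [p, q₁, q₂]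
        [([true], opts (ℓ z)), ([true], opts 0), ([true, false, false, true], opts 0), ([false, true, false, false, false, true], opts 0)] _ := Fit.cons' hN m.2.2.1 rfl (by simp [*, Ne.symm]) (by simp)
        (Fit.cons' P.nx P.hx P.x0 (by simp [*, Ne.symm]) (by simp)
        (Fit.cons' P.n1 m.1 P.h1 (by simp [*, Ne.symm]) (by simp)
        (Fit.cons' P.n2 m.2.1 P.h2 (by simp) (by simp) Fit.nil)))
    have hck := check_thread_tail
    simp only [List.all_eq_true] at hck
    replace hck := hck (ℓ z) (by simpa [P.kb_one M] using mem_cheap hc) ns hns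
    exact ⟨_, _, rfl, f1, hck⟩

theorem Arms.one (P : Arms G ℓ U x y₁ y₂ z q₁ q₂) (M : Crit G ℓ U)
    (hN : Nbs G U z [x]) (hc : (ℓ z).cost ≤ 3) : False := by
  obtain ⟨m, n, k, a⟩ := P.facts M
  have t1 := P.ne_right M
  have t2 := P.swap.ne_right M
  refine M.reduce [y₂, x, y₁, z] (by simp) (by simp [*, P.hx]) [(q₁, .TT), (q₂, .O)]
    (by simp [*, Ne.symm]) (by simp [PL.lv]) ?_ ?_
  · intro C hC hw h1
    simp only [List.mem_cons, List.not_mem_nil, or_false, forall_eq_or_imp, forall_eq] at hw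
    have t := P.two_le_left M hC (hw.2.1) (hw.2.2.1) (hw.1)
    simp [pc, PL.lv, LV.cost]
    split_ifs <;> grind
  · intro ns hns
    have f1 : Fit G ℓ (U \ [y₂, x, y₁, z].toFinset) [q₁, q₂]
        [([false, true], opts 0), ([true], opts 0), ([true, false, true], opts 0), ([false, true], opts (ℓ z))] _ := Fit.cons' P.n2 m.2.1 P.h2 (by simp [*, Ne.symm]) (by simp)
        (Fit.cons' P.nx P.hx P.x0 (by simp [*, Ne.symm]) (by simp)
        (Fit.cons' P.n1 m.1 P.h1 (by simp [*, Ne.symm]) (by simp)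
        (Fit.cons' hN m.2.2.1 rfl (by simp) (by simp) Fit.nil)))
    have hck := check_arms_one
    simp only [List.all_eq_true] at hck
    replace hck := hck (ℓ z) (by simpa [P.kb_one M] using mem_cheap hc) ns hns
    exact ⟨_, _, rfl, f1, hck⟩

theorem Arms.two_free (P : Arms G ℓ U x y₁ y₂ z q₁ q₂) (M : Crit G ℓ U)
    {u p : V} (hN : Nbs G U z [x, u]) (hc : (ℓ z).cost ≤ 2) (hu : u ∈ U) (hu0 : ℓ u = 0)
    (hNu : Nbs G U u [z, p]) : False := by
  obtain ⟨m, n, k, a⟩ := P.facts M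
  have t1 := P.ne_right M
  have t2 := P.swap.ne_right M
  obtain ⟨hz', hp, b1, b2, b3, b4, b5⟩ := hNu.two
  have su := P.sep_free M hu hu0 hNu
  refine M.reduce [y₂, x, y₁, z, u] (by simp) (by simp [*, P.hx]) [(q₁, .TT), (q₂, .O), (p, .O)]
    (by simp [*, Ne.symm]) (by simp [PL.lv]) ?_ ?_
  · intro C hC hw h1
    simp only [List.mem_cons, List.not_mem_nil, or_false, forall_eq_or_imp, forall_eq] at hw
    have t := P.two_le_left M hC (hw.2.1) (hw.2.2.1) (hw.1)
    simp [pc, PL.lv, LV.cost]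
    split_ifs <;> grind
  · intro ns hns
    have f1 : Fit G ℓ (U \ [y₂, x, y₁, z, u].toFinset) [q₁, q₂, p]
        [([false, true], opts 0), ([true], opts 0), ([true, false, true], opts 0), ([false, true], opts (ℓ z)), ([true, false, false, false, false, false, true], opts 0)] _ := Fit.cons' P.n2 m.2.1 P.h2 (by simp [*, Ne.symm]) (by simp)
        (Fit.cons' P.nx P.hx P.x0 (by simp [*, Ne.symm]) (by simp)
        (Fit.cons' P.n1 m.1 P.h1 (by simp [*, Ne.symm]) (by simp)
        (Fit.cons' hN m.2.2.1 rfl (by simp [*, Ne.symm]) (by simp)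
        (Fit.cons' hNu hu hu0 (by simp) (by simp) Fit.nil))))
    have hck := check_arms_two_free
    simp only [List.all_eq_true] at hck
    replace hck := hck (ℓ z) (by simpa [P.kb_one M] using mem_cheap hc) ns hns
    exact ⟨_, _, rfl, f1, hck⟩

set_option maxHeartbeats 1000000 in
theorem Arms.two_arms (P : Arms G ℓ U x y₁ y₂ z q₁ q₂) (M : Crit G ℓ U)
    (P' : Arms G ℓ U x' y₁' y₂' z q₁' q₂')
    (hN : Nbs G U z [x, x']) (hc : (ℓ z).cost ≤ 2) : False := by
  obtain ⟨m, n, k, a⟩ := P.facts M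
  have hxx := hN.two.2.2.2.2.2.2
  have t1 := P.ne_right M
  have t2 := P.swap.ne_right M
  obtain ⟨m', n', k', a'⟩ := P'.facts M
  have t1' := P'.ne_right M
  have t2' := P'.swap.ne_right M
  have s := P.sep P' M hxx
  refine M.reduce [y₂, x, y₁, z, y₁', x', y₂'] (by simp) (by simp [*, P.hx, P'.hx]) [(q₁, .TT), (q₂, .O), (q₁', .O), (q₂', .O)]
    (by simp [*, Ne.symm]) (by simp [PL.lv]) ?_ ?_
  · intro C hC hw h1
    simp only [List.mem_cons, List.not_mem_nil, or_false, forall_eq_or_imp, forall_eq] at hw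
    have t := P.two_le_left M hC (hw.2.1) (hw.2.2.1) (hw.1)
    simp [pc, PL.lv, LV.cost]
    split_ifs <;> grind
  · intro ns hns
    have f1 : Fit G ℓ (U \ [y₂, x, y₁, z, y₁', x', y₂'].toFinset) [q₁, q₂, q₁', q₂']
        [([false, true], opts 0), ([true], opts 0), ([true, false, true], opts 0), ([false, true], opts (ℓ z)), ([false, false, false, false, false, false, true], opts 0), ([true, true], opts 0), ([true, false, false, false, false, false, false, false, false, true], opts 0)] _ := Fit.cons' P.n2 m.2.1 P.h2 (by simp [*, Ne.symm]) (by simp)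
        (Fit.cons' P.nx P.hx P.x0 (by simp [*, Ne.symm]) (by simp)
        (Fit.cons' P.n1 m.1 P.h1 (by simp [*, Ne.symm]) (by simp)
        (Fit.cons' hN m.2.2.1 rfl (by simp [*, Ne.symm]) (by simp)
        (Fit.cons' P'.n1 m'.1 P'.h1 (by simp [*, Ne.symm]) (by simp)
        (Fit.cons' P'.nx P'.hx P'.x0 (by simp [*, Ne.symm]) (by simp)
        (Fit.cons' P'.n2 m'.2.1 P'.h2 (by simp) (by simp) Fit.nil))))))
    have f2 : Fit G ℓ (U \ [y₂, x, y₁, z, y₂', x', y₁'].toFinset) [q₁, q₂, q₁', q₂']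
        [([false, true], opts 0), ([true], opts 0), ([true, false, true], opts 0), ([false, true], opts (ℓ z)), ([false, false, false, false, false, false, false, true], opts 0), ([true, true], opts 0), ([true, false, false, false, false, false, false, false, true], opts 0)] _ := Fit.cons' P.n2 m.2.1 P.h2 (by simp [*, Ne.symm]) (by simp)
        (Fit.cons' P.nx P.hx P.x0 (by simp [*, Ne.symm]) (by simp)
        (Fit.cons' P.n1 m.1 P.h1 (by simp [*, Ne.symm]) (by simp)
        (Fit.cons' hN m.2.2.1 rfl (by simp [*, Ne.symm]) (by simp)
        (Fit.cons' P'.n2 m'.2.1 P'.h2 (by simp [*, Ne.symm]) (by simp)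
        (Fit.cons' P'.nx P'.hx P'.x0 (by simp [*, Ne.symm]) (by simp)
        (Fit.cons' P'.n1 m'.1 P'.h1 (by simp) (by simp) Fit.nil))))))
    have hck := check_arms_two_arms
    simp only [List.all_eq_true] at hck
    replace hck := hck (ℓ z) (by simpa [P.kb_one M] using mem_cheap hc) ns hns
    rcases (Bool.or_eq_true _ _).mp hck with h | h
    · exact ⟨_, _, rfl, f1, h⟩
    · exact ⟨_, _, by ext; simp only [List.mem_toFinset, List.mem_cons, or_left_comm], f2, h⟩

theorem Arms.three_free (P : Arms G ℓ U x y₁ y₂ z q₁ q₂) (M : Crit G ℓ U)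
    {u u' p p' : V} (hN : Nbs G U z [x, u, u']) (hc : (ℓ z).cost ≤ 1) (hu : u ∈ U) (hu0 : ℓ u = 0)
    (hNu : Nbs G U u [z, p]) (hu' : u' ∈ U) (hu0' : ℓ u' = 0) (hNu' : Nbs G U u' [z, p']) : False := by
  obtain ⟨m, n, k, a⟩ := P.facts M
  have huu := hN.three.2.2.2.2.2.2.2.2.2.2.2
  have t1 := P.ne_right M
  have t2 := P.swap.ne_right M
  obtain ⟨hz', hp, b1, b2, b3, b4, b5⟩ := hNu.two
  have su := P.sep_free M hu hu0 hNu
  obtain ⟨-, hp', b1', b2', b3', b4', b5'⟩ := hNu'.two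
  have su' := P.sep_free M hu' hu0' hNu'
  have e1 := M.end_ne hu0 hu0' hu hNu hNu'
  have e2 := M.end_ne hu0' hu0 hu' hNu' hNu
  refine M.reduce [y₂, x, y₁, z, u, u'] (by simp) (by simp [*, P.hx]) [(q₁, .TT), (q₂, .O), (p, .O), (p', .O)]
    (by simp [*, Ne.symm]) (by simp [PL.lv]) ?_ ?_
  · intro C hC hw h1
    simp only [List.mem_cons, List.not_mem_nil, or_false, forall_eq_or_imp, forall_eq] at hw
    have t := P.two_le_left M hC (hw.2.1) (hw.2.2.1) (hw.1)
    simp [pc, PL.lv, LV.cost]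
    split_ifs <;> grind
  · intro ns hns
    have f1 : Fit G ℓ (U \ [y₂, x, y₁, z, u, u'].toFinset) [q₁, q₂, p, p']
        [([false, true], opts 0), ([true], opts 0), ([true, false, true], opts 0), ([false, true], opts (ℓ z)), ([true, false, false, false, false, false, true], opts 0), ([false, true, false, false, false, false, false, false, true], opts 0)] _ := Fit.cons' P.n2 m.2.1 P.h2 (by simp [*, Ne.symm]) (by simp)
        (Fit.cons' P.nx P.hx P.x0 (by simp [*, Ne.symm]) (by simp)
        (Fit.cons' P.n1 m.1 P.h1 (by simp [*, Ne.symm]) (by simp)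
        (Fit.cons' hN m.2.2.1 rfl (by simp [*, Ne.symm]) (by simp)
        (Fit.cons' hNu hu hu0 (by simp [*, Ne.symm]) (by simp)
        (Fit.cons' hNu' hu' hu0' (by simp) (by simp) Fit.nil)))))
    have hck := check_arms_three_free
    simp only [List.all_eq_true] at hck
    replace hck := hck (ℓ z) (by simpa [P.kb_one M] using mem_cheap hc) ns hns
    exact ⟨_, _, rfl, f1, hck⟩

set_option maxHeartbeats 1000000 in
theorem Arms.three_mixed (P : Arms G ℓ U x y₁ y₂ z q₁ q₂) (M : Crit G ℓ U)
    {u p : V} (P' : Arms G ℓ U x' y₁' y₂' z q₁' q₂')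
    (hN : Nbs G U z [x, x', u]) (hc : (ℓ z).cost ≤ 1) (hu : u ∈ U) (hu0 : ℓ u = 0)
    (hNu : Nbs G U u [z, p]) : False := by
  obtain ⟨m, n, k, a⟩ := P.facts M
  have hxx := hN.three.2.2.2.2.2.2.2.2.2.1
  have t1 := P.ne_right M
  have t2 := P.swap.ne_right M
  obtain ⟨m', n', k', a'⟩ := P'.facts M
  have t1' := P'.ne_right M
  have t2' := P'.swap.ne_right M
  have s := P.sep P' M hxx
  obtain ⟨hz', hp, b1, b2, b3, b4, b5⟩ := hNu.two
  have su := P.sep_free M hu hu0 hNu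
  have sv := P'.sep_free M hu hu0 hNu
  refine M.reduce [y₂, x, y₁, z, y₁', x', y₂', u] (by simp) (by simp [*, P.hx, P'.hx]) [(q₁, .TT), (q₂, .O), (q₁', .O), (q₂', .O), (p, .O)]
    (by simp [*, Ne.symm]) (by simp [PL.lv]) ?_ ?_
  · intro C hC hw h1
    simp only [List.mem_cons, List.not_mem_nil, or_false, forall_eq_or_imp, forall_eq] at hw
    have t := P.two_le_left M hC (hw.2.1) (hw.2.2.1) (hw.1)
    simp [pc, PL.lv, LV.cost]
    split_ifs <;> grind
  · intro ns hns
    have f1 : Fit G ℓ (U \ [y₂, x, y₁, z, y₁', x', y₂', u].toFinset) [q₁, q₂, q₁', q₂', p]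
        [([false, true], opts 0), ([true], opts 0), ([true, false, true], opts 0), ([false, true], opts (ℓ z)), ([false, false, false, false, false, false, true], opts 0), ([true, true], opts 0), ([true, false, false, false, false, false, false, false, false, true], opts 0), ([false, false, false, true, false, false, false, false, false, false, false, true], opts 0)] _ := Fit.cons' P.n2 m.2.1 P.h2 (by simp [*, Ne.symm]) (by simp)
        (Fit.cons' P.nx P.hx P.x0 (by simp [*, Ne.symm]) (by simp)
        (Fit.cons' P.n1 m.1 P.h1 (by simp [*, Ne.symm]) (by simp)
        (Fit.cons' hN m.2.2.1 rfl (by simp [*, Ne.symm]) (by simp)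
        (Fit.cons' P'.n1 m'.1 P'.h1 (by simp [*, Ne.symm]) (by simp)
        (Fit.cons' P'.nx P'.hx P'.x0 (by simp [*, Ne.symm]) (by simp)
        (Fit.cons' P'.n2 m'.2.1 P'.h2 (by simp [*, Ne.symm]) (by simp)
        (Fit.cons' hNu hu hu0 (by simp) (by simp) Fit.nil)))))))
    have f2 : Fit G ℓ (U \ [y₂, x, y₁, z, y₂', x', y₁', u].toFinset) [q₁, q₂, q₁', q₂', p]
        [([false, true], opts 0), ([true], opts 0), ([true, false, true], opts 0), ([false, true], opts (ℓ z)), ([false, false, false, false, false, false, false, true], opts 0), ([true, true], opts 0), ([true, false, false, false, false, false, false, false, true], opts 0), ([false, false, false, true, false, false, false, false, false, false, false, true], opts 0)] _ := Fit.cons' P.n2 m.2.1 P.h2 (by simp [*, Ne.symm]) (by simp)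
        (Fit.cons' P.nx P.hx P.x0 (by simp [*, Ne.symm]) (by simp)
        (Fit.cons' P.n1 m.1 P.h1 (by simp [*, Ne.symm]) (by simp)
        (Fit.cons' hN m.2.2.1 rfl (by simp [*, Ne.symm]) (by simp)
        (Fit.cons' P'.n2 m'.2.1 P'.h2 (by simp [*, Ne.symm]) (by simp)
        (Fit.cons' P'.nx P'.hx P'.x0 (by simp [*, Ne.symm]) (by simp)
        (Fit.cons' P'.n1 m'.1 P'.h1 (by simp [*, Ne.symm]) (by simp)
        (Fit.cons' hNu hu hu0 (by simp) (by simp) Fit.nil)))))))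
    have hck := check_arms_three_mixed
    simp only [List.all_eq_true] at hck
    replace hck := hck (ℓ z) (by simpa [P.kb_one M] using mem_cheap hc) ns hns
    rcases (Bool.or_eq_true _ _).mp hck with h | h
    · exact ⟨_, _, rfl, f1, h⟩
    · exact ⟨_, _, by ext; simp only [List.mem_toFinset, List.mem_cons, or_left_comm], f2, h⟩

set_option maxHeartbeats 1000000 in
theorem Arms.three_arms_of (P : Arms G ℓ U x y₁ y₂ z q₁ q₂) (M : Crit G ℓ U)
    (P' : Arms G ℓ U x' y₁' y₂' z q₁' q₂') (P'' : Arms G ℓ U x'' y₁'' y₂'' z q₁'' q₂'')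
    (hN : Nbs G U z [x, x', x'']) (hc : (ℓ z).cost ≤ 1)
    (h3 : ∀ C ⊆ U \ {z, x, y₁, y₂, x', y₁', y₂', x'', y₁'', y₂''}, q₁ ∈ C → q₁' ∈ C →
      3 ≤ rho G ℓ C) : False := by
  obtain ⟨m, n, k, a⟩ := P.facts M
  obtain ⟨-, -, -, -, -, -, -, -, -, hxx, hxx', hxx''⟩ := hN.three
  have t1 := P.ne_right M
  have t2 := P.swap.ne_right M
  obtain ⟨m', n', k', a'⟩ := P'.facts M
  have t1' := P'.ne_right M
  have t2' := P'.swap.ne_right M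
  have s := P.sep P' M hxx
  obtain ⟨m'', n'', k'', a''⟩ := P''.facts M
  have t1'' := P''.ne_right M
  have t2'' := P''.swap.ne_right M
  have s' := P.sep P'' M hxx'
  have s'' := P'.sep P'' M hxx''
  refine M.reduce [y₂, x, y₁, z, y₂', x', y₁', y₁'', x'', y₂''] (by simp) (by simp [*, P.hx, P'.hx, P''.hx]) [(q₁, .TT), (q₂, .O), (q₁', .T), (q₂', .O), (q₁'', .O), (q₂'', .O)]
    (by simp [*, Ne.symm]) (by simp [PL.lv]) ?_ ?_
  · intro C hC hw h1
    simp only [List.mem_cons, List.not_mem_nil, or_false, forall_eq_or_imp, forall_eq] at hw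
    have t := P.two_le_left M hC (hw.2.1) (hw.2.2.1) (hw.1)
    have t' := h3 C (fun v hv => by
      simp only [Finset.mem_sdiff, Finset.mem_insert, Finset.mem_singleton, not_or]
      refine ⟨hC hv, ?_⟩
      refine ⟨?_, ?_, ?_, ?_, ?_, ?_, ?_, ?_, ?_, ?_⟩ <;> rintro rfl <;> tauto)
    simp [pc, PL.lv, LV.cost]
    split_ifs <;> grind
  · intro ns hns
    have f1 : Fit G ℓ (U \ [y₂, x, y₁, z, y₂', x', y₁', y₁'', x'', y₂''].toFinset) [q₁, q₂, q₁', q₂', q₁'', q₂'']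
        [([false, true], opts 0), ([true], opts 0), ([true, false, true], opts 0), ([false, true], opts (ℓ z)), ([false, false, false, false, false, false, false, true], opts 0), ([true, true], opts 0), ([true, false, false, false, false, false, false, false, true], opts 0), ([false, false, false, false, false, false, false, false, false, false, false, true], opts 0), ([true, false, false, false, true], opts 0), ([true, false, false, false, false, false, false, false, false, false, false, false, false, false, true], opts 0)] _ := Fit.cons' P.n2 m.2.1 P.h2 (by simp [*, Ne.symm]) (by simp)
        (Fit.cons' P.nx P.hx P.x0 (by simp [*, Ne.symm]) (by simp)
        (Fit.cons' P.n1 m.1 P.h1 (by simp [*, Ne.symm]) (by simp)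
        (Fit.cons' hN m.2.2.1 rfl (by simp [*, Ne.symm]) (by simp)
        (Fit.cons' P'.n2 m'.2.1 P'.h2 (by simp [*, Ne.symm]) (by simp)
        (Fit.cons' P'.nx P'.hx P'.x0 (by simp [*, Ne.symm]) (by simp)
        (Fit.cons' P'.n1 m'.1 P'.h1 (by simp [*, Ne.symm]) (by simp)
        (Fit.cons' P''.n1 m''.1 P''.h1 (by simp [*, Ne.symm]) (by simp)
        (Fit.cons' P''.nx P''.hx P''.x0 (by simp [*, Ne.symm]) (by simp)
        (Fit.cons' P''.n2 m''.2.1 P''.h2 (by simp) (by simp) Fit.nil)))))))))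
    have f2 : Fit G ℓ (U \ [y₂, x, y₁, z, x', y₁', y₂', y₂'', x'', y₁''].toFinset) [q₁, q₂, q₁', q₂', q₁'', q₂'']
        [([false, true], opts 0), ([true], opts 0), ([true, false, true], opts 0), ([false, true], opts (ℓ z)), ([true], opts 0), ([true, false, false, false, false, false, false, true], opts 0), ([false, true, false, false, false, false, false, false, false, true], opts 0), ([false, false, false, false, false, false, false, false, false, false, false, false, true], opts 0), ([true, false, false, false, true], opts 0), ([true, false, false, false, false, false, false, false, false, false, false, false, false, true], opts 0)] _ := Fit.cons' P.n2 m.2.1 P.h2 (by simp [*, Ne.symm]) (by simp)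
        (Fit.cons' P.nx P.hx P.x0 (by simp [*, Ne.symm]) (by simp)
        (Fit.cons' P.n1 m.1 P.h1 (by simp [*, Ne.symm]) (by simp)
        (Fit.cons' hN m.2.2.1 rfl (by simp [*, Ne.symm]) (by simp)
        (Fit.cons' P'.nx P'.hx P'.x0 (by simp [*, Ne.symm]) (by simp)
        (Fit.cons' P'.n1 m'.1 P'.h1 (by simp [*, Ne.symm]) (by simp)
        (Fit.cons' P'.n2 m'.2.1 P'.h2 (by simp [*, Ne.symm]) (by simp)
        (Fit.cons' P''.n2 m''.2.1 P''.h2 (by simp [*, Ne.symm]) (by simp)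
        (Fit.cons' P''.nx P''.hx P''.x0 (by simp [*, Ne.symm]) (by simp)
        (Fit.cons' P''.n1 m''.1 P''.h1 (by simp) (by simp) Fit.nil)))))))))
    have hck := check_arms_three_arms
    simp only [List.all_eq_true] at hck
    replace hck := hck (ℓ z) (by simpa [P.kb_one M] using mem_cheap hc) ns hns
    rcases (Bool.or_eq_true _ _).mp hck with h | h
    · exact ⟨_, _, rfl, f1, h⟩
    · exact ⟨_, _, by ext; simp only [List.mem_toFinset, List.mem_cons, or_left_comm], f2, h⟩

end

section
variable {V : Type*} [Fintype V] {G : SimpleGraph V} {ℓ : V → LV} {U : Finset V}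
variable {x y₁ y₂ z q₁ q₂ x' y₁' y₂' q₁' q₂' x'' y₁'' y₂'' q₁'' q₂'' : V}

theorem Arms.exists_joint (P : Arms G ℓ U x y₁ y₂ z q₁ q₂) (M : Crit G ℓ U)
    (P' : Arms G ℓ U x' y₁' y₂' z q₁' q₂') (P'' : Arms G ℓ U x'' y₁'' y₂'' z q₁'' q₂'')
    (hN : Nbs G U z [x, x', x'']) (hc : (ℓ z).cost ≤ 1) :
    ∃ C ⊆ U, (z ∉ C ∧ (x ∉ C ∧ y₁ ∉ C ∧ y₂ ∉ C) ∧ (x' ∉ C ∧ y₁' ∉ C ∧ y₂' ∉ C) ∧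
      (x'' ∉ C ∧ y₁'' ∉ C ∧ y₂'' ∉ C)) ∧ q₁ ∈ C ∧ q₁' ∈ C ∧ rho G ℓ C ≤ 2 := by
  by_contra h
  refine P.three_arms_of M P' P'' hN hc fun C hC h1 h2 => ?_
  by_contra hlt
  simp only [Finset.subset_sdiff, Finset.disjoint_insert_right,
    Finset.disjoint_singleton_right] at hC
  exact h ⟨C, hC.1, by simp only [hC, not_false_eq_true, and_self], h1, h2, by omega⟩

theorem Arms.three_arms (P : Arms G ℓ U x y₁ y₂ z q₁ q₂) (M : Crit G ℓ U)
    (P' : Arms G ℓ U x' y₁' y₂' z q₁' q₂') (P'' : Arms G ℓ U x'' y₁'' y₂'' z q₁'' q₂'')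
    (hN : Nbs G U z [x, x', x'']) (hc : (ℓ z).cost ≤ 1) : False := by
  obtain ⟨C₁, s₁, n₁, a₁, b₁, c₁⟩ := P.exists_joint M P' P'' hN hc
  obtain ⟨C₂, s₂, n₂, a₂, b₂, c₂⟩ := P.exists_joint M P'.swap P'' hN hc
  have hN' := hN.perm (List.Perm.cons x (List.Perm.swap x'' x' []))
  obtain ⟨C₃, s₃, n₃, a₃, b₃, c₃⟩ := P.exists_joint M P'' P' hN' hc
  obtain ⟨C₄, s₄, n₄, a₄, b₄, c₄⟩ := P.exists_joint M P''.swap P' hN' hc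
  have key : ∀ A B : Finset V, A ⊆ U → (x ∉ A ∧ y₁ ∉ A ∧ y₂ ∉ A) → q₁ ∈ A → q₁ ∈ B →
      rho G ℓ A ≤ 2 → rho G ℓ B ≤ 2 → rho G ℓ (A ∪ B) ≤ 2 := by
    intro A B hA h h1 h2 h3 h4
    have h5 := rho_union_add_inter (G := G) (ℓ := ℓ) A B
    have h6 := P.two_le_left M (C := A ∩ B) (Finset.inter_subset_left.trans hA)
      (by simp [h]) (by simp [h]) (by simp [h]) (Or.inl (by simp [h1, h2]))
    linarith
  have r := key C₁ (C₂ ∪ (C₃ ∪ C₄)) s₁ n₁.2.1 a₁ (by simp [a₂]) c₁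
    (key C₂ _ s₂ n₂.2.1 a₂ (by simp [a₃]) c₂ (key C₃ C₄ s₃ n₃.2.1 a₃ a₄ c₃ c₄))
  set D := C₁ ∪ (C₂ ∪ (C₃ ∪ C₄)) with hD
  have hDU : D ⊆ U := by simp [hD, Finset.union_subset_iff, *]
  have hn : z ∉ D ∧ (x' ∉ D ∧ y₁' ∉ D ∧ y₂' ∉ D) ∧ (x'' ∉ D ∧ y₁'' ∉ D ∧ y₂'' ∉ D) := by
    simp [hD, *]
  have hq : q₁' ∈ D ∧ q₂' ∈ D ∧ q₁'' ∈ D ∧ q₂'' ∈ D := by simp [hD, *]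
  clear_value D
  clear hD n₁ n₂ n₃ n₄ s₁ s₂ s₃ s₄ a₁ a₂ a₃ a₄ b₁ b₂ b₃ b₄ key
  obtain ⟨-, -, -, -, hz1, hz2, -, -, -, hxx, hxx', hxx''⟩ := hN.three
  obtain ⟨m', n', k', a'⟩ := P'.facts M
  obtain ⟨m'', n'', k'', a''⟩ := P''.facts M
  have s'' := P'.sep P'' M hxx''
  have hwt : (ℓ z).wt ≤ 3 := by
    have := (P.bad M).1
    simp only [LV.wt, LV.cost]
    omega
  have h3 := M.grow [(y₁', [q₁']), (y₂', [q₂']), (y₁'', [q₁'']), (y₂'', [q₂'']),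
    (x', [y₁', y₂']), (x'', [y₁'', y₂'']), (z, [x', x''])] hDU (by
      simp [Grow, *, Ne.symm, P'.hx, P''.hx, Ne.symm k'.1, Ne.symm k''.1])
  simp [wt_zero P'.x0, wt_zero P'.h1, wt_zero P'.h2, wt_zero P''.x0, wt_zero P''.h1,
    wt_zero P''.h2] at h3
  linarith

end

section
variable {V : Type*} [Fintype V] (G : SimpleGraph V) (ℓ : V → LV) (U : Finset V)

/-- Unlabelled vertices of degree two. -/
def Thin (v : V) : Prop := v ∈ U ∧ ℓ v = 0 ∧ dg G U v = 2

/-- The number of neighbours of `v` in `U` with the property `p`. -/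
noncomputable def num (p : V → Prop) (v : V) : ℕ := (U.filter fun u => G.Adj v u ∧ p u).card

/-- Unlabelled vertices of degree three with two thin neighbours. -/
def Poor (v : V) : Prop := v ∈ U ∧ ℓ v = 0 ∧ dg G U v = 3 ∧ num G U (Thin G ℓ U) v = 2

variable {G ℓ U}

theorem exists_nbs_sorted {P Q : V → Prop} (h : ∀ u, P u → ¬ Q u) (v : V) :
    ∃ B A C, Nbs G U v (B ++ (A ++ C)) ∧ (∀ u ∈ B, P u) ∧ (∀ u ∈ A, Q u) ∧
      (∀ u ∈ C, ¬ P u ∧ ¬ Q u) ∧ num G U P v = B.length ∧ num G U Q v = A.length := by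
  refine ⟨(U.filter fun u => G.Adj v u ∧ P u).toList, (U.filter fun u => G.Adj v u ∧ Q u).toList,
    (U.filter fun u => G.Adj v u ∧ ¬ P u ∧ ¬ Q u).toList, ⟨?_, fun w => ?_⟩, ?_, ?_, ?_, ?_, ?_⟩
  · refine List.Nodup.append (Finset.nodup_toList _) (List.Nodup.append (Finset.nodup_toList _)
      (Finset.nodup_toList _) ?_) ?_
    all_goals intro u hu hu'; simp at hu hu'; grind
  · simp; tauto
  all_goals simp +contextual [num]

theorem sum_num (p q : V → Prop) :
    ∑ v ∈ U.filter q, num G U p v = ∑ v ∈ U.filter p, num G U q v := by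
  have h := Finset.sum_card_bipartiteAbove_eq_sum_card_bipartiteBelow (s := U.filter q)
    (t := U.filter p) G.Adj
  simp only [Finset.bipartiteAbove, Finset.bipartiteBelow, Finset.filter_filter] at h
  simp only [num, and_comm (a := G.Adj _ _), G.adj_comm] at h ⊢
  convert h using 5

theorem Thin.exists_nbs {u v : V} (h : Thin G ℓ U u) (hv : v ∈ U) (ha : G.Adj v u) :
    ∃ p, Nbs G U u [v, p] :=
  nbs_of_dg_two h.2.2 hv ha.symm

theorem Poor.exists_arms {x : V} (h : Poor G ℓ U x) (M : Crit G ℓ U) :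
    ∃ y₁ y₂ z q₁ q₂, Arms G ℓ U x y₁ y₂ z q₁ q₂ ∧ ¬ Thin G ℓ U z ∧ ¬ Poor G ℓ U z ∧
      Thin G ℓ U y₁ ∧ Thin G ℓ U y₂ := by
  obtain ⟨hx, h0, h3, h2⟩ := h
  obtain ⟨B, A, C, hN, hB, hA, hC, -, hA'⟩ :=
    exists_nbs_sorted (G := G) (U := U) (P := fun _ => False) (Q := Thin G ℓ U) (by simp) x
  obtain rfl : B = [] := List.eq_nil_iff_forall_not_mem.2 hB
  have hd := hN.dg
  rw [hA', List.length_eq_two] at h2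
  obtain ⟨y₁, y₂, rfl⟩ := h2
  have : C.length = 1 := by simp at hd; omega
  obtain ⟨z, rfl⟩ := List.length_eq_one_iff.1 this
  simp only [List.nil_append, List.cons_append] at hN
  have t1 := hA y₁ (by simp)
  have t2 := hA y₂ (by simp)
  obtain ⟨q₁, hq1⟩ := t1.exists_nbs hx (hN.adj (by simp))
  obtain ⟨q₂, hq2⟩ := t2.exists_nbs hx (hN.adj (by simp))
  have P : Arms G ℓ U x y₁ y₂ z q₁ q₂ := ⟨hx, h0, t1.2.1, t2.2.1, hN, hq1, hq2⟩
  refine ⟨y₁, y₂, z, q₁, q₂, P, (hC z (by simp)).2, fun hz => ?_, t1, t2⟩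
  have := P.kb_one M
  rw [hz.2.1] at this
  cases this

/-- The arms of a poor vertex point to any of its neighbours that is not thin. -/
theorem Poor.arms_of_adj {x v : V} (h : Poor G ℓ U x) (M : Crit G ℓ U) (hv : v ∈ U)
    (ha : G.Adj v x) (ht : ¬ Thin G ℓ U v) :
    ∃ y₁ y₂ q₁ q₂, Arms G ℓ U x y₁ y₂ v q₁ q₂ := by
  obtain ⟨y₁, y₂, z, q₁, q₂, P, -, -, t1, t2⟩ := h.exists_arms M
  have := (P.nx.2 v).1 ⟨hv, ha.symm⟩
  simp at this
  rcases this with rfl | rfl | rfl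
  · exact (ht t1).elim
  · exact (ht t2).elim
  · exact ⟨_, _, _, _, P⟩

variable (G ℓ U) in
/-- Twice the weight of a vertex minus its degree cost, after thin vertices sent one unit along
every edge and poor vertices sent one unit to their only neighbour of full weight. -/
noncomputable def charge (v : V) : ℤ :=
  2 * (ℓ v).wt - 3 * dg G U v + num G U (Thin G ℓ U) v - (if Thin G ℓ U v then 2 else 0) +
    (if ¬ Thin G ℓ U v ∧ ¬ Poor G ℓ U v then (num G U (Poor G ℓ U) v : ℤ) else 0) -
    (if Poor G ℓ U v then 1 else 0)

theorem num_true (v : V) : num G U (fun _ => True) v = dg G U v := by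
  simp [num, dg]

theorem Crit.charge_sum (M : Crit G ℓ U) : 0 ≤ ∑ v ∈ U, charge G ℓ U v := by
  have h0 := M.nn U subset_rfl
  have h1 := sum_num (G := G) (U := U) (Thin G ℓ U) fun _ => True
  have h2 := sum_num (G := G) (U := U) (Poor G ℓ U) fun v => ¬ Thin G ℓ U v ∧ ¬ Poor G ℓ U v
  have h3 : ∑ v ∈ U.filter (Thin G ℓ U), num G U (fun _ => True) v =
      ∑ v ∈ U.filter (Thin G ℓ U), 2 :=
    Finset.sum_congr rfl fun v hv => by rw [num_true]; exact (Finset.mem_filter.1 hv).2.2.2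
  have h4 : ∑ v ∈ U.filter (Poor G ℓ U), 1 ≤ ∑ v ∈ U.filter (Poor G ℓ U),
      num G U (fun v => ¬ Thin G ℓ U v ∧ ¬ Poor G ℓ U v) v := by
    refine Finset.sum_le_sum fun v hv => ?_
    obtain ⟨y₁, y₂, z, q₁, q₂, P, k1, k2, -⟩ := Poor.exists_arms (Finset.mem_filter.1 hv).2 M
    have := P.facts M
    exact Finset.card_pos.2 ⟨z, by simp [*]⟩
  rw [h3] at h1
  rw [← h2] at h4
  rw [Finset.filter_true] at h1
  have h5 := sum_dg (G := G) (C := U)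
  simp only [charge, Finset.sum_add_distrib, Finset.sum_sub_distrib, ← Finset.mul_sum]
  unfold rho at h0
  zify at h1 h4 h5
  rw [h5]
  simp only [Finset.sum_filter] at h1 h4
  have h6 : ∑ v ∈ U, (num G U (Thin G ℓ U) v : ℤ) = ∑ v ∈ U, if Thin G ℓ U v then 2 else 0 := by
    convert h1
  have h7 : ∑ v ∈ U, (if Poor G ℓ U v then 1 else 0) ≤ ∑ v ∈ U,
      (if ¬ Thin G ℓ U v ∧ ¬ Poor G ℓ U v then (num G U (Poor G ℓ U) v : ℤ) else 0) := by
    convert h4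
  rw [h6]
  linarith

theorem Crit.not_adj_poor (M : Crit G ℓ U) {v x : V} (hv : v ∈ U) (hx : Poor G ℓ U x)
    (ht : ¬ Thin G ℓ U v) (hc : (ℓ v).cost = 0) : ¬ G.Adj v x := by
  intro ha
  obtain ⟨y₁, y₂, q₁, q₂, P⟩ := hx.arms_of_adj M hv ha ht
  have := P.kb_one M
  rw [eq_zero_of_cost hc] at this
  cases this

set_option maxHeartbeats 1000000 in
theorem Crit.charge_zero (M : Crit G ℓ U) {v : V} (hv : v ∈ U) :
    charge G ℓ U v ≤ 0 ∧ (charge G ℓ U v = 0 → ¬ Thin G ℓ U v → ¬ Poor G ℓ U v →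
      ((ℓ v = 0 ∧ dg G U v = 4 ∧ num G U (Thin G ℓ U) v = 4) ∨
      (ℓ v = 0 ∧ dg G U v = 3 ∧ num G U (Thin G ℓ U) v = 1) ∨
      ((ℓ v).cost = 1 ∧ dg G U v = 2 ∧ num G U (Thin G ℓ U) v = 0 ∧
        num G U (Poor G ℓ U) v = 0))) := by
  have hPT : ∀ u, Poor G ℓ U u → ¬ Thin G ℓ U u := fun u h1 h2 => by
    have := h1.2.2.1.symm.trans h2.2.2
    omega
  by_cases hT : Thin G ℓ U v
  · have hP : ¬ Poor G ℓ U v := fun h => hPT v h hT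
    have h0 : num G U (Thin G ℓ U) v = 0 := by
      refine Finset.card_eq_zero.2 (Finset.filter_eq_empty_iff.2 ?_)
      rintro u hu ⟨ha, hu2⟩
      obtain ⟨p, hp⟩ := hu2.exists_nbs hv ha
      obtain ⟨q, hq⟩ := hT.exists_nbs hu ha.symm
      exact M.thread_two hT.2.1 hu2.2.1 hq hp
    have := hT.2.2
    simp [charge, hT, hP, h0, wt_zero hT.2.1, this]
  by_cases hP : Poor G ℓ U v
  · have h1 := hP.2.2.1
    have h2 := hP.2.2.2
    simp [charge, hT, hP, wt_zero hP.2.1, h1, h2]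
  obtain ⟨B, A, C, hN, hB, hA, hC, hb, ha⟩ := exists_nbs_sorted (G := G) (U := U) hPT v
  have hd := hN.dg
  simp only [List.length_append] at hd
  have hcost := M.cost_le hv
  have nadj : ∀ u, u ∈ B ∨ u ∈ A → u ∈ U ∧ G.Adj v u := fun u hu =>
    (hN.2 u).2 (by simp; tauto)
  have k0 : (ℓ v).cost = 0 → B.length = 0 := by
    intro hc
    rw [List.length_eq_zero_iff, List.eq_nil_iff_forall_not_mem]
    exact fun x hx => M.not_adj_poor hv (hB x hx) hT hc (nadj x (.inl hx)).2
  have arms : ∀ x ∈ B, ∃ y₁ y₂ q₁ q₂, Arms G ℓ U x y₁ y₂ v q₁ q₂ := fun x hx =>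
    (hB x hx).arms_of_adj M hv (nadj x (.inl hx)).2 hT
  have thin : ∀ u ∈ A, u ∈ U ∧ ℓ u = 0 ∧ ∃ p, Nbs G U u [v, p] := fun u hu =>
    ⟨(hA u hu).1, (hA u hu).2.1, (hA u hu).exists_nbs hv (nadj u (.inr hu)).2⟩
  have e0 : ¬ (B.length + (A.length + C.length) = 0) := by
    intro h
    simp at h
    obtain ⟨rfl, rfl, rfl⟩ := h
    exact M.isolated hv hN
  have e1 : ¬ (dg G U v = 1 ∧ (ℓ v).cost ≤ 2) := fun ⟨h, hc⟩ => by
    obtain ⟨p, hp⟩ := nbs_of_dg_one h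
    exact M.leaf hv hc hp
  have e2 : ¬ ((ℓ v).cost = 0 ∧ dg G U v = 2) := fun ⟨h, h'⟩ => hT ⟨hv, eq_zero_of_cost h, h'⟩
  have e3 : ¬ ((ℓ v).cost = 0 ∧ dg G U v = 3 ∧ A.length = 2) := fun ⟨h, h', h2⟩ =>
    hP ⟨hv, eq_zero_of_cost h, h', ha.trans h2⟩
  have e4 : ¬ ((ℓ v).cost ≤ 3 ∧ B.length = 0 ∧ A.length = 1 ∧ C.length = 0) := by
    rintro ⟨hc, h1, h2, h3⟩
    obtain rfl := List.length_eq_zero_iff.1 h1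
    obtain rfl := List.length_eq_zero_iff.1 h3
    obtain ⟨u, rfl⟩ := List.length_eq_one_iff.1 h2
    obtain ⟨hu, hu0, p, hp⟩ := thin u (by simp)
    exact M.leaf_free hv hc hu0 hN hp
  have e5 : ¬ ((ℓ v).cost ≤ 3 ∧ B.length = 1 ∧ A.length = 0 ∧ C.length = 0) := by
    rintro ⟨hc, h1, h2, h3⟩
    obtain ⟨x, rfl⟩ := List.length_eq_one_iff.1 h1
    obtain rfl := List.length_eq_zero_iff.1 h2
    obtain rfl := List.length_eq_zero_iff.1 h3
    obtain ⟨y₁, y₂, q₁, q₂, P⟩ := arms x (by simp)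
    exact P.one M hN hc
  have e6 : ¬ ((ℓ v).cost ≤ 1 ∧ B.length = 0 ∧ A.length = 3 ∧ C.length = 0) := by
    rintro ⟨hc, h1, h2, h3⟩
    obtain rfl := List.length_eq_zero_iff.1 h1
    obtain rfl := List.length_eq_zero_iff.1 h3
    obtain ⟨u, u', u'', rfl⟩ := List.length_eq_three.1 h2
    obtain ⟨hu, hu0, p, hp⟩ := thin u (by simp)
    obtain ⟨hu', hu0', p', hp'⟩ := thin u' (by simp)
    obtain ⟨hu'', hu0'', p'', hp''⟩ := thin u'' (by simp)
    exact M.three_free hv hc hu0 hu0' hu0'' hN hp hp' hp''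
  have e7 : ¬ ((ℓ v).cost ≤ 1 ∧ B.length = 1 ∧ A.length = 2 ∧ C.length = 0) := by
    rintro ⟨hc, h1, h2, h3⟩
    obtain ⟨x, rfl⟩ := List.length_eq_one_iff.1 h1
    obtain ⟨u, u', rfl⟩ := List.length_eq_two.1 h2
    obtain rfl := List.length_eq_zero_iff.1 h3
    obtain ⟨y₁, y₂, q₁, q₂, P⟩ := arms x (by simp)
    obtain ⟨hu, hu0, p, hp⟩ := thin u (by simp)
    obtain ⟨hu', hu0', p', hp'⟩ := thin u' (by simp)
    exact P.three_free M hN hc hu hu0 hp hu' hu0' hp'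
  have e8 : ¬ ((ℓ v).cost ≤ 1 ∧ B.length = 2 ∧ A.length = 1 ∧ C.length = 0) := by
    rintro ⟨hc, h1, h2, h3⟩
    obtain ⟨x, x', rfl⟩ := List.length_eq_two.1 h1
    obtain ⟨u, rfl⟩ := List.length_eq_one_iff.1 h2
    obtain rfl := List.length_eq_zero_iff.1 h3
    obtain ⟨y₁, y₂, q₁, q₂, P⟩ := arms x (by simp)
    obtain ⟨y₁', y₂', q₁', q₂', P'⟩ := arms x' (by simp)
    obtain ⟨hu, hu0, p, hp⟩ := thin u (by simp)
    exact P.three_mixed M P' hN hc hu hu0 hp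
  have e9 : ¬ ((ℓ v).cost ≤ 1 ∧ B.length = 3 ∧ A.length = 0 ∧ C.length = 0) := by
    rintro ⟨hc, h1, h2, h3⟩
    obtain ⟨x, x', x'', rfl⟩ := List.length_eq_three.1 h1
    obtain rfl := List.length_eq_zero_iff.1 h2
    obtain rfl := List.length_eq_zero_iff.1 h3
    obtain ⟨y₁, y₂, q₁, q₂, P⟩ := arms x (by simp)
    obtain ⟨y₁', y₂', q₁', q₂', P'⟩ := arms x' (by simp)
    obtain ⟨y₁'', y₂'', q₁'', q₂'', P''⟩ := arms x'' (by simp)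
    exact P.three_arms M P' P'' hN hc
  have e10 : ¬ ((ℓ v).cost = 1 ∧ dg G U v = 2 ∧ 0 < A.length) := by
    rintro ⟨hc, h2, h1⟩
    obtain ⟨u, hu⟩ := List.exists_mem_of_length_pos h1
    obtain ⟨huU, hu0, p, hp⟩ := thin u hu
    obtain ⟨q, hq⟩ := nbs_of_dg_two h2 huU (nadj u (.inr hu)).2
    exact M.thread_three huU hv (by rw [hu0]; rfl) hc hp hq
  have e11 : ¬ ((ℓ v).cost = 1 ∧ dg G U v = 2 ∧ 0 < B.length) := by
    rintro ⟨hc, h2, h1⟩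
    obtain ⟨x, hx⟩ := List.exists_mem_of_length_pos h1
    obtain ⟨y₁, y₂, q₁, q₂, P⟩ := arms x hx
    obtain ⟨q, hq⟩ := nbs_of_dg_two h2 (nadj x (.inl hx)).1 (nadj x (.inl hx)).2
    exact P.thread_tail M hq hc.le
  have e12 : ¬ ((ℓ v).cost ≤ 2 ∧ B.length = 0 ∧ A.length = 2 ∧ C.length = 0) := by
    rintro ⟨hc, h1, h2, h3⟩
    obtain rfl := List.length_eq_zero_iff.1 h1
    obtain rfl := List.length_eq_zero_iff.1 h3
    obtain ⟨u, u', rfl⟩ := List.length_eq_two.1 h2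
    obtain ⟨hu, hu0, p, hp⟩ := thin u (by simp)
    obtain ⟨hu', hu0', p', hp'⟩ := thin u' (by simp)
    exact M.two_free hv hc hu0 hu0' hN hp hp'
  have e13 : ¬ ((ℓ v).cost ≤ 2 ∧ B.length = 1 ∧ A.length = 1 ∧ C.length = 0) := by
    rintro ⟨hc, h1, h2, h3⟩
    obtain ⟨x, rfl⟩ := List.length_eq_one_iff.1 h1
    obtain ⟨u, rfl⟩ := List.length_eq_one_iff.1 h2
    obtain rfl := List.length_eq_zero_iff.1 h3
    obtain ⟨y₁, y₂, q₁, q₂, P⟩ := arms x (by simp)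
    obtain ⟨hu, hu0, p, hp⟩ := thin u (by simp)
    exact P.two_free M hN hc hu hu0 hp
  have e14 : ¬ ((ℓ v).cost ≤ 2 ∧ B.length = 2 ∧ A.length = 0 ∧ C.length = 0) := by
    rintro ⟨hc, h1, h2, h3⟩
    obtain ⟨x, x', rfl⟩ := List.length_eq_two.1 h1
    obtain rfl := List.length_eq_zero_iff.1 h2
    obtain rfl := List.length_eq_zero_iff.1 h3
    obtain ⟨y₁, y₂, q₁, q₂, P⟩ := arms x (by simp)
    obtain ⟨y₁', y₂', q₁', q₂', P'⟩ := arms x' (by simp)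
    exact P.two_arms M P' hN hc
  have e15 : (ℓ v).cost = 0 → ℓ v = 0 := eq_zero_of_cost
  simp only [charge, hT, hP, not_false_eq_true, and_self, if_true, if_false, LV.wt, ha, hb]
  clear hN hB hA hC hb ha nadj arms thin
  clear hPT hT hP
  generalize hk : (ℓ v).cost = k at *
  rw [hd] at *
  generalize B.length = b, A.length = a, C.length = c at *
  clear hd
  have hk' : k = 0 ∨ k = 1 ∨ k = 2 ∨ k = 3 ∨ k = 4 := by omega
  rcases hk' with rfl | rfl | rfl | rfl | rfl
  · obtain rfl := k0 rfl
    clear k0 e4 e5 e7 e8 e9 e10 e11 e12 e13 e14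
    simp only [e15 rfl, true_and]
    constructor
    · omega
    · intros; omega
  · clear k0 e2 e3 e4 e5 e12 e13 e14 e15
    constructor
    · omega
    · intros; omega
  · clear k0 e2 e3 e4 e5 e6 e7 e8 e9 e10 e11 e15
    constructor
    · clear e12 e13 e14; omega
    · intros; omega
  · clear k0 e1 e2 e3 e6 e7 e8 e9 e10 e11 e12 e13 e14 e15
    constructor
    · omega
    · intros; omega
  · clear k0 e1 e2 e3 e4 e5 e6 e7 e8 e9 e10 e11 e12 e13 e14 e15
    constructor
    · omega
    · intros; omega

/-- A critical configuration consists of four kinds of vertices. -/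
theorem Crit.types (M : Crit G ℓ U) : ∀ v ∈ U, Thin G ℓ U v ∨
    (ℓ v = 0 ∧ dg G U v = 4 ∧ num G U (Thin G ℓ U) v = 4) ∨
    (ℓ v = 0 ∧ dg G U v = 3 ∧ num G U (Thin G ℓ U) v = 1) ∨
    ((ℓ v).cost = 1 ∧ dg G U v = 2 ∧ num G U (Thin G ℓ U) v = 0) := by
  have h0 : ∀ v ∈ U, charge G ℓ U v = 0 := by
    have h1 : ∑ v ∈ U, charge G ℓ U v ≤ 0 := Finset.sum_nonpos fun v hv => (M.charge_zero hv).1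
    have h2 := h1.antisymm M.charge_sum
    exact (Finset.sum_eq_zero_iff_of_nonpos fun v hv => (M.charge_zero hv).1).1 h2
  have hPT : ∀ u, Poor G ℓ U u → ¬ Thin G ℓ U u := fun u h1 h2 => by
    have := h1.2.2.1.symm.trans h2.2.2
    omega
  have hnP : ∀ v, ¬ Poor G ℓ U v := by
    intro x hx
    obtain ⟨y₁, y₂, z, q₁, q₂, P, h1, h2, -⟩ := hx.exists_arms M
    have m := P.facts M
    have hz := (M.charge_zero m.1.2.2.1).2 (h0 z m.1.2.2.1) h1 h2
    have hkb := P.kb_one M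
    rcases hz with ⟨hz, -⟩ | ⟨hz, -⟩ | ⟨-, -, -, hz⟩
    · rw [hz] at hkb; cases hkb
    · rw [hz] at hkb; cases hkb
    · rw [num, Finset.card_eq_zero, Finset.filter_eq_empty_iff] at hz
      exact hz hx.1 ⟨m.2.2.2.2.2.1.symm, hx⟩
  intro v hv
  have := (M.charge_zero hv).2 (h0 v hv)
  have := hnP v
  tauto

end

section
variable {V : Type*}

/-- The possible structure of a critical configuration: thin vertices `T` join vertices of degree
four `X` and of degree three `Z`; the vertices of `Z` and the labelled vertices `W` induce a
two-regular graph. -/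
structure Web (G : SimpleGraph V) (U : Finset V) (T X Z W : V → Prop) : Prop where
  mem : ∀ v, T v ∨ X v ∨ Z v ∨ W v ↔ v ∈ U
  tx : ∀ v, T v → ¬ X v
  ty : ∀ v, T v → ¬ (Z v ∨ W v)
  xy : ∀ v, X v → ¬ (Z v ∨ W v)
  zw : ∀ v, Z v → ¬ W v
  adjT : ∀ u v, T u → v ∈ U → G.Adj u v → X v ∨ Z v
  adjX : ∀ u v, X u → v ∈ U → G.Adj u v → T v
  adjZ : ∀ u v, Z u → v ∈ U → G.Adj u v → T v ∨ Z v ∨ W v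
  adjW : ∀ u v, W u → v ∈ U → G.Adj u v → Z v ∨ W v
  nT : ∀ u, T u → dg G U u = 2
  nX : ∀ u, X u → dg G U u = 4
  nZ : ∀ u t t', Z u → T t → T t' → G.Adj u t → G.Adj u t' → t = t'
  nY : ∀ u, Z u ∨ W u → num G U (fun v => Z v ∨ W v) u = 2

theorem num_add_num {G : SimpleGraph V} {U : Finset V} {p q : V → Prop} {v : V}
    (h : ∀ u ∈ U, G.Adj v u → (p u ↔ ¬ q u)) : num G U p v + num G U q v = dg G U v := by
  unfold num dg
  rw [← Finset.card_union_of_disjoint]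
  · congr 1
    ext u
    have := h u
    simp; tauto
  · refine Finset.disjoint_left.2 fun u => ?_
    have := h u
    simp; tauto

theorem num_eq_dg {G : SimpleGraph V} {U : Finset V} {p : V → Prop} {v : V} :
    num G U p v = dg G U v ↔ ∀ u ∈ U, G.Adj v u → p u := by
  unfold num dg
  rw [← Finset.filter_filter, Finset.card_filter_eq_iff]
  simp

theorem num_eq_zero {G : SimpleGraph V} {U : Finset V} {p : V → Prop} {v : V} :
    num G U p v = 0 ↔ ∀ u ∈ U, G.Adj v u → ¬ p u := by
  unfold num
  rw [Finset.card_eq_zero, Finset.filter_eq_empty_iff]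
  simp

theorem Crit.web [Fintype V] {G : SimpleGraph V} {ℓ : V → LV} {U : Finset V} (M : Crit G ℓ U) :
    Web G U (Thin G ℓ U) (fun v => v ∈ U ∧ ℓ v = 0 ∧ dg G U v = 4)
      (fun v => v ∈ U ∧ ℓ v = 0 ∧ dg G U v = 3) (fun v => v ∈ U ∧ (ℓ v).cost = 1) := by
  have h0 : ∀ v, ℓ v = 0 → (ℓ v).cost = 0 := fun v h => by rw [h]; rfl
  have hX : ∀ v ∈ U, ℓ v = 0 → dg G U v = 4 → ∀ u ∈ U, G.Adj v u → Thin G ℓ U u := by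
    intro v hv hl hd
    rw [← num_eq_dg]
    rcases M.types v hv with h | h | h | h
    · have := h.2.2; omega
    · omega
    · omega
    · have := h0 v hl; omega
  have hW : ∀ v ∈ U, (ℓ v).cost = 1 → dg G U v = 2 ∧ ∀ u ∈ U, G.Adj v u → ¬ Thin G ℓ U u := by
    intro v hv hl
    rw [← num_eq_zero]
    rcases M.types v hv with h | h | h | h
    · have := h0 v h.2.1; omega
    · have := h0 v h.1; omega
    · have := h0 v h.1; omega
    · exact h.2
  have hZ : ∀ v ∈ U, ℓ v = 0 → dg G U v = 3 → num G U (Thin G ℓ U) v = 1 := by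
    intro v hv hl hd
    rcases M.types v hv with h | h | h | h
    · have := h.2.2; omega
    · omega
    · omega
    · have := h0 v hl; omega
  have hcase : ∀ v ∈ U, Thin G ℓ U v ∨ (v ∈ U ∧ ℓ v = 0 ∧ dg G U v = 4) ∨
      (v ∈ U ∧ ℓ v = 0 ∧ dg G U v = 3) ∨ (v ∈ U ∧ (ℓ v).cost = 1) := by
    intro v hv
    have := M.types v hv
    tauto
  have hnT : ∀ v, Thin G ℓ U v → ∀ u ∈ U, G.Adj v u → ¬ Thin G ℓ U u := by
    intro v hv u hu ha hu2
    obtain ⟨p, hp⟩ := hu2.exists_nbs hv.1 ha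
    obtain ⟨q, hq⟩ := hv.exists_nbs hu ha.symm
    exact M.thread_two hv.2.1 hu2.2.1 hq hp
  have ht0 : ∀ v, Thin G ℓ U v → (ℓ v).cost = 0 ∧ dg G U v = 2 := fun v h => ⟨h0 v h.2.1, h.2.2⟩
  have adjZ : ∀ u v, (u ∈ U ∧ ℓ u = 0 ∧ dg G U u = 3) → v ∈ U → G.Adj u v →
      Thin G ℓ U v ∨ (v ∈ U ∧ ℓ v = 0 ∧ dg G U v = 3) ∨ (v ∈ U ∧ (ℓ v).cost = 1) := by
    intro u v hu hv ha
    rcases hcase v hv with h | h | h | h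
    · exact .inl h
    · have := (ht0 u (hX v hv h.2.1 h.2.2 u hu.1 ha.symm)).2
      omega
    · tauto
    · tauto
  have adjW : ∀ u v, (u ∈ U ∧ (ℓ u).cost = 1) → v ∈ U → G.Adj u v →
      (v ∈ U ∧ ℓ v = 0 ∧ dg G U v = 3) ∨ (v ∈ U ∧ (ℓ v).cost = 1) := by
    intro u v hu hv ha
    rcases hcase v hv with h | h | h | h
    · exact ((hW u hu.1 hu.2).2 v hv ha h).elim
    · have := (ht0 u (hX v hv h.2.1 h.2.2 u hu.1 ha.symm)).1
      omega
    · tauto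
    · tauto
  refine ⟨fun v => ⟨fun h => ?_, hcase v⟩, fun v hv hv' => ?_, fun v hv hv' => ?_,
    fun v hv hv' => ?_, fun v hv hv' => ?_, fun u v hu hv ha => ?_,
    fun u v hu hv ha => hX u hu.1 hu.2.1 hu.2.2 v hv ha, adjZ, adjW, fun u hu => hu.2.2,
    fun u hu => hu.2.2, fun u t t' hu ht ht' ha ha' => ?_, fun u hu => ?_⟩
  · have : Thin G ℓ U v → v ∈ U := fun h => h.1
    tauto
  · have := ht0 v hv; omega
  · have := ht0 v hv; omega
  · have := h0 v hv.2.1; omega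
  · have := h0 v hv.2.1; omega
  · rcases hcase v hv with h | h | h | h
    · exact (hnT u hu v hv ha h).elim
    · exact .inl h
    · exact .inr h
    · exact ((hW v hv h.2).2 u hu.1 ha.symm hu).elim
  · have := hZ u hu.1 hu.2.1 hu.2.2
    rw [num, Finset.card_eq_one] at this
    obtain ⟨a, h⟩ := this
    have e : ∀ t, Thin G ℓ U t → G.Adj u t → t = a := fun t ht ha => by
      have : t ∈ U.filter fun v => G.Adj u v ∧ Thin G ℓ U v := by simp [ht.1, ha, ht]
      simpa [h] using this
    rw [e t ht ha, e t' ht' ha']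
  · have key := num_add_num (G := G) (U := U) (p := Thin G ℓ U) (v := u)
      (q := fun v => (v ∈ U ∧ ℓ v = 0 ∧ dg G U v = 3) ∨ (v ∈ U ∧ (ℓ v).cost = 1)) fun v hv ha => by
        have := ht0 v
        have := adjZ u v
        have := adjW u v
        rcases hu with hu | hu
        · constructor
          · intro h; have := ht0 v h; omega
          · tauto
        · constructor
          · intro h; have := ht0 v h; omega
          · tauto
    rcases hu with hu | hu
    · rw [hZ u hu.1 hu.2.1 hu.2.2] at key
      omega
    · have := hW u hu.1 hu.2
      rw [num_eq_zero.2 this.2] at key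
      omega

end

section
variable {V : Type*}

/-- If every class has an admissible vertex avoiding the only partner of a given vertex, then the
classes have admissible representatives no two of which are partners. -/
theorem exists_transversal {K : Type*} (cls : V → K) {J : V → V → Prop}
    (hJ : ∀ u v, J u v → J v u) (huniq : ∀ u v w, J u v → J u w → v = w) (good : V → Prop)
    (𝒞 : Finset K) (h : ∀ c ∈ 𝒞, ∀ u, ∃ v, cls v = c ∧ good v ∧ ¬ J u v) (u : V) :
    ∃ pick : K → V, ∀ c ∈ 𝒞, cls (pick c) = c ∧ good (pick c) ∧ ¬ J u (pick c) ∧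
      ∀ c' ∈ 𝒞, c' ≠ c → ¬ J (pick c) (pick c') := by
  induction 𝒞 using Finset.strongInduction generalizing u with
  | H 𝒞 ih =>
    rcases 𝒞.eq_empty_or_nonempty with rfl | hne
    · exact ⟨fun _ => u, by simp⟩
    obtain ⟨c, hc, hcu⟩ : ∃ c ∈ 𝒞, ∀ w, J u w → cls w ∈ 𝒞 → cls w = c := by
      by_cases hw : ∃ w, J u w ∧ cls w ∈ 𝒞
      · obtain ⟨w, h1, h2⟩ := hw
        exact ⟨cls w, h2, fun w' h3 _ => by rw [huniq u w w' h1 h3]⟩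
      · push Not at hw
        obtain ⟨c, hc⟩ := hne
        exact ⟨c, hc, fun w h1 h2 => (hw w h1 h2).elim⟩
    obtain ⟨v, h1, h2, h3⟩ := h c hc u
    obtain ⟨pick, hp⟩ := ih (𝒞.erase c) (Finset.erase_ssubset hc)
      (fun c' hc' => h c' (Finset.mem_of_mem_erase hc')) v
    refine ⟨Function.update pick c v, fun d hd => ?_⟩
    by_cases hdc : d = c
    · subst hdc
      rw [Function.update_self]
      refine ⟨h1, h2, h3, fun c' hc' hne => ?_⟩
      rw [Function.update_of_ne hne]
      exact (hp c' (Finset.mem_erase.2 ⟨hne, hc'⟩)).2.2.1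
    · rw [Function.update_of_ne hdc]
      obtain ⟨k1, k2, k3, k4⟩ := hp d (Finset.mem_erase.2 ⟨hdc, hd⟩)
      refine ⟨k1, k2, fun hj => hdc ?_, fun c' hc' hne => ?_⟩
      · rw [← hcu _ hj (by rwa [k1]), k1]
      · by_cases hcc : c' = c
        · subst hcc
          rw [Function.update_self]
          exact fun hj => k3 (hJ _ _ hj)
        · rw [Function.update_of_ne hcc]
          exact k4 c' (Finset.mem_erase.2 ⟨hcc, hc'⟩) hne

/-- A finite set has a maximal subset that is independent together with `R`. -/
theorem exists_maximal_indep {J : V → V → Prop} (hJ : ∀ u v, J u v → J v u) (hi : ∀ u, ¬ J u u)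
    (X R : Finset V) : ∃ A ⊆ X, (∀ u ∈ A, ∀ v ∈ A ∪ R, ¬ J u v) ∧
      ∀ u ∈ X, u ∉ A → ∃ v ∈ A ∪ R, J u v := by
  induction X using Finset.induction_on with
  | empty => exact ⟨∅, by simp⟩
  | insert x X hx ih =>
    obtain ⟨A, hA, h1, h2⟩ := ih
    by_cases h : ∃ v ∈ A ∪ R, J x v
    · refine ⟨A, hA.trans (Finset.subset_insert _ _), h1, fun u hu huA => ?_⟩
      rcases Finset.mem_insert.1 hu with rfl | hu
      · exact h
      · exact h2 u hu huA
    · push Not at h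
      refine ⟨insert x A, Finset.insert_subset_insert _ hA, fun u hu v hv => ?_, fun u hu huA => ?_⟩
      · rw [Finset.insert_union, Finset.mem_insert] at hv
        rcases Finset.mem_insert.1 hu with rfl | hu'
        · rcases hv with rfl | hv
          · exact hi _
          · exact h v hv
        · rcases hv with rfl | hv
          · exact fun hj => h u (Finset.mem_union_left _ hu') (hJ _ _ hj)
          · exact h1 u hu' v hv
      · rw [Finset.mem_insert, not_or] at huA
        obtain ⟨v, hv, hj⟩ := h2 u ((Finset.mem_insert.1 hu).resolve_left huA.1) huA.2
        exact ⟨v, by rw [Finset.insert_union]; exact Finset.mem_insert_of_mem hv, hj⟩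

/-- Two vertices are joined when they are the ends of a thin vertex. -/
def ThinJoined (G : SimpleGraph V) (T : V → Prop) (u v : V) : Prop :=
  u ≠ v ∧ ∃ t, T t ∧ G.Adj t u ∧ G.Adj t v

theorem ThinJoined.symm {G : SimpleGraph V} {T : V → Prop} {u v : V} (h : ThinJoined G T u v) :
    ThinJoined G T v u :=
  ⟨h.1.symm, h.2.imp fun _ ht => ⟨ht.1, ht.2.2, ht.2.1⟩⟩

/-- The subgraph spanned by the vertices with property `Y`. -/
def restr (G : SimpleGraph V) (Y : V → Prop) : SimpleGraph V where
  Adj u v := G.Adj u v ∧ Y u ∧ Y v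
  symm := ⟨fun _ _ h => ⟨h.1.symm, h.2.2, h.2.1⟩⟩
  loopless := ⟨fun _ h => h.1.ne rfl⟩

variable {G : SimpleGraph V} {U : Finset V} {T X Z W : V → Prop}

theorem Web.two_ends (h : Web G U T X Z W) {t a b c : V} (ht : T t) (ha : a ∈ U) (hb : b ∈ U)
    (hc : c ∈ U) (ka : G.Adj t a) (kb : G.Adj t b) (kc : G.Adj t c) (hab : a ≠ b) :
    c = a ∨ c = b := by
  by_contra hn
  push Not at hn
  have h2 : ({a, b, c} : Finset V).card ≤ dg G U t := Finset.card_le_card (by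
    intro v hv
    simp at hv
    rcases hv with rfl | rfl | rfl <;> simp [*])
  rw [h.nT t ht, Finset.card_eq_three.2 ⟨a, b, c, hab, hn.1.symm, hn.2.symm, rfl⟩] at h2
  omega

theorem Web.exists_breakers (h : Web G U T X Z W) :
    ∃ R : Finset V, (∀ v ∈ R, Z v ∨ W v) ∧ (∀ u ∈ R, ∀ v ∈ R, ¬ ThinJoined G T u v) ∧
      (∀ u ∈ R, ∀ v ∈ R, (restr G fun v => Z v ∨ W v).Reachable u v → u = v) ∧
      (∀ v, Z v ∨ W v → ∃ r ∈ R, (restr G fun v => Z v ∨ W v).Reachable v r) ∧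
      ∀ r ∈ R, Z r → ∀ w, W w → ¬ (restr G fun v => Z v ∨ W v).Reachable w r := by
  set Y : V → Prop := fun v => Z v ∨ W v with hY
  set H := restr G Y with hH
  have hYU : ∀ v, Y v → v ∈ U := fun v hv => (h.mem v).1 (by simp only [hY] at hv; tauto)
  let J : V → V → Prop := fun u v => (Y u ∧ Y v) ∧ ThinJoined G T u v
  have notW : ∀ u v, J u v → ¬ W v := by
    rintro u v ⟨⟨h1, h2⟩, -, t, ht, h3, h4⟩ hw
    exact h.ty t ht (h.adjW v t hw ((h.mem t).1 (.inl ht)) h4.symm)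
  have huniq : ∀ u v w, J u v → J u w → v = w := by
    rintro u v w ⟨⟨h1, h2⟩, h3, t, ht, h4, h5⟩ ⟨⟨-, k2⟩, k3, t', ht', k4, k5⟩
    have hu : Z u := by
      rcases h1 with h1 | h1
      · exact h1
      · exact (h.ty t ht (h.adjW u t h1 ((h.mem t).1 (.inl ht)) h4.symm)).elim
    obtain rfl := h.nZ u t t' hu ht ht' h4.symm k4.symm
    exact ((h.two_ends ht (hYU u h1) (hYU v h2) (hYU w k2) h4 h5 k5 h3).resolve_left k3.symm).symm
  have adjY : ∀ u, Y u → ∃ v, H.Adj u v := by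
    intro u hu
    have := h.nY u hu
    obtain ⟨v, hv⟩ := Finset.card_pos.1 (this ▸ two_pos : 0 < num G U (fun v => Z v ∨ W v) u)
    simp at hv
    exact ⟨v, hv.2.1, hu, hv.2.2⟩
  let good : V → Prop := fun v => Y v ∧ (Z v → ∀ w, W w → ¬ H.Reachable w v)
  rcases isEmpty_or_nonempty V with he | ⟨⟨v₀⟩⟩
  · exact ⟨∅, by simp⟩
  obtain ⟨pick, hp⟩ := exists_transversal H.connectedComponentMk (J := J)
    (fun u v hj => ⟨hj.1.symm, hj.2.symm⟩) huniq good ((U.filter Y).image H.connectedComponentMk)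
    (fun c hc u => by
      obtain ⟨v, hv, rfl⟩ := Finset.mem_image.1 hc
      replace hv := (Finset.mem_filter.1 hv).2
      by_cases hw : ∃ w, W w ∧ H.Reachable w v
      · obtain ⟨w, h1, h2⟩ := hw
        exact ⟨w, SimpleGraph.ConnectedComponent.sound h2, ⟨.inr h1, fun hz => (h.zw w hz h1).elim⟩,
          fun hj => notW u w hj h1⟩
      · push Not at hw
        by_cases hj : J u v
        · obtain ⟨v', hv'⟩ := adjY v hv
          exact ⟨v', SimpleGraph.ConnectedComponent.sound hv'.symm.reachable,
            ⟨hv'.2.2, fun _ w h1 h2 => hw w h1 (h2.trans hv'.symm.reachable)⟩,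
            fun hj' => hv'.1.ne (huniq u v v' hj hj')⟩
        · exact ⟨v, rfl, ⟨hv, fun _ => hw⟩, hj⟩) v₀
  have hmem : ∀ v, Y v → H.connectedComponentMk v ∈ (U.filter Y).image H.connectedComponentMk :=
    fun v hv => Finset.mem_image_of_mem _ (by simp [hv, hYU v hv])
  refine ⟨((U.filter Y).image H.connectedComponentMk).image pick, ?_, ?_, ?_, ?_, ?_⟩
  · intro v hv
    obtain ⟨c, hc, rfl⟩ := Finset.mem_image.1 hv
    exact (hp c hc).2.1.1
  · intro u hu v hv hj
    obtain ⟨c, hc, rfl⟩ := Finset.mem_image.1 hu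
    obtain ⟨c', hc', rfl⟩ := Finset.mem_image.1 hv
    by_cases hcc : c' = c
    · subst hcc
      exact hj.1 rfl
    · exact (hp c hc).2.2.2 c' hc' hcc ⟨⟨(hp c hc).2.1.1, (hp c' hc').2.1.1⟩, hj⟩
  · intro u hu v hv hr
    obtain ⟨c, hc, rfl⟩ := Finset.mem_image.1 hu
    obtain ⟨c', hc', rfl⟩ := Finset.mem_image.1 hv
    have := SimpleGraph.ConnectedComponent.sound hr
    rw [(hp c hc).1, (hp c' hc').1] at this
    rw [this]
  · intro v hv
    exact ⟨_, Finset.mem_image_of_mem _ (hmem v hv),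
      (SimpleGraph.ConnectedComponent.exact (hp _ (hmem v hv)).1).symm⟩
  · intro r hr
    obtain ⟨c, hc, rfl⟩ := Finset.mem_image.1 hr
    exact (hp c hc).2.1.2

end

section
variable {V : Type*}

/-- A colouring of a web: `A` and `B` are the coloured vertices of degree four, `R` consists of one
vertex from each cycle of `Z ∪ W`, and `C` is a set of coloured thin vertices. -/
structure Paint (G : SimpleGraph V) (U : Finset V) (T X Z W : V → Prop) (A B C R : Finset V) :
    Prop where
  web : Web G U T X Z W
  rY : ∀ v ∈ R, Z v ∨ W v
  rJ : ∀ u ∈ R, ∀ v ∈ R, ¬ ThinJoined G T u v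
  rU : ∀ u ∈ R, ∀ v ∈ R, (restr G fun v => Z v ∨ W v).Reachable u v → u = v
  rE : ∀ v, Z v ∨ W v → ∃ r ∈ R, (restr G fun v => Z v ∨ W v).Reachable v r
  rW : ∀ r ∈ R, Z r → ∀ w, W w → ¬ (restr G fun v => Z v ∨ W v).Reachable w r
  aX : ∀ v ∈ A, X v
  aJ : ∀ u ∈ A, ∀ v ∈ A, ¬ ThinJoined G T u v
  bX : ∀ v ∈ B, X v
  ab : ∀ v ∈ A, v ∉ B
  bJ : ∀ u ∈ B, ∀ v, v ∈ B ∨ v ∈ R → ¬ ThinJoined G T u v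
  fJ : ∀ u, X u → u ∉ A → u ∉ B →
    (∃ v ∈ A, ThinJoined G T u v) ∧ ∃ v, (v ∈ B ∨ v ∈ R) ∧ ThinJoined G T u v
  cT : ∀ t ∈ C, T t
  cE : ∀ t ∈ C, ∀ u ∈ U, G.Adj t u → u ∉ A ∧ u ∉ B ∧ u ∉ R
  cJ : ∀ t ∈ C, ∀ t' ∈ C, ∀ w, X w → w ∉ A → w ∉ B → G.Adj t w → G.Adj t' w → t = t'
  cM : ∀ t w, T t → X w → G.Adj t w → (∀ u ∈ U, G.Adj t u → u ∉ A ∧ u ∉ B ∧ u ∉ R) → t ∉ C →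
    ∃ t' ∈ C, ∃ w', X w' ∧ w' ∉ A ∧ w' ∉ B ∧ G.Adj t w' ∧ G.Adj t' w'

variable {G : SimpleGraph V} {U : Finset V} {T X Z W : V → Prop}

theorem Web.exists_paint (h : Web G U T X Z W) : ∃ A B C R, Paint G U T X Z W A B C R := by
  obtain ⟨R, r1, r2, r3, r4, r5⟩ := h.exists_breakers
  have hs : ∀ u v, ThinJoined G T u v → ThinJoined G T v u := fun _ _ => ThinJoined.symm
  have hi : ∀ u, ¬ ThinJoined G T u u := fun _ h => h.1 rfl
  obtain ⟨A, a1, a2, a3⟩ := exists_maximal_indep hs hi (U.filter X) ∅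
  obtain ⟨B, b1, b2, b3⟩ := exists_maximal_indep hs hi (U.filter X \ A) R
  obtain ⟨C, c1, c2, c3⟩ := exists_maximal_indep
    (J := fun t t' => t ≠ t' ∧ ∃ w, (X w ∧ w ∉ A ∧ w ∉ B) ∧ G.Adj t w ∧ G.Adj t' w)
    (fun t t' ⟨h1, w, h2, h3, h4⟩ => ⟨h1.symm, w, h2, h4, h3⟩) (fun t h => h.1 rfl)
    (U.filter fun t => T t ∧ ∀ u ∈ U, G.Adj t u → u ∉ A ∧ u ∉ B ∧ u ∉ R) ∅
  simp only [Finset.union_empty, Finset.mem_union] at a2 a3 b2 b3 c2 c3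
  have hXU : ∀ v, X v → v ∈ U := fun v hv => (h.mem v).1 (by tauto)
  have hTU : ∀ v, T v → v ∈ U := fun v hv => (h.mem v).1 (by tauto)
  refine ⟨A, B, C, R, h, r1, r2, r3, r4, r5, fun v hv => (Finset.mem_filter.1 (a1 hv)).2, a2,
    fun v hv => (Finset.mem_filter.1 (Finset.mem_sdiff.1 (b1 hv)).1).2,
    fun v hv hv' => (Finset.mem_sdiff.1 (b1 hv')).2 hv, b2, fun u hu hA hB => ⟨?_, ?_⟩,
    fun t ht => (Finset.mem_filter.1 (c1 ht)).2.1, fun t ht => (Finset.mem_filter.1 (c1 ht)).2.2,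
    fun t ht t' ht' w h1 h2 h3 h4 h5 => ?_, fun t w ht hw ha hE htC => ?_⟩
  · exact a3 u (by simp [hXU u hu, hu]) hA
  · exact b3 u (by simp [hXU u hu, hu, hA]) hB
  · by_contra hne
    exact c2 t ht t' ht' ⟨hne, w, ⟨h1, h2, h3⟩, h4, h5⟩
  · obtain ⟨t', h1, h2, w', h3, h4, h5⟩ := c3 t (by simp [hTU t ht, ht]; exact hE) htC
    exact ⟨t', h1, w', h3.1, h3.2.1, h3.2.2, h4, h5⟩

variable {A B C R : Finset V}

/-- The thin vertices that receive the first colour. -/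
def ThinCol (G : SimpleGraph V) (U : Finset V) (T Z : V → Prop) (C : Finset V) (t : V) : Prop :=
  T t ∧ ((∀ u ∈ U, G.Adj t u → Z u) ∨ t ∈ C)

variable {K : V → Prop}

/-- The first colour is used on a breaker when both its neighbours are of kind `W` and satisfy `K`. -/
def Flip (G : SimpleGraph V) (U : Finset V) (W K : V → Prop) (v : V) : Prop :=
  W v ∧ ∀ u ∈ U, G.Adj v u → W u ∧ K u

theorem Paint.peel [Fintype V] (P : Paint G U T X Z W A B C R) (κ : V → ℕ)
    (hκ : ∀ v, κ v ≠ 0 → κ v = 1 ∧ W v ∧ K v ∧ ∃ r ∈ R, G.Adj v r ∧ ¬ Flip G U W K r)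
    {S : Finset V} (hSU : S ⊆ U) (hne : S.Nonempty)
    (hS : ∀ v ∈ S, v ∉ A ∧ v ∉ B ∧ v ∉ R ∧ ¬ ThinCol G U T Z C v) :
    ∃ v ∈ S, dg G S v + κ v ≤ 1 := by
  by_contra hcon
  push Not at hcon
  have hw := P.web
  have κ0 : ∀ v, ¬ W v → κ v = 0 := fun v hv => by
    by_contra hn
    exact hv (hκ v hn).2.1
  have full : ∀ v, dg G U v ≤ dg G S v → ∀ u ∈ U, G.Adj v u → u ∈ S := by
    intro v hv u hu ha
    have := Finset.eq_of_subset_of_card_le (Finset.filter_subset_filter (G.Adj v) hSU) hv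
    have h2 : u ∈ U.filter (G.Adj v) := by simp [hu, ha]
    rw [← this] at h2
    exact (Finset.mem_filter.1 h2).1
  have fullT : ∀ t ∈ S, T t → ∀ u ∈ U, G.Adj t u → u ∈ S := by
    intro t ht hT
    have := hcon t ht
    rw [κ0 t (fun h => hw.ty t hT (.inr h))] at this
    exact full t (by rw [hw.nT t hT]; omega)
  have hXU : ∀ v, X v → v ∈ U := fun v hv => (hw.mem v).1 (by tauto)
  have hTU : ∀ v, T v → v ∈ U := fun v hv => (hw.mem v).1 (by tauto)
  have hYU : ∀ v, Z v ∨ W v → v ∈ U := fun v hv => (hw.mem v).1 (by tauto)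
  have hnum : ∀ v, Z v ∨ W v →
      (U.filter fun u => G.Adj v u ∧ (Z u ∨ W u)).card = 2 := fun v hv => by
    have := hw.nY v hv
    unfold num at this
    convert this
  have noX : ∀ w ∈ S, ¬ X w := by
    intro w hwS hX
    have h1 := hcon w hwS
    rw [κ0 w (fun h => hw.xy w hX (.inr h))] at h1
    obtain ⟨t, ht⟩ := Finset.card_pos.1 (show 0 < dg G S w by omega)
    obtain ⟨htS, hta⟩ := Finset.mem_filter.1 ht
    have hT := hw.adjX w t hX (hSU htS) hta
    have hend : ∀ u ∈ U, G.Adj t u → u ∉ A ∧ u ∉ B ∧ u ∉ R := fun u hu ha => by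
      have := hS u (fullT t htS hT u hu ha)
      tauto
    obtain ⟨t', htC, w', k1, k2, k3, k4, k5⟩ := P.cM t w hT hX hta.symm hend
      fun hC => (hS t htS).2.2.2 ⟨hT, .inr hC⟩
    have hw'S := fullT t htS hT w' (hXU w' k1) k4
    have h2 := hcon w' hw'S
    rw [κ0 w' (fun h => hw.xy w' k1 (.inr h))] at h2
    obtain ⟨⟨a, ha, hne1, s, hs, hs1, hs2⟩, b, hb, hne2, s', hs', hs1', hs2'⟩ := P.fJ w' k1 k2 k3
    have hbU : b ∈ U := hb.elim (fun h => hXU b (P.bX b h)) fun h => hYU b (P.rY b h)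
    have haU := hXU a (P.aX a ha)
    have hab : a ≠ b := by
      rintro rfl
      rcases hb with hb | hb
      · exact P.ab a ha hb
      · exact hw.xy a (P.aX a ha) (P.rY a hb)
    have d1 : s ≠ s' := by
      rintro rfl
      rcases hw.two_ends hs haU hbU (hXU w' k1) hs2 hs2' hs1 hab with h | h
      · exact hne1 h
      · exact hne2 h
    have d2 : s ∉ S := fun h => (hS a (fullT s h hs a haU hs2)).1 ha
    have d3 : s' ∉ S := fun h => by
      have := hS b (fullT s' h hs' b hbU hs2')
      tauto
    have d4 : t' ∉ S := fun h => (hS t' h).2.2.2 ⟨P.cT t' htC, .inr htC⟩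
    have d5 : t' ≠ s := by
      rintro rfl
      exact (P.cE t' htC a haU hs2).1 ha
    have d6 : t' ≠ s' := by
      rintro rfl
      have := P.cE t' htC b hbU hs2'
      tauto
    have h3 : ({t', s, s'} ∪ S.filter (G.Adj w')).card ≤ dg G U w' := by
      refine Finset.card_le_card (Finset.union_subset ?_ (Finset.filter_subset_filter _ hSU))
      intro v hv
      simp only [Finset.mem_insert, Finset.mem_singleton] at hv
      rcases hv with rfl | rfl | rfl <;> simp [P.cT, *, G.adj_comm w']
    rw [Finset.card_union_of_disjoint, Finset.card_eq_three.2 ⟨t', s, s', d5, d6, d1, rfl⟩,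
      hw.nX w' k1] at h3
    · unfold dg at h2
      omega
    · simp [Finset.disjoint_left, *]
  have noT : ∀ t ∈ S, ¬ T t := by
    intro t ht hT
    refine (hS t ht).2.2.2 ⟨hT, .inl fun u hu ha => ?_⟩
    rcases hw.adjT t u hT hu ha with h | h
    · exact (noX u (fullT t ht hT u hu ha) h).elim
    · exact h
  have hY : ∀ v ∈ S, Z v ∨ W v := fun v hv => by
    have := (hw.mem v).2 (hSU hv)
    have := noX v hv
    have := noT v hv
    tauto
  set H := restr G fun v => Z v ∨ W v with hH
  have hdY : ∀ v ∈ S, S.filter (G.Adj v) ⊆ U.filter fun u => G.Adj v u ∧ (Z u ∨ W u) := by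
    intro v hv u hu
    obtain ⟨h1, h2⟩ := Finset.mem_filter.1 hu
    simp [hSU h1, h2, hY u h1]
  obtain ⟨v₀, hv₀⟩ := hne
  obtain ⟨r, hr, hvr⟩ := P.rE v₀ (hY v₀ hv₀)
  set S' := S.filter fun v => H.Reachable v r with hS'
  have hdg : ∀ v ∈ S', dg G S' v = dg G S v := by
    intro v hv
    unfold dg
    congr 1
    ext u
    simp only [hS', Finset.mem_filter, and_congr_left_iff, and_iff_left_iff_imp]
    intro ha hu
    obtain ⟨h1, h2⟩ := Finset.mem_filter.1 hv
    have : H.Adj u v := ⟨ha.symm, hY u hu, hY v h1⟩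
    exact this.reachable.trans h2
  have cons : ∀ q ∈ S', κ q ≠ 0 → κ q = 1 ∧ W q ∧ K q ∧ G.Adj q r ∧ ¬ Flip G U W K r := by
    intro q hq hq0
    obtain ⟨h1, h2, h3, r', h4, h5, h6⟩ := hκ q hq0
    obtain ⟨k1, k2⟩ := Finset.mem_filter.1 hq
    have h7 : H.Adj q r' := ⟨h5, hY q k1, P.rY r' h4⟩
    obtain rfl := P.rU r' h4 r hr (h7.symm.reachable.trans k2)
    exact ⟨h1, h2, h3, h5, h6⟩
  have hrS : r ∉ S := fun h => (hS r h).2.2.1 hr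
  by_cases hq : ∃ q ∈ S', κ q ≠ 0
  · obtain ⟨q, hq, hq0⟩ := hq
    obtain ⟨c1, c2, c3, c4, c5⟩ := cons q hq hq0
    have huniq : ∀ v ∈ S'.erase q, dg G S' v = 2 := by
      intro v hv
      obtain ⟨hvq, hv⟩ := Finset.mem_erase.1 hv
      have hvS := (Finset.mem_filter.1 hv).1
      have hv0 : κ v = 0 := by
        by_contra hv0
        obtain ⟨k1, k2, k3, k4, k5⟩ := cons v hv hv0
        rcases P.rY r hr with hz | hz
        · exact P.rW r hr hz q c2 (Finset.mem_filter.1 hq).2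
        · refine c5 ⟨hz, fun u hu ha => ?_⟩
          have h1 := hw.nY r (.inr hz)
          have h2 : u = v ∨ u = q := by
            by_contra hn
            push Not at hn
            have h3 : ({u, v, q} : Finset V).card ≤ num G U (fun v => Z v ∨ W v) r := by
              refine Finset.card_le_card fun x hx => ?_
              simp only [Finset.mem_insert, Finset.mem_singleton] at hx
              rcases hx with rfl | rfl | rfl
              · simp [hu, ha, hw.adjW r x hz hu ha]
              · simp [hYU x (.inr k2), k4.symm, k2]
              · simp [hYU x (.inr c2), c4.symm, c2]
            rw [Finset.card_eq_three.2 ⟨u, v, q, hn.1, hn.2, hvq, rfl⟩] at h3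
            omega
          rcases h2 with rfl | rfl
          · exact ⟨k2, k3⟩
          · exact ⟨c2, c3⟩
      have h1 := hcon v hvS
      have h2 := Finset.card_le_card (hdY v hvS)
      have h3 := hnum v (hY v hvS)
      rw [hdg v hv]
      unfold dg at h1 ⊢
      omega
    have hqS := (Finset.mem_filter.1 hq).1
    have hq1 : dg G S' q = 1 := by
      have h1 := hcon q hqS
      have h3 := hnum q (.inr c2)
      have h4 := Finset.card_lt_card ((hdY q hqS).ssubset_of_ne fun he => hrS (by
        have : r ∈ U.filter fun u => G.Adj q u ∧ (Z u ∨ W u) := by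
          simp [hYU r (P.rY r hr), c4, P.rY r hr]
        rw [← he] at this
        exact (Finset.mem_filter.1 this).1))
      rw [hdg q hq]
      unfold dg at h1 ⊢
      omega
    have h1 := sum_dg (G := G) S'
    rw [← Finset.add_sum_erase _ _ hq, Finset.sum_congr rfl huniq, hq1, Finset.sum_const,
      smul_eq_mul] at h1
    omega
  · push Not at hq
    have hcl : ∀ v ∈ S', ∀ u, H.Adj v u → u ∈ S' := by
      intro v hv u ha
      obtain ⟨h1, h2⟩ := Finset.mem_filter.1 hv
      have h3 := hcon v h1
      rw [hq v hv] at h3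
      have h4 := hnum v (hY v h1)
      have h5 := Finset.eq_of_subset_of_card_le (hdY v h1)
        (by unfold dg at h3; omega)
      have h6 : u ∈ U.filter fun u => G.Adj v u ∧ (Z u ∨ W u) := by
        simp only [Finset.mem_filter]
        exact ⟨hYU u ha.2.2, ha.1, ha.2.2⟩
      rw [← h5] at h6
      exact Finset.mem_filter.2 ⟨(Finset.mem_filter.1 h6).1, ha.symm.reachable.trans h2⟩
    have hwalk : ∀ v u, H.Walk v u → v ∈ S' → u ∈ S' := by
      intro v u p
      induction p with
      | nil => exact id
      | cons ha _ ih => exact fun hv => ih (hcl _ hv _ ha)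
    obtain ⟨p⟩ := hvr
    exact hrS (Finset.mem_filter.1 (hwalk v₀ r p (Finset.mem_filter.2 ⟨hv₀, ⟨p⟩⟩))).1

end

section
variable {V : Type*} (G : SimpleGraph V) (U : Finset V) (T X Z W K : V → Prop) (A B C R : Finset V)

/-- The colouring determined by a paint. -/
noncomputable def paintCol (v : V) : Option Bool :=
  if v ∈ A then some true else if v ∈ B then some false else
  if v ∈ R then some (decide (Flip G U W K v)) else if ThinCol G U T Z C v then some true else none

variable {G U T X Z W K A B C R}

theorem eq_true_of_paintCol {v : V} (h : paintCol G U T Z W K A B C R v = some true) :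
    v ∈ A ∨ (v ∈ R ∧ Flip G U W K v) ∨ ThinCol G U T Z C v := by
  unfold paintCol at h
  split_ifs at h <;> simp_all

theorem eq_false_of_paintCol {v : V} (h : paintCol G U T Z W K A B C R v = some false) :
    v ∈ B ∨ (v ∈ R ∧ ¬ Flip G U W K v) := by
  unfold paintCol at h
  split_ifs at h <;> simp_all

theorem eq_none_of_paintCol {v : V} (h : paintCol G U T Z W K A B C R v = none) :
    v ∉ A ∧ v ∉ B ∧ v ∉ R ∧ ¬ ThinCol G U T Z C v := by
  unfold paintCol at h
  split_ifs at h <;> simp_all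

theorem nb_le_one {D : Finset V} {col : V → Option Bool} {v : V} {s : Option Bool}
    (h : ∀ u ∈ D, ∀ u' ∈ D, G.Adj v u → G.Adj v u' → col u = s → col u' = s → u = u') :
    nb G D col v s ≤ 1 := by
  refine Finset.card_le_one.2 fun u hu u' hu' => ?_
  obtain ⟨h1, h2, h3⟩ := Finset.mem_filter.1 hu
  obtain ⟨k1, k2, k3⟩ := Finset.mem_filter.1 hu'
  exact h u h1 u' k1 h2 k2 h3 k3

theorem Paint.raw [Fintype V] (P : Paint G U T X Z W A B C R) (σ : V → Option Bool → ℕ)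
    (h0 : ∀ v s, ¬ W v → σ v s = 0) (h1 : ∀ v s, σ v s ≤ 1)
    (ht : ∀ v ∉ R, σ v (some true) ≠ 0 → ¬ K v)
    (hf : ∀ v ∉ R, σ v (some false) ≠ 0 → ∀ r ∈ R, G.Adj v r → Flip G U W K r)
    (hn : ∀ v, σ v none ≠ 0 → K v ∧ ∃ r ∈ R, G.Adj v r ∧ ¬ Flip G U W K r) :
    Raw G U (paintCol G U T Z W K A B C R) σ := by
  have hw := P.web
  have colT := fun v => eq_true_of_paintCol (G := G) (U := U) (T := T) (Z := Z) (W := W) (K := K)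
    (A := A) (B := B) (C := C) (R := R) (v := v)
  have colF := fun v => eq_false_of_paintCol (G := G) (U := U) (T := T) (Z := Z) (W := W) (K := K)
    (A := A) (B := B) (C := C) (R := R) (v := v)
  set col := paintCol G U T Z W K A B C R
  have hAX := P.aX
  have hBX := P.bX
  have hRY := P.rY
  have hnear : ∀ v ∈ U, ∀ u ∈ R, ∀ u' ∈ R, (Z v ∨ W v) → G.Adj v u → G.Adj v u' → u = u' := by
    intro v hv u hu u' hu' hY ha ha'
    have e1 : (restr G fun v => Z v ∨ W v).Adj u v := ⟨ha.symm, P.rY u hu, hY⟩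
    have e2 : (restr G fun v => Z v ∨ W v).Adj v u' := ⟨ha', hY, P.rY u' hu'⟩
    exact P.rU u hu u' hu' (e1.reachable.trans e2.reachable)
  have hRR : ∀ u ∈ R, ∀ v ∈ R, ¬ G.Adj u v := by
    intro u hu v hv ha
    have e1 : (restr G fun v => Z v ∨ W v).Adj u v := ⟨ha, P.rY u hu, P.rY v hv⟩
    exact ha.ne (P.rU u hu v hv e1.reachable)
  have hXthin : ∀ v u, X v → v ∈ U → G.Adj v u → ThinCol G U T Z C u →
      u ∈ C ∧ v ∉ A ∧ v ∉ B := by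
    rintro v u hX hv ha ⟨hT, h | h⟩
    · exact (hw.xy v hX (.inl (h v hv ha.symm))).elim
    · have := P.cE u h v hv ha.symm
      exact ⟨h, this.1, this.2.1⟩
  refine ⟨fun v hv c hc => ?_, fun v hv c hc => nb_eq_zero fun u hu ha hcu => ?_,
    fun S hS hne hcol => ?_⟩
  · rcases (hw.mem v).2 hv with hT | hX | hZ | hW
    · rw [h0 v _ fun h => hw.ty v hT (.inr h)]
      refine nb_le_one fun u hu u' hu' ha ha' k k' => ?_
      have e := hw.adjT v u hT hu ha
      have e' := hw.adjT v u' hT hu' ha'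
      by_contra hne
      have J : ThinJoined G T u u' := ⟨hne, v, hT, ha, ha'⟩
      rcases c
      · rcases colF u k with k | ⟨k, -⟩ <;> rcases colF u' k' with k' | ⟨k', -⟩
        · exact P.bJ u k u' (.inl k') J
        · exact P.bJ u k u' (.inr k') J
        · exact P.bJ u' k' u (.inr k) J.symm
        · exact P.rJ u k u' k' J
      · have key : ∀ u, X u ∨ Z u → (u ∈ A ∨ (u ∈ R ∧ Flip G U W K u) ∨ ThinCol G U T Z C u) →
            u ∈ A := by
          rintro u e (h | ⟨-, h⟩ | h)
          · exact h
          · have := hw.xy u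
            have := hw.zw u
            have := h.1
            tauto
          · have := hw.tx u h.1
            have := hw.ty u h.1
            tauto
        exact P.aJ u (key u e (colT u k)) u' (key u' e' (colT u' k')) J
    · rw [h0 v _ fun h => hw.xy v hX (.inr h)]
      refine nb_le_one fun u hu u' hu' ha ha' k k' => ?_
      have e := hw.adjX v u hX hu ha
      have e' := hw.adjX v u' hX hu' ha'
      rcases c
      · rcases colF u k with k | ⟨k, -⟩
        · exact (hw.tx u e (hBX u k)).elim
        · exact (hw.ty u e (hRY u k)).elim
      · have key : ∀ u, G.Adj v u → T u →
            (u ∈ A ∨ (u ∈ R ∧ Flip G U W K u) ∨ ThinCol G U T Z C u) → u ∈ C ∧ v ∉ A ∧ v ∉ B := by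
          rintro u ha e (h | ⟨h, -⟩ | h)
          · exact (hw.tx u e (hAX u h)).elim
          · exact (hw.ty u e (hRY u h)).elim
          · exact hXthin v u hX hv ha h
        obtain ⟨j1, j2, j3⟩ := key u ha e (colT u k)
        exact P.cJ u j1 u' (key u' ha' e' (colT u' k')).1 v hX j2 j3 ha.symm ha'.symm
    · rw [h0 v _ (hw.zw v hZ)]
      refine nb_le_one fun u hu u' hu' ha ha' k k' => ?_
      have nX : ∀ u ∈ U, G.Adj v u → ¬ X u := fun u hu ha hX => by
        have := hw.tx u
        have := hw.xy u hX
        have := hw.adjZ v u hZ hu ha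
        tauto
      rcases c
      · have key : ∀ u ∈ U, G.Adj v u → (u ∈ B ∨ (u ∈ R ∧ ¬ Flip G U W K u)) → u ∈ R := by
          rintro u hu ha (h | h)
          · exact (nX u hu ha (hBX u h)).elim
          · exact h.1
        exact hnear v hv u (key u hu ha (colF u k)) u' (key u' hu' ha' (colF u' k')) (.inl hZ) ha ha'
      · have key : ∀ u ∈ U, G.Adj v u →
            (u ∈ A ∨ (u ∈ R ∧ Flip G U W K u) ∨ ThinCol G U T Z C u) → T u := by
          rintro u hu ha (h | ⟨h, h'⟩ | h)
          · exact (nX u hu ha (hAX u h)).elim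
          · exact (hw.zw v hZ (h'.2 v hv ha.symm).1).elim
          · exact h.1
        exact hw.nZ v u u' hZ (key u hu ha (colT u k)) (key u' hu' ha' (colT u' k')) ha ha'
    · have keyT : ∀ u ∈ U, G.Adj v u → col u = some true → u ∈ R ∧ Flip G U W K u := by
        intro u hu ha k
        have e := hw.adjW v u hW hu ha
        rcases colT u k with h | h | h
        · exact (hw.xy u (hAX u h) e).elim
        · exact h
        · exact (hw.ty u h.1 e).elim
      have keyF : ∀ u ∈ U, G.Adj v u → col u = some false → u ∈ R ∧ ¬ Flip G U W K u := by
        intro u hu ha k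
        have e := hw.adjW v u hW hu ha
        rcases colF u k with h | h
        · exact (hw.xy u (hBX u h) e).elim
        · exact h
      have key : ∀ u ∈ U, G.Adj v u → col u = some c → u ∈ R := by
        intro u hu ha k
        rcases c
        · exact (keyF u hu ha k).1
        · exact (keyT u hu ha k).1
      have hle : nb G U col v (some c) ≤ 1 := nb_le_one fun u hu u' hu' ha ha' k k' =>
        hnear v hv u (key u hu ha k) u' (key u' hu' ha' k') (.inr hW) ha ha'
      by_cases hz : nb G U col v (some c) = 0
      · have := h1 v (some c)
        omega
      obtain ⟨u, hu⟩ := Finset.card_pos.1 (Nat.pos_of_ne_zero hz)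
      obtain ⟨hu1, ha, k⟩ := Finset.mem_filter.1 hu
      have hvR : v ∉ R := fun h => hRR v h u (key u hu1 ha k) ha
      suffices σ v (some c) = 0 by omega
      by_contra hs
      rcases c
      · obtain ⟨h2, h3⟩ := keyF u hu1 ha k
        exact h3 (hf v hvR hs u h2 ha)
      · obtain ⟨h2, h3⟩ := keyT u hu1 ha k
        exact ht v hvR hs (h3.2 v hv ha.symm).2
  · have hXe : ∀ u v, u ∈ U → v ∈ U → X u → G.Adj u v → ¬ (X v ∨ Z v ∨ W v) := by
      intro u v hu hv hX ha
      have e := hw.adjX u v hX hv ha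
      have := hw.tx v e
      have := hw.ty v e
      tauto
    rcases c
    · rcases colF v hc with k | k <;> rcases colF u hcu with k' | k'
      · exact hXe v u hv hu (hBX v k) ha (.inl (hBX u k'))
      · exact hXe v u hv hu (hBX v k) ha (.inr (hRY u k'.1))
      · exact hXe u v hu hv (hBX u k') ha.symm (.inr (hRY v k.1))
      · exact hRR v k.1 u k'.1 ha
    · have hWt : ∀ u v, u ∈ U → v ∈ U → T u → G.Adj u v → ¬ (T v ∨ W v) := by
        intro u v hu hv hT ha
        have := hw.adjT u v hT hv ha
        have := hw.tx v
        have := hw.ty v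
        have := hw.xy v
        have := hw.zw v
        tauto
      rcases colT v hc with k | k | k <;> rcases colT u hcu with k' | k' | k'
      · exact hXe v u hv hu (hAX v k) ha (.inl (hAX u k'))
      · exact hXe v u hv hu (hAX v k) ha (.inr (hRY u k'.1))
      · exact (hXthin v u (hAX v k) hv ha k').2.1 k
      · exact hXe u v hu hv (hAX u k') ha.symm (.inr (hRY v k.1))
      · exact hRR v k.1 u k'.1 ha
      · exact hWt u v hu hv k'.1 ha.symm (.inr k.2.1)
      · exact (hXthin u v (hAX u k') hu ha.symm k).2.1 k'
      · exact hWt v u hv hu k.1 ha (.inr k'.2.1)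
      · exact hWt v u hv hu k.1 ha (.inl k'.1)
  · refine P.peel (K := K) (fun v => σ v none) (fun v hv => ?_) hS hne fun v hv =>
      eq_none_of_paintCol (hcol v hv)
    refine ⟨?_, ?_, hn v hv⟩
    · have := h1 v none
      omega
    · by_contra hW
      exact hv (h0 v none hW)

theorem Crit.elim [Fintype V] {ℓ : V → LV} (M : Crit G ℓ U) : False := by
  obtain ⟨A, B, C, R, P⟩ := M.web.exists_paint
  set T := Thin G ℓ U
  set Z : V → Prop := fun v => v ∈ U ∧ ℓ v = 0 ∧ dg G U v = 3 with hZ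
  set W : V → Prop := fun v => v ∈ U ∧ (ℓ v).cost = 1 with hW
  set K : V → Prop := fun v => 1 ≤ (ℓ v).kb
  let f : V → Prop := fun v => ∃ r ∈ R, G.Adj v r ∧ ¬ Flip G U W K r
  let κ : V → Option Bool → ℕ := fun v s =>
    if W v then
      if v ∈ R then if s = some !(decide (Flip G U W K v)) then 1 else 0
      else if K v then if s = (if f v then none else some false) then 1 else 0
      else if s = some true then 1 else 0
    else 0
  refine M.no (paintCol G U T Z W K A B C R) [] ⟨κ, ?_, fun v hv => ?_, by simp⟩
  · simp only [eps_nil, add_zero]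
    refine P.raw κ (fun v s h => by simp [κ, h]) (fun v s => ?_) (fun v hv h hK => ?_)
      (fun v hv h r hr ha => ?_) fun v h => ?_
    · simp only [κ]
      split_ifs <;> simp
    · simp only [κ, hv, hK, if_true, if_false] at h
      split_ifs at h <;> simp_all
    · by_contra hF
      have : f v := ⟨r, hr, ha, hF⟩
      simp only [κ, hv, this, if_true, if_false] at h
      split_ifs at h <;> simp_all
    · simp only [κ] at h
      split_ifs at h <;> simp_all
      exact ‹f v›
  · by_cases h : (ℓ v).cost = 1
    · have hWv : W v := ⟨hv, h⟩
      have hA : v ∉ A := fun h' => M.web.xy v (P.aX v h') (.inr hWv)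
      have hB : v ∉ B := fun h' => M.web.xy v (P.bX v h') (.inr hWv)
      have hT : ¬ ThinCol G U T Z C v := fun h' => M.web.ty v h'.1 (.inr hWv)
      unfold cost at h
      by_cases hR : v ∈ R
      · simp only [paintCol, hA, hB, hR, if_true, if_false, Meets, κ, hWv]
        refine ⟨by omega, by omega, by omega, ?_⟩
        split_ifs <;> omega
      · simp only [paintCol, hA, hB, hR, hT, if_true, if_false, Meets, κ, hWv]
        by_cases hK : K v
        · have : 1 ≤ (ℓ v).kb := hK
          by_cases hf : f v <;> simp [hf, hK] <;> omega
        · have : ¬ 1 ≤ (ℓ v).kb := hK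
          simp [hK]
          omega
    · have : ℓ v = 0 := by
        rcases (M.web.mem v).2 hv with h' | h' | h' | h'
        · exact h'.2.1
        · exact h'.2.1
        · exact h'.2.1
        · exact (h h'.2).elim
      rw [this]
      unfold Meets
      split
      · exact ⟨rfl, rfl, rfl, by simp [show (0 : LV).b = 0 from rfl, show (0 : LV).l = 0 from rfl]⟩
      · refine ⟨?_, ?_, ?_, ?_, ?_, ?_, ?_⟩ <;> exact Nat.zero_le _

end

section
variable {V : Type*} {G : SimpleGraph V}

theorem exists_st [Fintype V] (n : ℕ) : ∀ (U : Finset V) (ℓ : V → LV), U.card = n → (∀ v ∈ U, (ℓ v).kb ≤ 1) →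
    (∀ C ⊆ U, 0 ≤ rho G ℓ C) → ∃ col, St G ℓ U col [] := by
  induction n using Nat.strong_induction_on with
  | _ n ih =>
    intro U ℓ hn hpv hnn
    by_contra hcon
    exact Crit.elim (G := G) (U := U) (ℓ := ℓ)
      ⟨fun U' ℓ' h => ih U'.card (hn ▸ h) U' ℓ' rfl, hpv, hnn,
        fun col ns h => hcon ⟨col, h.sublist (List.nil_sublist ns)⟩⟩

theorem isAcyclic_of_peel {F : Set V} (h : ∀ S : Finset V, S.Nonempty → (∀ v ∈ S, v ∈ F) →
    ∃ v ∈ S, (S.filter (G.Adj v)).card ≤ 1) : (G.induce F).IsAcyclic := by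
  intro a p hp
  obtain ⟨v, hv, hcard⟩ := h (p.support.toFinset.map (Function.Embedding.subtype _))
    ⟨a, by simp⟩ (by simp only [Finset.mem_map]; rintro _ ⟨u, -, rfl⟩; exact u.2)
  simp only [Finset.mem_map, List.mem_toFinset, Function.Embedding.subtype_apply] at hv
  obtain ⟨v, hv, rfl⟩ := hv
  have h2 := hp.ncard_neighborSet_toSubgraph_eq_two hv
  obtain ⟨x, y, hxy, hs⟩ := Set.ncard_eq_two.1 h2
  have key : ∀ z, z ∈ p.toSubgraph.neighborSet v →
      (z : V) ∈ (p.support.toFinset.map (Function.Embedding.subtype _)).filter (G.Adj v) := by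
    intro z hz
    have h3 : z ∈ p.support := p.mem_verts_toSubgraph.1 (SimpleGraph.Subgraph.Adj.snd_mem hz)
    simp only [Finset.mem_filter, Finset.mem_map, List.mem_toFinset,
      Function.Embedding.subtype_apply]
    exact ⟨⟨z, h3, rfl⟩, (p.toSubgraph.adj_sub hz : (G.induce F).Adj v z)⟩
  exact hxy (Subtype.ext (Finset.card_le_one.1 hcard _ (key x (by simp [hs])) _
    (key y (by simp [hs]))))

theorem Raw.twoIndepSet [Fintype V] {col : V → Option Bool} {σ : V → Option Bool → ℕ}
    (h : Raw G Finset.univ col σ) (c : Bool) : TwoIndepSet G {v | col v = some c} := by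
  intro u hu v hv hne
  refine ⟨fun ha => ne_of_nb_eq_zero (h.same u (Finset.mem_univ _) c hu) (Finset.mem_univ v) ha hv,
    fun w ⟨h1, h2⟩ => ?_⟩
  by_cases hw : col w = some c
  · exact ne_of_nb_eq_zero (h.same u (Finset.mem_univ _) c hu) (Finset.mem_univ w) h1 hw
  · have h3 := h.slot w (Finset.mem_univ _) c hw
    have h4 : nb G Finset.univ col w (some c) ≤ 1 := by omega
    exact hne (Finset.card_le_one.1 h4 u
      (Finset.mem_filter.2 ⟨Finset.mem_univ _, h1.symm, hu⟩) v
      (Finset.mem_filter.2 ⟨Finset.mem_univ _, h2, hv⟩))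

end

/-- If a finite simple graph has maximum average degree at most 8/3 (every nonempty
vertex subset `A` spans at most `4|A|/3` edges), then it has an FII-partition. -/
theorem hasFIIPartition_of_mad_le_eight_thirds {V : Type*} [Fintype V]
    (G : SimpleGraph V)
    (hmad : ∀ A : Finset V, A.Nonempty → 3 * edgesIn G A ≤ 4 * A.card) :
    HasFIIPartition G := by
  obtain ⟨col, κ, hraw, -⟩ := exists_st (G := G) _ Finset.univ (fun _ => 0) rfl
    (fun v _ => Nat.zero_le _) fun C _ => by
      rcases C.eq_empty_or_nonempty with rfl | hC
      · rw [rho_empty]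
      · have h1 := hmad C hC
        have h2 : (0 : LV).wt = 4 := rfl
        simp only [rho, h2, Finset.sum_const, nsmul_eq_mul]
        omega
  refine ⟨{v | col v = none}, {v | col v = some true}, {v | col v = some false}, fun v => ?_,
    ?_, ?_, ?_, isAcyclic_of_peel fun S hne hS => ?_, hraw.twoIndepSet true,
    hraw.twoIndepSet false⟩
  · rcases h : col v with _ | _ | _ <;> simp [h]
  · exact Set.disjoint_left.2 fun v h1 h2 => by simp_all
  · exact Set.disjoint_left.2 fun v h1 h2 => by simp_all
  · exact Set.disjoint_left.2 fun v h1 h2 => by simp_all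
  · obtain ⟨v, hv, h⟩ := hraw.peel S (Finset.subset_univ S) hne hS
    exact ⟨v, hv, by omega⟩
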